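/- arXiv:0809.2501 — 4 statements merged into one kernel-verified Lean document; each statement's English description precedes it below -/
import Mathlib

section
/- If q = 1/p with p an integer ≥ 2 and r ≥ 1 is a natural number, then the number ∑_{k=1}^∞ k q^{rk}/(1-q^k) is irrational. -/
open Filter Topology

lemma hasSum_congr_aux {E : Type*} [AddCommMonoid E] [TopologicalSpace E] {f g : ℕ → E} {x : E}
    (h : ∀ k, f k = g k) : HasSum f x ↔ HasSum g x := by
  rw [funext h]

lemma pent_a_ge (k : ℕ) : k ≤ pentagonal (-(k:ℤ)) := by
  have := two_mul_natCast_pentagonal_neg k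
  zify; nlinarith
lemma pent_b_ge (k : ℕ) : k ≤ pentagonal ((k:ℤ)+1) := by
  have := two_mul_natCast_pentagonal (k+1)
  zify; nlinarith

lemma pent_term_bound (x : ℂ) (ρ : ℝ) (hρ : ρ ≤ 1) (hx : ‖x‖ ≤ ρ) (k : ℕ) :
    ‖(-1) ^ k * (x ^ pentagonal (-(k:ℤ)) - x ^ pentagonal ((k:ℤ) + 1))‖ ≤ 2 * ρ ^ k := by
  have h0 : 0 ≤ ρ := (norm_nonneg _).trans hx
  have h (m : ℕ) (hm : k ≤ m) : ‖x ^ m‖ ≤ ρ ^ k := by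
    rw [norm_pow]
    exact (pow_le_pow_left₀ (norm_nonneg _) hx m).trans (pow_le_pow_of_le_one h0 hρ hm)
  have h1 := h _ (pent_a_ge k)
  have h2 := h _ (pent_b_ge k)
  rw [norm_mul, norm_pow, norm_neg, norm_one, one_pow, one_mul]
  exact (norm_sub_le _ _).trans (by linarith)

lemma prod_bound (x : ℂ) (hx : ‖x‖ < 1) (k n : ℕ) :
    ‖∏ i ∈ Finset.range n, (1 - x ^ (k + i + 1))‖ ≤ Real.exp (1 - ‖x‖)⁻¹ := by
  rw [norm_prod]
  calc _ ≤ ∏ i ∈ Finset.range n, Real.exp (‖x‖ ^ i) := by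
        apply Finset.prod_le_prod
        · intros; positivity
        intro i _
        have h1 : ‖x ^ (k + i + 1)‖ ≤ ‖x‖ ^ i := by
          rw [norm_pow]
          exact pow_le_pow_of_le_one (norm_nonneg _) hx.le (by omega)
        have h2 := norm_sub_le (1:ℂ) (x ^ (k + i + 1))
        have h3 := Real.add_one_le_exp (‖x‖ ^ i)
        rw [norm_one] at h2
        linarith
    _ = Real.exp (∑ i ∈ Finset.range n, ‖x‖ ^ i) := (Real.exp_sum _ _).symm
    _ ≤ _ := by
        apply Real.exp_le_exp.mpr
        rw [← tsum_geometric_of_lt_one (norm_nonneg _) hx]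
        exact (summable_geometric_of_lt_one (norm_nonneg _) hx).sum_le_tsum _ (fun _ _ => by positivity)

lemma pentagonal_complex (x : ℂ) (hx : ‖x‖ < 1) :
    ∏' n : ℕ, (1 - x ^ (n + 1)) =
      ∑' k : ℕ, (-1) ^ k * (x ^ pentagonal (-(k:ℤ)) - x ^ pentagonal ((k:ℤ) + 1)) := by
  have hg := summable_geometric_of_lt_one (norm_nonneg x) hx
  have hb (k n : ℕ) : ‖x ^ ((k + 1) * n) * ∏ i ∈ Finset.range (n + 1), (1 - x ^ (k + i + 1))‖
      ≤ ‖x‖ ^ n * Real.exp (1 - ‖x‖)⁻¹ := by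
    rw [norm_mul, norm_pow]
    apply mul_le_mul _ (prod_bound x hx _ _) (norm_nonneg _) (by positivity)
    exact pow_le_pow_of_le_one (norm_nonneg _) hx.le (by nlinarith)
  apply Pentagonal.tprod_one_sub_pow
  · exact tendsto_pow_atTop_nhds_zero_of_norm_lt_one hx
  · intro k
    exact Summable.of_norm_bounded (hg.mul_right _) (hb k)
  · intro k
    have : Summable fun n : ℕ => ‖-x ^ (n + k + 1)‖ := by
      simp_rw [norm_neg, norm_pow, add_assoc]
      exact (summable_nat_add_iff (k+1)).mpr hg
    simpa [sub_eq_add_neg] using multipliable_one_add_of_summable this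
  · exact Summable.of_norm_bounded (hg.mul_left 2) (pent_term_bound x _ hx.le le_rfl)
  · set C := ∑' n : ℕ, ‖x‖ ^ n * Real.exp (1 - ‖x‖)⁻¹
    apply squeeze_zero_norm (a := fun k : ℕ => ‖x‖ ^ k * C)
    · intro k
      rw [norm_mul]
      apply mul_le_mul _ (tsum_of_norm_bounded (hg.mul_right _).hasSum (hb k)) (norm_nonneg _)
        (by positivity)
      rw [norm_mul, norm_pow, norm_pow, norm_neg, norm_one, one_pow, one_mul]
      apply pow_le_pow_of_le_one (norm_nonneg _) hx.le
      rw [Nat.le_div_iff_mul_le (by norm_num)]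
      nlinarith
    · simpa using (tendsto_pow_atTop_nhds_zero_of_lt_one (norm_nonneg x) hx).mul_const C

lemma key_complex (x : ℂ) (hx : ‖x‖ < 1) (hx0 : x ≠ 0) :
    HasSum (fun k : ℕ => (-1) ^ k *
      ((∑' n : ℕ, (n + 1 : ℂ) * x ^ (n + 1) / (1 - x ^ (n + 1)) + pentagonal (-(k:ℤ))) *
          x ^ pentagonal (-(k:ℤ)) -
        (∑' n : ℕ, (n + 1 : ℂ) * x ^ (n + 1) / (1 - x ^ (n + 1)) + pentagonal ((k:ℤ) + 1)) *
          x ^ pentagonal ((k:ℤ) + 1))) 0 := by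
  set S := ∑' n : ℕ, (n + 1 : ℂ) * x ^ (n + 1) / (1 - x ^ (n + 1)) with hS
  have hg := summable_geometric_of_lt_one (norm_nonneg x) hx
  set F : ℂ → ℂ := fun y => ∑' k : ℕ, (-1) ^ k * (y ^ pentagonal (-(k:ℤ)) - y ^ pentagonal ((k:ℤ) + 1)) with hF
  set P : ℂ → ℂ := fun y => ∏' n : ℕ, (1 - y ^ (n + 1)) with hP
  have hPF : P =ᶠ[𝓝 x] F := by
    filter_upwards [Metric.isOpen_ball.mem_nhds (show x ∈ Metric.ball (0:ℂ) 1 by simpa using hx)] with y hy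
    exact pentagonal_complex y (by simpa using hy)
  obtain ⟨ρ, hρ1, hρ2⟩ := exists_between hx
  have hρ0 : 0 ≤ ρ := (norm_nonneg x).trans hρ1.le
  have hderiv : HasSum (fun k : ℕ => deriv (fun y : ℂ => (-1) ^ k * (y ^ pentagonal (-(k:ℤ)) - y ^ pentagonal ((k:ℤ) + 1))) x) (deriv F x) := by
    apply Complex.hasSum_deriv_of_summable_norm (U := Metric.ball 0 ρ)
      ((summable_geometric_of_lt_one hρ0 hρ2).mul_left 2)
    · intro i; fun_prop
    · exact Metric.isOpen_ball
    · intro i w hw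
      exact pent_term_bound w ρ hρ2.le (by simpa using (le_of_lt (by simpa using hw))) i
    · simpa using hρ1
  have hne (n : ℕ) : 1 - x ^ (n + 1) ≠ 0 := by
    intro h
    have h1 : ‖x ^ (n+1)‖ = 1 := by rw [← sub_eq_zero.mp h, norm_one]
    rw [norm_pow] at h1
    have := pow_lt_one₀ (norm_nonneg x) hx (Nat.succ_ne_zero n)
    exact absurd h1 this.ne
  have hP0 : P x ≠ 0 := by
    have := tprod_one_add_ne_zero_of_summable (f := fun n : ℕ => - x ^ (n + 1))
      (by simpa [← sub_eq_add_neg] using hne)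
      (by simpa using (summable_nat_add_iff 1).mpr hg)
    simpa [← sub_eq_add_neg] using this
  have hld (n : ℕ) : logDeriv (fun y : ℂ => 1 - y ^ (n + 1)) x =
      - x⁻¹ * ((n + 1 : ℂ) * x ^ (n + 1) / (1 - x ^ (n + 1))) := by
    have h := hne n
    have hd : deriv (fun y : ℂ => 1 - y ^ (n + 1)) x = -((n + 1 : ℂ) * x ^ n) := by
      simp
    rw [logDeriv_apply, hd]
    field_simp
    ring
  have hsum : Summable fun n : ℕ => (n + 1 : ℂ) * x ^ (n + 1) / (1 - x ^ (n + 1)) := by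
    have := summable_norm_pow_mul_geometric_div_one_sub 1 hx
    simpa using ((summable_nat_add_iff 1).mpr this)
  have hL : logDeriv P x = - x⁻¹ * S := by
    rw [hP, logDeriv_tprod_eq_tsum (s := Metric.ball 0 1) Metric.isOpen_ball (by simpa using hx) hne
      (by intro i; fun_prop) (by simp_rw [hld]; exact hsum.mul_left _)
      ModularForm.multipliableLocallyUniformlyOn_one_sub_pow hP0]
    simp_rw [hld]
    rw [tsum_mul_left]
  have hFP : F x = P x := hPF.symm.eq_of_nhds
  have hdF : x * deriv F x = - S * F x := by
    rw [← hPF.deriv_eq, hFP]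
    rw [logDeriv_apply, div_eq_iff hP0] at hL
    rw [hL]; field_simp
  have hFs : HasSum (fun k : ℕ => (-1) ^ k * (x ^ pentagonal (-(k:ℤ)) - x ^ pentagonal ((k:ℤ) + 1))) (F x) :=
    (Summable.of_norm_bounded (hg.mul_left 2) (pent_term_bound x _ hx.le le_rfl)).hasSum
  have h := (hFs.mul_left S).add (hderiv.mul_left x)
  rw [hdF, show S * F x + -S * F x = 0 by ring] at h
  have hm (m : ℕ) : x * (m * x ^ (m - 1)) = m * x ^ m := by
    cases m with
    | zero => simp
    | succ m => simp [pow_succ]; ring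
  refine (hasSum_congr_aux fun k => ?_).mpr h
  have hd : deriv (fun y : ℂ => (-1) ^ k * (y ^ pentagonal (-(k:ℤ)) - y ^ pentagonal ((k:ℤ) + 1))) x
    = (-1) ^ k * (pentagonal (-(k:ℤ)) * x ^ (pentagonal (-(k:ℤ)) - 1) - pentagonal ((k:ℤ)+1) * x ^ (pentagonal ((k:ℤ)+1) - 1)) := by
    rw [deriv_const_mul _ (by fun_prop), deriv_fun_sub (by fun_prop) (by fun_prop)]
    simp
  rw [hd]
  linear_combination -(-1) ^ k * hm (pentagonal (-(k:ℤ))) + (-1) ^ k * hm (pentagonal ((k:ℤ)+1))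

lemma key_real (x : ℝ) (hx : x < 1) (hx0 : 0 < x) :
    HasSum (fun k : ℕ => (-1) ^ k *
      ((∑' n : ℕ, (n + 1 : ℝ) * x ^ (n + 1) / (1 - x ^ (n + 1)) + pentagonal (-(k:ℤ))) *
          x ^ pentagonal (-(k:ℤ)) -
        (∑' n : ℕ, (n + 1 : ℝ) * x ^ (n + 1) / (1 - x ^ (n + 1)) + pentagonal ((k:ℤ) + 1)) *
          x ^ pentagonal ((k:ℤ) + 1))) 0 := by
  have h := key_complex (x : ℂ) (by simpa [abs_of_pos hx0] using hx) (by exact_mod_cast hx0.ne')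
  rw [← Complex.hasSum_ofReal]
  push_cast
  exact h

/-- The lacunary series argument. -/
lemma lacunary (p : ℕ) (hp : 2 ≤ p) (A B : ℤ) (hA : 0 ≤ A) (hB : 0 < B)
    (h : HasSum (fun k : ℕ => (-1 : ℝ) ^ k *
      ((A + B * pentagonal (-(k:ℤ))) * ((1:ℝ) / p) ^ pentagonal (-(k:ℤ)) -
        (A + B * pentagonal ((k:ℤ) + 1)) * ((1:ℝ) / p) ^ pentagonal ((k:ℤ) + 1))) 0) : False := by
  set a : ℕ → ℕ := fun k => pentagonal (-(k:ℤ)) with ha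
  set e : ℕ → ℕ := fun k => pentagonal (k:ℤ) with he
  have hea (k : ℕ) : a k = e k + k := by
    have h1 := two_mul_natCast_pentagonal k
    have h2 := two_mul_natCast_pentagonal_neg k
    simp only [ha, he]; zify; nlinarith
  have hee (k : ℕ) : e (k + 1) = e k + (3 * k + 1) := by
    have h1 := two_mul_natCast_pentagonal k
    have h2 := two_mul_natCast_pentagonal (k + 1)
    simp only [he]; zify; nlinarith
  have hb (k : ℕ) : pentagonal ((k:ℤ) + 1) = e (k + 1) := by simp [he]
  have hmono : Monotone e := monotone_nat_of_le_succ (fun n => by rw [hee]; omega)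
  have hele (k : ℕ) : e k ≤ 2 * k ^ 2 := by
    have h1 := two_mul_natCast_pentagonal k
    simp only [he]; zify; nlinarith
  have hege (k : ℕ) : k ≤ e k := by
    induction k with
    | zero => simp
    | succ n ih => rw [hee]; omega
  have hp0 : (0:ℝ) < p := by positivity
  have hp2 : (2:ℝ) ≤ p := by exact_mod_cast hp
  set q : ℝ := (1:ℝ) / p with hq
  have hq0 : 0 < q := by positivity
  have hq1 : q < 1 := by rw [hq, div_lt_one hp0]; linarith
  have hpq : (p:ℝ) * q = 1 := by rw [hq]; field_simp
  have hpqm (m n : ℕ) : (p:ℝ) ^ m * q ^ (m + n) = q ^ n := by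
    rw [pow_add, ← mul_assoc, ← mul_pow, hpq, one_pow, one_mul]
  have hpqm' (m n : ℕ) : (p:ℝ) ^ (m + n) * q ^ m = p ^ n := by
    rw [pow_add, mul_right_comm, ← mul_pow, hpq, one_pow, one_mul]
  set c : ℕ → ℝ := fun k => (-1 : ℝ) ^ k *
      ((A + B * a k) * q ^ a k - (A + B * e (k+1)) * q ^ e (k+1)) with hc
  replace h : HasSum c 0 := by
    refine (hasSum_congr_aux fun k => ?_).mpr h
    rw [hb]
  have hA' : (0:ℝ) ≤ A := by exact_mod_cast hA
  have hB' : (0:ℝ) < B := by exact_mod_cast hB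
  -- bound
  set g : ℕ → ℝ := fun k => (2 * A + 10 * B) * q ^ k + 10 * B * ((k:ℝ) ^ 2 * q ^ k) with hgdef
  have hgs : Summable g := by
    have hqn : ‖q‖ < 1 := by rwa [Real.norm_of_nonneg hq0.le]
    exact ((summable_geometric_of_lt_one hq0.le hq1).mul_left _).add
      ((summable_pow_mul_geometric_of_norm_lt_one 2 hqn).mul_left _)
  have hbound (k : ℕ) : ‖(p:ℝ) ^ e k * c k‖ ≤ g k := by
    have h1 : (p:ℝ) ^ e k * c k = (-1 : ℝ) ^ k *
        ((A + B * a k) * q ^ k - (A + B * e (k+1)) * q ^ (3 * k + 1)) := by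
      rw [← hpqm (e k) k, ← hpqm (e k) (3 * k + 1), ← hea, ← hee]
      simp only [hc]; ring
    have h2 : q ^ (3 * k + 1) ≤ q ^ k := pow_le_pow_of_le_one hq0.le hq1.le (by omega)
    have h3 : (a k : ℝ) ≤ 2 * k ^ 2 + k := by
      rw [hea]; exact_mod_cast Nat.add_le_add_right (hele k) k
    have h4 : (e (k + 1) : ℝ) ≤ 2 * (k + 1) ^ 2 := by exact_mod_cast hele (k + 1)
    have hqk : 0 < q ^ k := by positivity
    have hk2 : (k:ℝ) ≤ k ^ 2 := by exact_mod_cast Nat.le_self_pow (by norm_num) k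
    rw [h1, norm_mul, norm_pow, norm_neg, norm_one, one_pow, one_mul]
    calc _ ≤ ‖(A + B * a k) * q ^ k‖ + ‖(A + B * e (k+1)) * q ^ (3 * k + 1)‖ := norm_sub_le _ _
      _ = (A + B * a k) * q ^ k + (A + B * e (k+1)) * q ^ (3 * k + 1) := by
          rw [Real.norm_of_nonneg (by positivity), Real.norm_of_nonneg (by positivity)]
      _ ≤ (A + B * a k) * q ^ k + (A + B * e (k+1)) * q ^ k := by gcongr
      _ = (2 * A + B * (a k + e (k + 1))) * q ^ k := by ring
      _ ≤ (2 * A + B * (10 + 10 * k ^ 2)) * q ^ k := by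
          apply mul_le_mul_of_nonneg_right _ hqk.le
          have : (a k + e (k + 1) : ℝ) ≤ 10 + 10 * k ^ 2 := by nlinarith
          gcongr
      _ = g k := by simp only [hgdef]; ring
  -- integrality
  have hintegral (N : ℕ) : ∃ z : ℤ, (p:ℝ) ^ e N * ∑ k ∈ Finset.range N, c k = z := by
    have hk : ∀ k ∈ Finset.range N, ∃ z : ℤ, (p:ℝ) ^ e N * c k = z := by
      intro k hk
      have hkN := Finset.mem_range.mp hk
      have h1 : e (k + 1) ≤ e N := hmono hkN
      have h2 : a k ≤ e N := by rw [hee] at h1; rw [hea]; omega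
      obtain ⟨u, hu⟩ := Nat.exists_eq_add_of_le h1
      obtain ⟨v, hv⟩ := Nat.exists_eq_add_of_le h2
      refine ⟨(-1) ^ k * ((A + B * a k) * p ^ v - (A + B * e (k+1)) * p ^ u), ?_⟩
      push_cast
      have h3 := hpqm' (a k) v
      have h4 := hpqm' (e (k+1)) u
      rw [← hv] at h3
      rw [← hu] at h4
      rw [← h3, ← h4]
      simp only [hc]; ring
    choose! z hz using hk
    refine ⟨∑ k ∈ Finset.range N, z k, ?_⟩
    rw [Finset.mul_sum]; push_cast
    exact Finset.sum_congr rfl hz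
  have hsmall : ∀ᶠ N in atTop, ∑' k, g (k + N) < 1 :=
    (tendsto_sum_nat_add g).eventually_lt_const one_pos
  have hzero : ∀ᶠ N in atTop, ∑ k ∈ Finset.range N, c k = 0 := by
    filter_upwards [hsmall] with N hN
    have h1 := h.summable.sum_add_tsum_nat_add N
    rw [h.tsum_eq] at h1
    obtain ⟨z, hz⟩ := hintegral N
    have h2 : ‖∑' k, (p:ℝ) ^ e N * c (k + N)‖ ≤ ∑' k, g (k + N) := by
      apply tsum_of_norm_bounded ((summable_nat_add_iff N).mpr hgs).hasSum
      intro k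
      refine le_trans ?_ (hbound (k + N))
      rw [norm_mul _ (c (k + N)), norm_mul _ (c (k + N))]
      apply mul_le_mul_of_nonneg_right _ (norm_nonneg _)
      rw [Real.norm_of_nonneg (by positivity), Real.norm_of_nonneg (by positivity)]
      exact pow_le_pow_right₀ (by linarith) (hmono (by omega))
    rw [tsum_mul_left] at h2
    have h3 : (p:ℝ) ^ e N * ∑' k, c (k + N) = -z := by rw [← hz]; linear_combination (p:ℝ) ^ e N * h1
    rw [h3, norm_neg, Real.norm_eq_abs] at h2
    have h4 : |(z:ℝ)| < 1 := h2.trans_lt hN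
    have h5 : z = 0 := by
      rw [← Int.abs_lt_one_iff]; exact_mod_cast h4
    rw [h5] at hz
    have : (p:ℝ) ^ e N ≠ 0 := by positivity
    simpa [this, hp0.ne'] using hz
  obtain ⟨N0, hN0⟩ := eventually_atTop.mp hzero
  set N := N0 + 1
  have h1 := hN0 N (by omega)
  have h2 := hN0 (N + 1) (by omega)
  rw [Finset.sum_range_succ, h1, zero_add] at h2
  have h3 : (A + B * a N) * q ^ a N = (A + B * e (N+1)) * q ^ e (N+1) := by
    have : (-1:ℝ) ^ N ≠ 0 := by positivity
    simp only [hc] at h2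
    exact sub_eq_zero.mp ((mul_eq_zero.mp h2).resolve_left this)
  have h4 : e (N + 1) = a N + (2 * N + 1) := by rw [hee, hea]; omega
  have h5 : (A + B * a N : ℝ) = (A + B * e (N+1)) * q ^ (2 * N + 1) := by
    rw [h4] at h3 ⊢
    rw [pow_add, ← mul_assoc, mul_right_comm] at h3
    exact mul_right_cancel₀ (by positivity) h3
  have h6 : q ^ (2 * N + 1) ≤ 1 / 8 := by
    have : q ≤ 1 / 2 := by rw [hq]; gcongr
    calc _ ≤ q ^ 3 := pow_le_pow_of_le_one hq0.le hq1.le (by omega)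
      _ ≤ (1/2) ^ 3 := by gcongr
      _ = 1 / 8 := by norm_num
  have h7 : N + N ≤ a N := by rw [hea]; have := hege N; omega
  have h8 : (e (N + 1) : ℝ) ≤ 2 * a N + 1 := by
    have : e (N + 1) ≤ 2 * a N + 1 := by omega
    exact_mod_cast this
  have h9 : (2:ℝ) ≤ a N := by
    have : 2 ≤ a N := by omega
    exact_mod_cast this
  have h10 : (A + B * a N : ℝ) ≤ (A + B * (2 * a N + 1)) * (1 / 8) := by
    rw [h5]; gcongr
  nlinarith

lemma series_succ (q : ℝ) (hq0 : 0 < q) (hq1 : q < 1) (r : ℕ) :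
    Summable (fun k : ℕ => (k + 1 : ℝ) * q ^ ((r + 1) * (k + 1)) / (1 - q ^ (k + 1))) ∧
    ∑' k : ℕ, (k + 1 : ℝ) * q ^ (k + 1) / (1 - q ^ (k + 1)) =
    ∑' k : ℕ, (k + 1 : ℝ) * q ^ ((r + 1) * (k + 1)) / (1 - q ^ (k + 1)) +
      ∑ i ∈ Finset.range r, q ^ (i + 1) / (1 - q ^ (i + 1)) ^ 2 := by
  induction r with
  | zero =>
    simp only [zero_add, one_mul, Finset.range_zero, Finset.sum_empty, add_zero, and_true]
    have := summable_norm_pow_mul_geometric_div_one_sub (𝕜 := ℝ) 1 (r := q) (by rwa [Real.norm_of_nonneg hq0.le])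
    simpa using ((summable_nat_add_iff 1).mpr this)
  | succ r ih =>
    obtain ⟨ih1, ih2⟩ := ih
    have hQ : q ^ (r + 1) < 1 := pow_lt_one₀ hq0.le hq1 (by omega)
    have hg : HasSum (fun k : ℕ => (k + 1 : ℝ) * (q ^ (r + 1)) ^ (k + 1))
        (q ^ (r + 1) / (1 - q ^ (r + 1)) ^ 2) := by
      have := hasSum_coe_mul_geometric_of_norm_lt_one (𝕜 := ℝ) (r := q ^ (r + 1))
        (by rwa [Real.norm_of_nonneg (by positivity)])
      rw [← hasSum_nat_add_iff' 1] at this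
      simpa using this
    have hs := ih1.hasSum.sub hg
    have heq : (fun k : ℕ => (k + 1 : ℝ) * q ^ ((r + 1) * (k + 1)) / (1 - q ^ (k + 1)) -
        (k + 1 : ℝ) * (q ^ (r + 1)) ^ (k + 1)) =
        fun k : ℕ => (k + 1 : ℝ) * q ^ ((r + 1 + 1) * (k + 1)) / (1 - q ^ (k + 1)) := by
      ext k
      have : 1 - q ^ (k + 1) ≠ 0 := by
        have := pow_lt_one₀ hq0.le hq1 (Nat.succ_ne_zero k)
        exact (sub_pos.mpr this).ne'
      rw [← pow_mul, add_mul (r + 1) 1 (k + 1), one_mul, pow_add q ((r + 1) * (k + 1))]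
      field_simp
      ring
    rw [heq] at hs
    refine ⟨hs.summable, ?_⟩
    rw [hs.tsum_eq, ih2, Finset.sum_range_succ]
    ring

theorem irrational_q_series (p : ℕ) (hp : 2 ≤ p) (r : ℕ) (hr : 1 ≤ r) :
    Irrational (∑' k : ℕ, (k + 1 : ℝ) * ((1 : ℝ) / p) ^ (r * (k + 1)) /
      (1 - ((1 : ℝ) / p) ^ (k + 1))) := by
  have hp2 : (2:ℝ) ≤ p := by exact_mod_cast hp
  have hq0 : (0:ℝ) < 1 / p := by positivity
  have hq1 : (1:ℝ) / p < 1 := by rw [div_lt_one (by linarith)]; linarith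
  obtain ⟨r, rfl⟩ := Nat.exists_eq_add_of_le' hr
  have h1 := (series_succ _ hq0 hq1 r).2
  have h2 := key_real _ hq1 hq0
  rintro ⟨s, hs⟩
  rw [← hs] at h1
  have h3 : ∃ t : ℚ, ∑' k : ℕ, (k + 1 : ℝ) * ((1:ℝ) / p) ^ (k + 1) / (1 - ((1:ℝ) / p) ^ (k + 1)) = t :=
    ⟨s + ∑ i ∈ Finset.range r, ((1:ℚ) / p) ^ (i + 1) / (1 - ((1:ℚ) / p) ^ (i + 1)) ^ 2, by
      rw [h1]; push_cast; rfl⟩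
  obtain ⟨t, ht⟩ := h3
  have ht0 : 0 ≤ t := by
    have : (0:ℝ) ≤ t := by
      rw [← ht]
      apply tsum_nonneg
      intro k
      have := pow_lt_one₀ hq0.le hq1 (Nat.succ_ne_zero k)
      have := sub_pos.mpr this
      positivity
    exact_mod_cast this
  rw [ht] at h2
  refine lacunary p hp t.num t.den (Rat.num_nonneg.mpr ht0) (by exact_mod_cast t.den_pos) ?_
  have h3 := h2.mul_left (t.den : ℝ)
  rw [mul_zero] at h3
  have h4 : (t.num : ℝ) = t.den * t := by
    exact_mod_cast (Rat.den_mul_eq_num t).symm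
  refine (hasSum_congr_aux fun k => ?_).mpr h3
  rw [h4]
  push_cast
  ring
end

section
/- For every natural number n ≥ 0 and 0 < q < 1, ∑_{j=0}^n q^{j²−2nj} [n+j,n]_q ([n,j]_q)² · ( n + ∑_{k=1}^{n+j} 1/(1−q^k) − 3∑_{k=1}^{j} 1/(1−q^k) + 2∑_{k=1}^{n-j} q^k/(1−q^k) ) = 0. -/
/-- The q-Pochhammer symbol `(a;q)_n = ∏_{j=0}^{n-1} (1 - a q^j)`. -/
noncomputable def qPoch (a q : ℝ) (n : ℕ) : ℝ := ∏ j ∈ Finset.range n, (1 - a * q ^ j)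

/-- The q-binomial coefficient `[m,k]_q`. -/
noncomputable def qBinom (q : ℝ) (m k : ℕ) : ℝ := qPoch q q m / (qPoch q q k * qPoch q q (m - k))

open Polynomial
lemma logder {ι : Type*} [DecidableEq ι] (s : Finset ι) (f : ι → ℝ[X]) (x : ℝ)
    (h : ∀ i ∈ s, (f i).eval x ≠ 0) :
    (derivative (∏ i ∈ s, f i)).eval x
      = (∏ i ∈ s, (f i).eval x) * ∑ i ∈ s, (derivative (f i)).eval x / (f i).eval x := by
  induction s using Finset.induction_on with
  | empty => simp
  | insert a s ha ih =>
    have h1 := h a (Finset.mem_insert_self _ _)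
    rw [Finset.prod_insert ha, Finset.prod_insert ha, Finset.sum_insert ha, derivative_mul,
      eval_add, eval_mul, eval_mul, ih (fun i hi => h i (Finset.mem_insert_of_mem hi)), eval_prod]
    field_simp

noncomputable def dd (s : Finset ℕ) (x : ℕ → ℝ) (j : ℕ) : ℝ := ∏ k ∈ s.erase j, (x j - x k)

lemma core (s : Finset ℕ) (x : ℕ → ℝ) (hx : Set.InjOn x s) (P : ℝ[X]) (hP : P.degree < s.card) :
    ∑ j ∈ s, ((derivative P).eval (x j) / (dd s x j) ^ 2
      - 2 * P.eval (x j) / (dd s x j) ^ 2 * ∑ k ∈ s.erase j, 1 / (x j - x k)) = 0 := by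
  have hne : ∀ j ∈ s, ∀ k ∈ s.erase j, x j - x k ≠ 0 := by
    intro j hj k hk h
    rw [Finset.mem_erase] at hk
    exact hk.1 (hx hk.2 hj (by linarith))
  have hd : ∀ j ∈ s, dd s x j ≠ 0 := fun j hj => Finset.prod_ne_zero_iff.mpr (hne j hj)
  have hb : ∀ k, Lagrange.basis s x k = C (dd s x k)⁻¹ * ∏ i ∈ s.erase k, (X - C (x i)) := by
    intro k
    simp only [Lagrange.basis, Lagrange.basisDivisor, Finset.prod_mul_distrib, dd]
    rw [← Finset.prod_inv_distrib, map_prod]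
  have hbj : ∀ j ∈ s, (derivative (Lagrange.basis s x j)).eval (x j)
      = ∑ k ∈ s.erase j, 1 / (x j - x k) := by
    intro j hj
    rw [hb, derivative_C_mul, eval_mul, eval_C, logder]
    · simp only [eval_sub, eval_X, eval_C, derivative_sub, derivative_X, derivative_C, sub_zero,
        eval_one]
      rw [← mul_assoc]
      change (dd s x j)⁻¹ * dd s x j * _ = _
      rw [inv_mul_cancel₀ (hd j hj), one_mul]
    · simpa using hne j hj
  have hbk : ∀ j ∈ s, ∀ k ∈ s.erase j, (derivative (Lagrange.basis s x k)).eval (x j)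
      = dd s x j / (dd s x k * (x j - x k)) := by
    intro j hj k hk
    have hk' := Finset.mem_erase.mp hk
    have hjk : j ∈ s.erase k := Finset.mem_erase.mpr ⟨hk'.1.symm, hj⟩
    rw [hb, derivative_C_mul, eval_mul, eval_C, ← Finset.mul_prod_erase _ _ hjk, derivative_mul]
    have e : dd s x j = (x j - x k) * ∏ i ∈ (s.erase k).erase j, (x j - x i) := by
      rw [dd, ← Finset.mul_prod_erase _ _ hk, Finset.erase_right_comm]
    have := hne j hj k hk
    have := hd k hk'.2
    simp only [eval_add, eval_mul, eval_sub, eval_X, eval_C, derivative_sub, derivative_X,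
      derivative_C, sub_zero, eval_one, sub_self, zero_mul, add_zero, one_mul, eval_prod]
    rw [e]; field_simp
  have key : ∀ R : ℝ[X], R.degree < s.card → ∀ j ∈ s, (derivative R).eval (x j)
      = R.eval (x j) * (∑ k ∈ s.erase j, 1 / (x j - x k))
        + ∑ k ∈ s.erase j, R.eval (x k) * (dd s x j / (dd s x k * (x j - x k))) := by
    intro R hR j hj
    conv_lhs => rw [Lagrange.eq_interpolate hx hR, Lagrange.interpolate_apply]
    rw [derivative_sum, eval_finsetSum, ← Finset.add_sum_erase _ _ hj]
    simp only [derivative_C_mul, eval_mul, eval_C]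
    rw [hbj j hj]
    congr 1
    exact Finset.sum_congr rfl fun k hk => by rw [hbk j hj k hk]
  set A : ℕ → ℕ → ℝ := fun j k => (P.eval (x k) + P.eval (x j)) / (dd s x j * dd s x k * (x j - x k)) with hA
  have step : ∀ j ∈ s, ((derivative P).eval (x j) / (dd s x j) ^ 2
      - 2 * P.eval (x j) / (dd s x j) ^ 2 * ∑ k ∈ s.erase j, 1 / (x j - x k)) = ∑ k ∈ s, A j k := by
    intro j hj
    have h1 := key P hP j hj
    have h2 := key 1 (by
      rw [degree_one]; exact_mod_cast Finset.card_pos.mpr ⟨j, hj⟩) j hj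
    simp only [derivative_one, eval_zero, eval_one, one_mul] at h2
    rw [← Finset.add_sum_erase _ _ hj]
    have h3 : A j j = 0 := by simp [hA]
    have h4 : ∑ k ∈ s.erase j, A j k = (∑ k ∈ s.erase j, P.eval (x k) * (dd s x j / (dd s x k * (x j - x k)))) / dd s x j ^ 2
       + P.eval (x j) / dd s x j ^ 2 * ∑ k ∈ s.erase j, (dd s x j / (dd s x k * (x j - x k))) := by
      rw [Finset.sum_div, Finset.mul_sum, ← Finset.sum_add_distrib]
      refine Finset.sum_congr rfl fun k hk => ?_
      have := hne j hj k hk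
      have := hd j hj
      have := hd k (Finset.mem_erase.mp hk).2
      simp only [hA]; field_simp
    rw [h3, h4, h1]
    linear_combination P.eval (x j) / dd s x j ^ 2 * h2
  rw [Finset.sum_congr rfl step]
  have anti : ∀ j k, A j k = - A k j := by
    intro j k
    simp only [hA]
    rw [← neg_sub (x k) (x j), mul_neg, div_neg, mul_comm (dd s x j), add_comm]
  have h5 : ∑ j ∈ s, ∑ k ∈ s, A j k = - ∑ j ∈ s, ∑ k ∈ s, A j k := by
    conv_lhs => rw [Finset.sum_comm]
    rw [← Finset.sum_neg_distrib]
    refine Finset.sum_congr rfl fun j _ => ?_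
    rw [← Finset.sum_neg_distrib]
    exact Finset.sum_congr rfl fun k _ => anti _ _
  linarith

lemma prod_erase_split {M : Type*} [CommMonoid M] (f : ℕ → M) (n j : ℕ) (hj : j ≤ n) :
    ∏ k ∈ (Finset.range (n + 1)).erase j, f k
      = (∏ k ∈ Finset.range j, f (j - 1 - k)) * ∏ k ∈ Finset.range (n - j), f (j + 1 + k) := by
  have h : (Finset.range (n + 1)).erase j = Finset.range j ∪ Finset.Ico (j + 1) (n + 1) := by
    ext k; simp only [Finset.mem_erase, Finset.mem_range, Finset.mem_union, Finset.mem_Ico]; omega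
  have hdis : Disjoint (Finset.range j) (Finset.Ico (j + 1) (n + 1)) := by
    rw [Finset.disjoint_left]; intro k hk hk'
    simp only [Finset.mem_range, Finset.mem_Ico] at hk hk'; omega
  rw [h, Finset.prod_union hdis, Finset.prod_range_reflect, Finset.prod_Ico_eq_prod_range,
    Nat.add_sub_add_right]

lemma sum_erase_split {M : Type*} [AddCommMonoid M] (f : ℕ → M) (n j : ℕ) (hj : j ≤ n) :
    ∑ k ∈ (Finset.range (n + 1)).erase j, f k
      = (∑ k ∈ Finset.range j, f (j - 1 - k)) + ∑ k ∈ Finset.range (n - j), f (j + 1 + k) := by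
  have h : (Finset.range (n + 1)).erase j = Finset.range j ∪ Finset.Ico (j + 1) (n + 1) := by
    ext k; simp only [Finset.mem_erase, Finset.mem_range, Finset.mem_union, Finset.mem_Ico]; omega
  have hdis : Disjoint (Finset.range j) (Finset.Ico (j + 1) (n + 1)) := by
    rw [Finset.disjoint_left]; intro k hk hk'
    simp only [Finset.mem_range, Finset.mem_Ico] at hk hk'; omega
  rw [h, Finset.sum_union hdis, Finset.sum_range_reflect, Finset.sum_Ico_eq_sum_range,
    Nat.add_sub_add_right]

lemma sum_Icc_shift (f : ℕ → ℝ) (m : ℕ) :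
    ∑ k ∈ Finset.Icc 1 m, f k = ∑ k ∈ Finset.range m, f (k + 1) := by
  induction m with
  | zero => simp
  | succ m ih => rw [Finset.sum_Icc_succ_top (by omega), ih, Finset.sum_range_succ]

lemma qPoch_eq (q : ℝ) (m : ℕ) : qPoch q q m = ∏ k ∈ Finset.range m, (1 - q ^ (k + 1)) := by
  unfold qPoch
  exact Finset.prod_congr rfl fun k _ => by rw [pow_succ, mul_comm]

lemma one_sub_ne (q : ℝ) (hq : 0 < q) (hq1 : q < 1) (k : ℕ) : 1 - q ^ (k + 1) ≠ 0 := by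
  have := pow_lt_one₀ hq.le hq1 (Nat.succ_ne_zero k)
  simp only [Nat.succ_eq_add_one] at this
  linarith

lemma qPoch_ne (q : ℝ) (hq : 0 < q) (hq1 : q < 1) (m : ℕ) : qPoch q q m ≠ 0 := by
  rw [qPoch_eq]
  exact Finset.prod_ne_zero_iff.mpr fun k _ => one_sub_ne q hq hq1 k

lemma dd_sq (q : ℝ) (hq : 0 < q) (n j : ℕ) (hj : j ≤ n) :
    q ^ ((j : ℤ) ^ 2 - 2 * n * j + j) * (dd (Finset.range (n + 1)) (fun k => q ^ k) j) ^ 2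
      = (qPoch q q j * qPoch q q (n - j)) ^ 2 := by
  have h1 : ∏ k ∈ Finset.range j, (q ^ j - q ^ (j - 1 - k))
      = (-1) ^ j * q ^ (∑ k ∈ Finset.range j, k) * qPoch q q j := by
    rw [qPoch_eq, ← Finset.prod_pow_eq_pow_sum, ← Finset.prod_range_reflect (fun k => q ^ k) j]
    have : ((-1 : ℝ)) ^ j = ∏ k ∈ Finset.range j, (-1 : ℝ) := by simp
    rw [this, ← Finset.prod_mul_distrib, ← Finset.prod_mul_distrib]
    refine Finset.prod_congr rfl fun k hk => ?_
    have hk := Finset.mem_range.mp hk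
    have e : q ^ j = q ^ (j - 1 - k) * q ^ (k + 1) := by rw [← pow_add]; congr 1; omega
    rw [e]; ring
  have h2 : ∏ k ∈ Finset.range (n - j), (q ^ j - q ^ (j + 1 + k))
      = q ^ (j * (n - j)) * qPoch q q (n - j) := by
    rw [qPoch_eq, pow_mul]
    have : (q ^ j) ^ (n - j) = ∏ k ∈ Finset.range (n - j), q ^ j := by simp
    rw [this, ← Finset.prod_mul_distrib]
    refine Finset.prod_congr rfl fun k hk => ?_
    ring
  have h3 : dd (Finset.range (n + 1)) (fun k => q ^ k) j ^ 2
      = q ^ (((∑ k ∈ Finset.range j, k) * 2 + j * (n - j) * 2 : ℕ) : ℤ)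
        * (qPoch q q j * qPoch q q (n - j)) ^ 2 := by
    rw [dd, prod_erase_split _ n j hj, h1, h2, zpow_natCast, pow_add, pow_mul, pow_mul]
    have : (((-1 : ℝ)) ^ j) ^ 2 = 1 := by rw [← pow_mul, mul_comm, pow_mul]; simp
    linear_combination (q ^ (∑ k ∈ Finset.range j, k) * qPoch q q j * q ^ (j * (n - j)) * qPoch q q (n - j)) ^ 2 * this
  rw [h3, ← mul_assoc, ← zpow_add₀ hq.ne', Finset.sum_range_id_mul_two]
  have : (j : ℤ) ^ 2 - 2 * n * j + j + ((j * (j - 1) + j * (n - j) * 2 : ℕ) : ℤ) = 0 := by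
    obtain ⟨m, rfl⟩ := Nat.exists_eq_add_of_le hj
    rw [Nat.add_sub_cancel_left]
    cases j with
    | zero => simp
    | succ i => push_cast [Nat.add_sub_cancel]; ring
  rw [this, zpow_zero, one_mul]

theorem q_binomial_identity (q : ℝ) (hq : 0 < q) (hq1 : q < 1) (n : ℕ) :
    ∑ j ∈ Finset.range (n + 1),
      q ^ ((j : ℤ) ^ 2 - 2 * n * j) * qBinom q (n + j) n * (qBinom q n j) ^ 2 *
        ((n : ℝ) + (∑ k ∈ Finset.Icc 1 (n + j), 1 / (1 - q ^ k))
          - 3 * (∑ k ∈ Finset.Icc 1 j, 1 / (1 - q ^ k))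
          + 2 * (∑ k ∈ Finset.Icc 1 (n - j), q ^ k / (1 - q ^ k))) = 0 := by
  set P : ℝ[X] := ∏ i ∈ Finset.range n, (1 - C (q ^ (i + 1)) * X) with hP
  have hdeg : P.degree < (Finset.range (n + 1)).card := by
    rw [Finset.card_range]
    refine lt_of_le_of_lt (degree_prod_le _ _) ?_
    have h : ∑ i ∈ Finset.range n, (1 - C (q ^ (i + 1)) * X : ℝ[X]).degree
        ≤ ∑ i ∈ Finset.range n, (1 : WithBot ℕ) := by
      refine Finset.sum_le_sum fun i _ => ?_
      refine (degree_sub_le _ _).trans (max_le ?_ (degree_C_mul_X_le _))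
      rw [degree_one]; exact zero_le_one
    refine lt_of_le_of_lt h ?_
    simp only [Finset.sum_const, Finset.card_range, nsmul_eq_mul, mul_one]
    exact_mod_cast Nat.lt_succ_self n
  have hinj : Set.InjOn (fun k : ℕ => q ^ k) (Finset.range (n + 1)) :=
    (pow_right_injective₀ hq hq1.ne).injOn
  have hcore := core (Finset.range (n + 1)) (fun k => q ^ k) hinj P hdeg
  rw [← neg_eq_zero, ← mul_zero (qPoch q q n), ← hcore, Finset.mul_sum, ← Finset.sum_neg_distrib]
  refine Finset.sum_congr rfl fun j hj => ?_
  have hj : j ≤ n := Nat.lt_succ_iff.mp (Finset.mem_range.mp hj)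
  have hne := one_sub_ne q hq hq1
  set S : ℕ → ℝ := fun m => ∑ k ∈ Finset.range m, q ^ (k + 1) / (1 - q ^ (k + 1)) with hS
  have hH : ∀ m : ℕ, ∑ k ∈ Finset.range m, 1 / (1 - q ^ (k + 1)) = S m + m := by
    intro m
    have : (m : ℝ) = ∑ k ∈ Finset.range m, (1 : ℝ) := by simp
    rw [this, hS, ← Finset.sum_add_distrib]
    refine Finset.sum_congr rfl fun k _ => ?_
    have := hne k
    field_simp; ring
  have hPe : P.eval (q ^ j) * qPoch q q j = qPoch q q (n + j) := by
    rw [add_comm n j, qPoch_eq, qPoch_eq, Finset.prod_range_add, hP, eval_prod, mul_comm]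
    congr 1
    refine Finset.prod_congr rfl fun i _ => ?_
    simp only [eval_sub, eval_one, eval_mul, eval_C, eval_X]; ring
  have hPd : q ^ j * (derivative P).eval (q ^ j) = - P.eval (q ^ j) * (S (n + j) - S j) := by
    rw [hP, logder]
    · have : S (n + j) - S j = ∑ i ∈ Finset.range n, q ^ (j + i + 1) / (1 - q ^ (j + i + 1)) := by
        simp only [hS]; rw [add_comm n j, Finset.sum_range_add]; ring
      rw [this, eval_prod, mul_left_comm, neg_mul, ← mul_neg, Finset.mul_sum,
        ← Finset.sum_neg_distrib]
      congr 1
      refine Finset.sum_congr rfl fun i _ => ?_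
      simp only [eval_sub, eval_one, eval_mul, eval_C, eval_X, derivative_sub, derivative_one,
        derivative_C_mul, derivative_X, zero_sub, eval_neg, mul_one]
      have e : q ^ (i + 1) * q ^ j = q ^ (j + i + 1) := by ring
      rw [e, neg_div, mul_neg, mul_div_assoc', mul_comm (q ^ j), e]
    · intro i _
      simp only [eval_sub, eval_one, eval_mul, eval_C, eval_X]
      rw [← pow_add, show i + 1 + j = i + j + 1 by ring]
      exact hne _
  have hsig : q ^ j * ∑ k ∈ (Finset.range (n + 1)).erase j, 1 / (q ^ j - q ^ k)
      = - S j + (S (n - j) + (n - j : ℕ)) := by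
    rw [sum_erase_split _ n j hj, mul_add, ← hH, Finset.mul_sum, Finset.mul_sum, hS,
      ← Finset.sum_neg_distrib]
    congr 1
    · refine Finset.sum_congr rfl fun k hk => ?_
      have hk := Finset.mem_range.mp hk
      have e : q ^ j = q ^ (j - 1 - k) * q ^ (k + 1) := by rw [← pow_add]; congr 1; omega
      have h0 : q ^ (j - 1 - k) ≠ 0 := pow_ne_zero _ hq.ne'
      have h1 := hne k
      have e2 : q ^ j - q ^ (j - 1 - k) = - (q ^ (j - 1 - k) * (1 - q ^ (k + 1))) := by rw [e]; ring
      rw [e2, e, div_neg, mul_neg]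
      field_simp
    · refine Finset.sum_congr rfl fun k hk => ?_
      have h0 : q ^ j ≠ 0 := pow_ne_zero _ hq.ne'
      have h1 := hne k
      have e2 : q ^ j - q ^ (j + 1 + k) = q ^ j * (1 - q ^ (k + 1)) := by ring
      rw [e2]
      field_simp
  have hcast : ((n - j : ℕ) : ℝ) = n - j := Nat.cast_sub hj
  rw [sum_Icc_shift (fun k => 1 / (1 - q ^ k)), sum_Icc_shift (fun k => 1 / (1 - q ^ k)),
    sum_Icc_shift (fun k => q ^ k / (1 - q ^ k)), hH, hH]
  change -(_ * (_ + _ - _ + 2 * S (n - j))) = _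
  have hd := dd_sq q hq n j hj
  rw [zpow_add₀ hq.ne', zpow_natCast] at hd
  set Z := q ^ ((j : ℤ) ^ 2 - 2 * n * j) with hZ
  set D := dd (Finset.range (n + 1)) (fun k => q ^ k) j with hD
  set σ := ∑ k ∈ (Finset.range (n + 1)).erase j, 1 / (q ^ j - q ^ k) with hσ
  rw [hcast] at hsig
  have hqj : q ^ j ≠ 0 := pow_ne_zero _ hq.ne'
  have p1 := qPoch_ne q hq hq1 n
  have p2 := qPoch_ne q hq hq1 j
  have p3 := qPoch_ne q hq hq1 (n - j)
  have hD0 : D ≠ 0 := by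
    intro h0
    rw [h0] at hd
    have : (qPoch q q j * qPoch q q (n - j)) ^ 2 ≠ 0 := pow_ne_zero _ (mul_ne_zero p2 p3)
    apply this; rw [← hd]; ring
  have hcoef : Z * qBinom q (n + j) n * (qBinom q n j) ^ 2
      = qPoch q q n * P.eval (q ^ j) / (q ^ j * D ^ 2) := by
    unfold qBinom
    rw [Nat.add_sub_cancel_left, ← hPe, div_pow, ← hd]
    have hZ0 : Z ≠ 0 := zpow_ne_zero _ hq.ne'
    field_simp
  rw [hcoef]
  have hd' : (derivative P).eval (q ^ j) = - P.eval (q ^ j) * (S (n + j) - S j) / q ^ j := by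
    rw [← hPd]; field_simp
  have hs' : σ = (- S j + (S (n - j) + (n - j))) / q ^ j := by
    rw [← hsig]; field_simp
  rw [hd', hs']
  push_cast
  field_simp
  ring
end

section
/- For every natural number n ≥ 0, ∑_{j=0}^n C(n+j, n) · C(n, j)² · (H(n+j) + 2H(n−j) − 3H(j)) = 0, where H(m) = ∑_{k=1}^m 1/k and C denotes the binomial coefficient. -/
open Polynomial in
/-- logarithmic derivative of a nodal polynomial away from its nodes -/
lemma hb_logder (s : Finset ℕ) (v : ℕ → ℝ) (x : ℝ) (hx : ∀ i ∈ s, x ≠ v i) :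
    eval x (derivative (Lagrange.nodal s v))
      = eval x (Lagrange.nodal s v) * ∑ k ∈ s, 1 / (x - v k) := by
  rw [Lagrange.derivative_nodal, eval_finsetSum, Finset.mul_sum]
  refine Finset.sum_congr rfl fun k hk => ?_
  rw [Lagrange.nodal_eq_mul_nodal_erase hk]
  have := sub_ne_zero.mpr (hx k hk)
  simp only [eval_mul, eval_sub, eval_X, eval_C]
  field_simp

open Polynomial in
/-- derivative at a node of a low degree polynomial -/
lemma hb_deriv_node (s : Finset ℕ) (v : ℕ → ℝ) (hv : Function.Injective v) (P : ℝ[X])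
    (hP : P.degree < s.card) (j : ℕ) (hj : j ∈ s) :
    Lagrange.nodalWeight s v j * eval (v j) (derivative P)
      = ∑ i ∈ s.erase j, Lagrange.nodalWeight s v i * eval (v i) P / (v j - v i)
        + Lagrange.nodalWeight s v j * eval (v j) P * ∑ k ∈ s.erase j, 1 / (v j - v k) := by
  have hw : ∀ i ∈ s, Lagrange.nodalWeight s v i ≠ 0 := fun i hi =>
    Lagrange.nodalWeight_ne_zero hv.injOn hi
  have hD : Lagrange.nodalWeight s v j * eval (v j) (Lagrange.nodal (s.erase j) v) = 1 := by
    have := hw j hj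
    rw [Lagrange.nodalWeight_eq_eval_nodal_erase_inv] at this ⊢
    exact inv_mul_cancel₀ (by simpa using this)
  have e1 : P = ∑ i ∈ s, C (Lagrange.nodalWeight s v i * eval (v i) P)
      * Lagrange.nodal (s.erase i) v := by
    conv_lhs => rw [Lagrange.eq_interpolate hv.injOn hP,
      Lagrange.interpolate_eq_nodalWeight_mul_nodal_div_X_sub_C]
    refine Finset.sum_congr rfl fun i hi => ?_
    rw [← Lagrange.nodal_erase_eq_nodal_div hi, C_mul]
    ring
  have e2 : eval (v j) (derivative P) = ∑ i ∈ s, (Lagrange.nodalWeight s v i * eval (v i) P)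
      * eval (v j) (derivative (Lagrange.nodal (s.erase i) v)) := by
    conv_lhs => rw [e1]
    simp [eval_finsetSum, derivative_mul]
  rw [e2, ← Finset.add_sum_erase _ _ hj, mul_add, add_comm]
  congr 1
  · rw [Finset.mul_sum]
    refine Finset.sum_congr rfl fun i hi => ?_
    obtain ⟨hij, his⟩ := Finset.mem_erase.mp hi
    rw [Lagrange.eval_nodal_derivative_eval_node_eq (Finset.mem_erase.mpr ⟨hij.symm, hj⟩),
      Finset.erase_right_comm]
    rw [Lagrange.nodal_eq_mul_nodal_erase hi] at hD
    simp only [eval_mul, eval_sub, eval_X, eval_C] at hD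
    have : v j - v i ≠ 0 := sub_ne_zero.mpr fun h => hij (hv h).symm
    rw [eq_div_iff this]
    linear_combination (Lagrange.nodalWeight s v i * eval (v i) P) * hD
  · rw [hb_logder _ _ _ fun i hi h => (Finset.mem_erase.mp hi).1 (hv h).symm]
    linear_combination (Lagrange.nodalWeight s v j * eval (v j) P *
      ∑ k ∈ s.erase j, 1 / (v j - v k)) * hD

open Polynomial in
/-- the sum of the residues of `P / Q ^ 2` vanishes -/
lemma hb_residue (s : Finset ℕ) (v : ℕ → ℝ) (hv : Function.Injective v) (P : ℝ[X])
    (hP : P.degree < s.card) :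
    ∑ j ∈ s, Lagrange.nodalWeight s v j ^ 2 *
      (eval (v j) (derivative P) - 2 * eval (v j) P * ∑ k ∈ s.erase j, 1 / (v j - v k)) = 0 := by
  set w := Lagrange.nodalWeight s v with hw
  have key : ∀ j ∈ s, w j ^ 2 *
      (eval (v j) (derivative P) - 2 * eval (v j) P * ∑ k ∈ s.erase j, 1 / (v j - v k))
      = ∑ i ∈ s, w i * w j * (eval (v i) P + eval (v j) P) / (v j - v i) := by
    intro j hj
    have h1 := hb_deriv_node s v hv P hP j hj
    have h2 := hb_deriv_node s v hv 1 (by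
      rw [degree_one]; exact_mod_cast Finset.card_pos.mpr ⟨j, hj⟩) j hj
    simp only [derivative_one, eval_zero, eval_one, mul_one, mul_zero] at h2
    rw [← Finset.add_sum_erase _ _ hj]
    have e : ∑ i ∈ s.erase j, w i * w j * (eval (v i) P + eval (v j) P) / (v j - v i)
        = w j * ∑ i ∈ s.erase j, w i * eval (v i) P / (v j - v i)
          + w j * eval (v j) P * ∑ i ∈ s.erase j, w i / (v j - v i) := by
      rw [Finset.mul_sum, Finset.mul_sum, ← Finset.sum_add_distrib]
      exact Finset.sum_congr rfl fun i _ => by ring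
    rw [e, sub_self, div_zero, zero_add]
    rw [← hw] at h1 h2
    linear_combination w j * h1 + w j * eval (v j) P * h2
  rw [Finset.sum_congr rfl key]
  have anti : ∑ j ∈ s, ∑ i ∈ s, w i * w j * (eval (v i) P + eval (v j) P) / (v j - v i)
      = - ∑ j ∈ s, ∑ i ∈ s, w i * w j * (eval (v i) P + eval (v j) P) / (v j - v i) := by
    conv_lhs => rw [Finset.sum_comm]
    rw [← Finset.sum_neg_distrib]
    refine Finset.sum_congr rfl fun j _ => ?_
    rw [← Finset.sum_neg_distrib]
    refine Finset.sum_congr rfl fun i _ => ?_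
    rw [← neg_sub (v j) (v i), div_neg]
    ring
  linarith

lemma hb_erase_succ (j m : ℕ) : (Finset.range (j + (m + 1) + 1)).erase j
    = insert (j + m + 1) ((Finset.range (j + m + 1)).erase j) := by
  ext k; simp only [Finset.mem_erase, Finset.mem_range, Finset.mem_insert]; omega

lemma hb_erase_zero (j : ℕ) : (Finset.range (j + 0 + 1)).erase j = Finset.range j := by
  ext k; simp only [Finset.mem_erase, Finset.mem_range]; omega

lemma hb_sum (j m : ℕ) : ∑ k ∈ (Finset.range (j + m + 1)).erase j, (1 : ℝ) / ((j : ℝ) - k)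
    = (∑ k ∈ Finset.range j, (1 : ℝ) / (k + 1)) - ∑ k ∈ Finset.range m, (1 : ℝ) / (k + 1) := by
  induction m with
  | zero =>
    rw [hb_erase_zero, Finset.sum_range_zero, sub_zero,
      ← Finset.sum_range_reflect (fun k : ℕ => (1 : ℝ) / (k + 1))]
    refine Finset.sum_congr rfl fun k hk => ?_
    have := Finset.mem_range.mp hk
    have h : j = (j - 1 - k) + k + 1 := by omega
    have h' : (j : ℝ) = ((j - 1 - k : ℕ) : ℝ) + k + 1 := by exact_mod_cast h
    congr 1
    linarith
  | succ m ih =>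
    rw [hb_erase_succ, Finset.sum_insert (by simp), ih, Finset.sum_range_succ]
    have : (j : ℝ) - ((j + m + 1 : ℕ) : ℝ) = - ((m : ℝ) + 1) := by push_cast; ring
    rw [this, div_neg]
    ring

lemma hb_prod (j m : ℕ) : (∏ k ∈ (Finset.range (j + m + 1)).erase j, ((j : ℝ) - k)) ^ 2
    = ((j.factorial : ℝ) * m.factorial) ^ 2 := by
  induction m with
  | zero =>
    rw [hb_erase_zero, Nat.factorial_zero, Nat.cast_one, mul_one, ← Finset.prod_range_add_one_eq_factorial]
    congr 1
    rw [Nat.cast_prod, ← Finset.prod_range_reflect]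
    refine Finset.prod_congr rfl fun k hk => ?_
    have := Finset.mem_range.mp hk
    have h : (j - 1 - k) + (k + 1) = j := by omega
    have h' : ((j - 1 - k : ℕ) : ℝ) + (k + 1) = j := by exact_mod_cast h
    push_cast
    linarith
  | succ m ih =>
    rw [hb_erase_succ, Finset.prod_insert (by simp), mul_pow, ih, Nat.factorial_succ]
    push_cast
    ring

theorem harmonic_binomial_identity (n : ℕ) :
    ∑ j ∈ Finset.range (n + 1),
      ((n + j).choose n : ℝ) * ((n.choose j : ℝ)) ^ 2 *
        ((∑ k ∈ Finset.range (n + j), (1 : ℝ) / (k + 1))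
          + 2 * (∑ k ∈ Finset.range (n - j), (1 : ℝ) / (k + 1))
          - 3 * (∑ k ∈ Finset.range j, (1 : ℝ) / (k + 1))) = 0 := by
  have h := hb_residue (Finset.range (n + 1)) (fun i => (i : ℝ)) Nat.cast_injective
    (Lagrange.nodal (Finset.range n) (fun i => -((i : ℝ) + 1)))
    (by rw [Lagrange.degree_nodal, Finset.card_range, Finset.card_range]; exact_mod_cast Nat.lt_succ_self n)
  have h2 := congrArg (fun x => (n.factorial : ℝ) * x) h
  simp only [mul_zero] at h2
  rw [← h2, Finset.mul_sum]
  refine Finset.sum_congr rfl fun j hj => ?_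
  obtain ⟨m, rfl⟩ : ∃ m, n = j + m := ⟨n - j, by have := Finset.mem_range.mp hj; omega⟩
  rw [hb_logder _ _ _ (fun i _ => by
    have : (0 : ℝ) ≤ j := by positivity
    have : (0 : ℝ) ≤ i := by positivity
    intro h; linarith), hb_sum]
  have hw : Lagrange.nodalWeight (Finset.range (j + m + 1)) (fun i => (i : ℝ)) j ^ 2
      = 1 / ((j.factorial : ℝ) * m.factorial) ^ 2 := by
    rw [← hb_prod, Lagrange.nodalWeight, Finset.prod_inv_distrib, inv_pow, one_div]
  have hP : ∀ n : ℕ, Polynomial.eval (j : ℝ) (Lagrange.nodal (Finset.range n) (fun i => -((i : ℝ) + 1)))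
      * j.factorial = (n + j).factorial := by
    intro n
    rw [Lagrange.eval_nodal]
    induction n with
    | zero => simp
    | succ n ih =>
      rw [Finset.prod_range_succ, mul_right_comm, ih, show n + 1 + j = (n + j) + 1 by ring,
        Nat.factorial_succ]
      push_cast
      ring
  have hS : ∀ n : ℕ, ∑ k ∈ Finset.range n, 1 / ((j : ℝ) - -((k : ℝ) + 1))
      = (∑ k ∈ Finset.range (n + j), (1 : ℝ) / (k + 1)) - ∑ k ∈ Finset.range j, (1 : ℝ) / (k + 1) := by
    intro n
    rw [add_comm n j, Finset.sum_range_add, add_sub_cancel_left]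
    refine Finset.sum_congr rfl fun k _ => ?_
    push_cast
    congr 1
    ring
  rw [hw, hS, Nat.add_sub_cancel_left]
  have hP' := hP (j + m)
  set p := Polynomial.eval (j : ℝ) (Lagrange.nodal (Finset.range (j + m)) (fun i => -((i : ℝ) + 1)))
  have hj0 : (j.factorial : ℝ) ≠ 0 := by positivity
  have hm0 : (m.factorial : ℝ) ≠ 0 := by positivity
  have hn0 : ((j + m).factorial : ℝ) ≠ 0 := by positivity
  have c1 : ((j + m + j).choose (j + m) : ℝ) = p / (j + m).factorial := by
    rw [Nat.cast_add_choose, ← hP']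
    field_simp
  have c2 : ((j + m).choose j : ℝ) = (j + m).factorial / (j.factorial * m.factorial) :=
    Nat.cast_add_choose ℝ
  rw [c1, c2]
  field_simp
  ring
end

section
/- Let q = 1/p with p an integer ≥ 2 and let ζ_q(2) = ∑_{k=1}^∞ k q^k/(1 − q^k). Then for ρ = 10π²/(5π² − 24), the inequality |ζ_q(2) − a/b| ≤ |b|^{−ρ} has at most finitely many integer solutions (a, b); in particular the irrationality measure of ζ_q(2) is at most 10π²/(5π² − 24). -/
open Real

lemma zq_dioph (ζ : ℝ) (hζ : ζ ≠ 0) (ρ α β₁ β₂ : ℝ) (hβ₁ : 0 < β₁) (hα : 0 ≤ α) (hβ : β₁ ≤ β₂)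
    (hρ : α + β₂ < ρ * β₁) (A B : ℕ → ℤ) (s0 : ℕ)
    (hB : ∀ s, s0 ≤ s → |(B s : ℝ)| ≤ Real.exp (α * (s : ℝ) ^ 2))
    (hL1 : ∀ s, s0 ≤ s → Real.exp (-(β₂ * (s : ℝ) ^ 2)) ≤ |(B s : ℝ) * ζ - A s|)
    (hL2 : ∀ s, s0 ≤ s → |(B s : ℝ) * ζ - A s| ≤ Real.exp (-(β₁ * (s : ℝ) ^ 2))) :
    {ab : ℤ × ℤ | |ζ - (ab.1 : ℝ) / (ab.2 : ℝ)| ≤ |(ab.2 : ℝ)| ^ (-ρ)}.Finite := by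
  have hρ1 : 1 < ρ := by
    by_contra h
    push Not at h
    nlinarith
  have hquad : ∀ᶠ s : ℕ in Filter.atTop, α * (s : ℝ) ^ 2 + β₂ * (s : ℝ) ^ 2 + ρ * Real.log 2 <
      ρ * (β₁ * ((s : ℝ) - 1) ^ 2) := by
    have h1 : Filter.Tendsto (fun s : ℕ => (s : ℝ)) Filter.atTop Filter.atTop :=
      tendsto_natCast_atTop_atTop
    filter_upwards [h1.eventually_ge_atTop
      ((2 * ρ * β₁ + ρ * Real.log 2 + 1) / (ρ * β₁ - α - β₂)), h1.eventually_ge_atTop 1] with s hs hs1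
    have hd : 0 < ρ * β₁ - α - β₂ := by linarith
    rw [div_le_iff₀ hd] at hs
    have hl : 0 ≤ ρ * Real.log 2 := by
      have := Real.log_nonneg (by norm_num : (1:ℝ) ≤ 2); positivity
    have hpb : 0 < ρ * β₁ := by positivity
    nlinarith [mul_le_mul_of_nonneg_left hs (by linarith : (0:ℝ) ≤ s), mul_nonneg hl (by linarith : (0:ℝ) ≤ (s:ℝ) - 1)]
  obtain ⟨s1, hs1⟩ := Filter.eventually_atTop.1 hquad
  set s2 := max s0 s1 + 1 with hs2
  set Bd : ℝ := Real.exp (β₁ * (s2 : ℝ) ^ 2) with hBd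
  have key : ∀ a b : ℤ, |ζ - (a : ℝ) / (b : ℝ)| ≤ |(b : ℝ)| ^ (-ρ) → b ≠ 0 ∧ |(b : ℝ)| ≤ Bd := by
    intro a b hab
    have hb : b ≠ 0 := by
      rintro rfl
      simp only [Int.cast_zero, div_zero, sub_zero, abs_zero] at hab
      rw [Real.zero_rpow (by linarith)] at hab
      exact hζ (abs_nonpos_iff.1 hab)
    refine ⟨hb, ?_⟩
    by_contra hlt
    push Not at hlt
    have hbR : (b : ℝ) ≠ 0 := by exact_mod_cast hb
    have hb0 : 0 < |(b : ℝ)| := abs_pos.2 hbR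
    have hex : ∃ s : ℕ, |(b : ℝ)| * Real.exp (-(β₁ * (s : ℝ) ^ 2)) < 1 / 2 := by
      have h1 : Filter.Tendsto (fun s : ℕ => β₁ * (s : ℝ) ^ 2) Filter.atTop Filter.atTop := by
        apply Filter.Tendsto.const_mul_atTop hβ₁
        exact (Filter.tendsto_pow_atTop (by norm_num)).comp tendsto_natCast_atTop_atTop
      have h2 : Filter.Tendsto (fun s : ℕ => |(b : ℝ)| * Real.exp (-(β₁ * (s : ℝ) ^ 2)))
          Filter.atTop (nhds (|(b : ℝ)| * 0)) := by
        apply Filter.Tendsto.const_mul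
        exact Real.tendsto_exp_neg_atTop_nhds_zero.comp h1
      rw [mul_zero] at h2
      exact (h2.eventually_lt_const (by norm_num)).exists
    classical
    let s := Nat.find hex
    have hs : |(b : ℝ)| * Real.exp (-(β₁ * (s : ℝ) ^ 2)) < 1 / 2 := Nat.find_spec hex
    have hsmin : ∀ t : ℕ, t < s → 1 / 2 ≤ |(b : ℝ)| * Real.exp (-(β₁ * (t : ℝ) ^ 2)) := by
      intro t ht
      have := Nat.find_min hex ht
      push Not at this
      exact this
    have hss : s2 < s := by
      by_contra hc
      push Not at hc
      have h1 : (s : ℝ) ≤ s2 := by exact_mod_cast hc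
      have h2 : Real.exp (-(β₁ * (s2 : ℝ) ^ 2)) ≤ Real.exp (-(β₁ * (s : ℝ) ^ 2)) := by
        apply Real.exp_le_exp.2
        have : (s : ℝ) ^ 2 ≤ (s2 : ℝ) ^ 2 := by gcongr
        nlinarith
      have h3 : (1 : ℝ) ≤ |(b : ℝ)| * Real.exp (-(β₁ * (s2 : ℝ) ^ 2)) := by
        rw [Real.exp_neg, ← div_eq_mul_inv, le_div_iff₀ (Real.exp_pos _), one_mul]
        exact hlt.le
      nlinarith [mul_le_mul_of_nonneg_left h2 hb0.le]
    have hsge0 : s0 ≤ s := by omega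
    have hsge1 : s1 ≤ s := by omega
    have hs1' : 1 ≤ s := by omega
    have hblow : 1 / 2 * Real.exp (β₁ * ((s : ℝ) - 1) ^ 2) ≤ |(b : ℝ)| := by
      have h := hsmin (s - 1) (by omega)
      rw [Nat.cast_sub hs1', Nat.cast_one, Real.exp_neg, ← div_eq_mul_inv,
        le_div_iff₀ (Real.exp_pos _)] at h
      exact h
    have hmain : 1 / 2 * Real.exp (β₁ * ((s : ℝ) - 1) ^ 2 - β₂ * (s : ℝ) ^ 2 - α * (s : ℝ) ^ 2)
        ≤ |b * ζ - a| := by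
      by_cases hcase : B s * a = A s * b
      · have hcR : (B s : ℝ) * a = A s * b := by exact_mod_cast hcase
        have hL := hL1 s hsge0
        have hLpos : 0 < |(B s : ℝ) * ζ - A s| := lt_of_lt_of_le (Real.exp_pos _) hL
        have hB0 : (B s : ℝ) ≠ 0 := by
          intro h0
          rw [h0] at hcR hLpos
          have : (A s : ℝ) = 0 := by
            have : (A s : ℝ) * b = 0 := by rw [← hcR]; ring
            exact (mul_eq_zero.1 this).resolve_right hbR
          rw [this] at hLpos
          simp at hLpos
        have hBpos : 0 < |(B s : ℝ)| := abs_pos.2 hB0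
        have heq : |(B s : ℝ)| * |b * ζ - a| = |(b : ℝ)| * |(B s : ℝ) * ζ - A s| := by
          rw [← abs_mul, ← abs_mul]
          congr 1
          linear_combination -hcR
        have h1 : 1 / 2 * Real.exp (β₁ * ((s : ℝ) - 1) ^ 2) * Real.exp (-(β₂ * (s : ℝ) ^ 2)) ≤
            Real.exp (α * (s : ℝ) ^ 2) * |b * ζ - a| := by
          calc _ ≤ |(b : ℝ)| * |(B s : ℝ) * ζ - A s| := by gcongr
            _ = |(B s : ℝ)| * |b * ζ - a| := heq.symm
            _ ≤ _ := by gcongr; exact hB s hsge0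
        rw [sub_eq_add_neg, sub_eq_add_neg, Real.exp_add, Real.exp_add, Real.exp_neg (α * _),
          ← mul_assoc, ← mul_assoc, ← div_eq_mul_inv, div_le_iff₀ (Real.exp_pos _)]
        linarith
      · have h1 : (1 : ℝ) ≤ |(B s : ℝ) * a - A s * b| := by
          have : 1 ≤ |B s * a - A s * b| := Int.one_le_abs (sub_ne_zero.2 hcase)
          exact_mod_cast this
        have h2 : (B s : ℝ) * a - A s * b = b * ((B s : ℝ) * ζ - A s) - B s * (b * ζ - a) := by ring
        have h3 : |(B s : ℝ) * a - A s * b| ≤ |(b : ℝ)| * |(B s : ℝ) * ζ - A s| +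
            |(B s : ℝ)| * |b * ζ - a| := by
          rw [h2, ← abs_mul, ← abs_mul]; exact abs_sub _ _
        have h4 : |(b : ℝ)| * |(B s : ℝ) * ζ - A s| ≤ 1 / 2 := by
          refine le_trans ?_ hs.le
          gcongr
          exact hL2 s hsge0
        have h5 : |(B s : ℝ)| * |b * ζ - a| ≤ Real.exp (α * (s : ℝ) ^ 2) * |b * ζ - a| := by
          gcongr; exact hB s hsge0
        have h6 : 1 / 2 ≤ Real.exp (α * (s : ℝ) ^ 2) * |b * ζ - a| := by linarith
        have h7 : Real.exp (β₁ * ((s : ℝ) - 1) ^ 2 - β₂ * (s : ℝ) ^ 2 - α * (s : ℝ) ^ 2) ≤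
            Real.exp (-(α * (s : ℝ) ^ 2)) := by
          apply Real.exp_le_exp.2
          have : ((s : ℝ) - 1) ^ 2 ≤ (s : ℝ) ^ 2 := by
            have : (1 : ℝ) ≤ s := by exact_mod_cast hs1'
            nlinarith
          nlinarith
        refine le_trans (mul_le_mul_of_nonneg_left h7 (by norm_num)) ?_
        rw [Real.exp_neg, ← div_eq_mul_inv, div_le_iff₀ (Real.exp_pos _)]
        linarith
    have hup : |b * ζ - a| ≤ |(b : ℝ)| ^ (1 - ρ) := by
      have : b * ζ - a = b * (ζ - a / b) := by field_simp
      rw [this, abs_mul, sub_eq_add_neg 1 ρ, Real.rpow_add hb0, Real.rpow_one]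
      gcongr
    have hup2 : |(b : ℝ)| ^ (1 - ρ) ≤ (1 / 2 * Real.exp (β₁ * ((s : ℝ) - 1) ^ 2)) ^ (1 - ρ) :=
      Real.rpow_le_rpow_of_nonpos (by positivity) hblow (by linarith)
    have hlog := Real.log_le_log (by positivity) (hmain.trans (hup.trans hup2))
    rw [Real.log_rpow (by positivity), Real.log_mul (by norm_num) (Real.exp_pos _).ne',
      Real.log_mul (by norm_num) (Real.exp_pos _).ne', Real.log_exp, Real.log_exp, one_div,
      Real.log_inv] at hlog
    have hq := hs1 s hsge1
    nlinarith
  set Nn : ℤ := ⌈Bd⌉ with hNn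
  set Mm : ℤ := ⌈Bd * (|ζ| + 1)⌉ with hMm
  apply Set.Finite.subset (Set.Finite.prod (Set.finite_Icc (-Mm) Mm) (Set.finite_Icc (-Nn) Nn))
  rintro ⟨a, b⟩ hab
  simp only [Set.mem_ofPred_eq] at hab
  obtain ⟨hb, hbB⟩ := key a b hab
  have hbR : (b : ℝ) ≠ 0 := by exact_mod_cast hb
  have hb1 : (1 : ℝ) ≤ |(b : ℝ)| := by
    have : 1 ≤ |b| := Int.one_le_abs hb
    exact_mod_cast this
  have h1 : |(b : ℝ)| ^ (-ρ) ≤ 1 := Real.rpow_le_one_of_one_le_of_nonpos hb1 (by linarith)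
  have h2 : |(a : ℝ) / b| ≤ |ζ| + 1 := by
    have := abs_sub_abs_le_abs_sub ((a : ℝ) / b) ζ
    rw [abs_sub_comm] at this
    linarith
  have h3 : |(a : ℝ)| ≤ Bd * (|ζ| + 1) := by
    rw [abs_div, div_le_iff₀ (by linarith)] at h2
    calc _ ≤ _ := h2
      _ = |(b : ℝ)| * (|ζ| + 1) := by ring
      _ ≤ _ := by gcongr
  have h4 : |a| ≤ Mm := by
    have : ((|a| : ℤ) : ℝ) ≤ Mm := by push_cast; exact h3.trans (Int.le_ceil _)
    exact_mod_cast this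
  have h5 : |b| ≤ Nn := by
    have : ((|b| : ℤ) : ℝ) ≤ Nn := by push_cast; exact hbB.trans (Int.le_ceil _)
    exact_mod_cast this
  rw [abs_le] at h4 h5
  exact ⟨⟨h4.1, h4.2⟩, ⟨h5.1, h5.2⟩⟩


noncomputable def zqCyc (p l : ℕ) : ℕ := ((Polynomial.cyclotomic l ℤ).eval (p : ℤ)).toNat

lemma zqCyc_cast (p l : ℕ) (hp : 2 ≤ p) :
    ((zqCyc p l : ℕ) : ℤ) = (Polynomial.cyclotomic l ℤ).eval (p : ℤ) := by
  unfold zqCyc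
  rw [Int.toNat_of_nonneg]
  exact Polynomial.cyclotomic_nonneg l (by exact_mod_cast (by omega : 1 ≤ p))

lemma zqCyc_pos (p l : ℕ) (hp : 2 ≤ p) : 0 < zqCyc p l := by
  have h := zqCyc_cast p l hp
  have h2 := Polynomial.cyclotomic_pos' l (by exact_mod_cast (by omega : 1 < p) : (1 : ℤ) < (p : ℤ))
  rw [← h] at h2
  exact_mod_cast h2

lemma zqCyc_prod (p k : ℕ) (hp : 2 ≤ p) (hk : 0 < k) :
    ∏ l ∈ k.divisors, zqCyc p l = p ^ k - 1 := by
  have h := Polynomial.prod_cyclotomic_eq_X_pow_sub_one hk ℤ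
  have h2 := congrArg (Polynomial.eval (p : ℤ)) h
  rw [Polynomial.eval_prod] at h2
  simp only [Polynomial.eval_sub, Polynomial.eval_pow, Polynomial.eval_X, Polynomial.eval_one] at h2
  have h3 : ((∏ l ∈ k.divisors, zqCyc p l : ℕ) : ℤ) = ((p ^ k - 1 : ℕ) : ℤ) := by
    rw [Nat.cast_sub (Nat.one_le_pow _ _ (by omega))]
    push_cast
    rw [← h2]
    exact Finset.prod_congr rfl fun l _ => zqCyc_cast p l hp
  exact_mod_cast h3

noncomputable def zqW (p l : ℕ) : ℝ := Real.log (zqCyc p l)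
noncomputable def zqPsi (p n : ℕ) : ℝ := ∑ l ∈ Finset.Ioc 0 n, zqW p l
noncomputable def zqG (p k : ℕ) : ℝ := Real.log ((p : ℝ) ^ k - 1)
noncomputable def zqS (p n : ℕ) : ℝ := ∑ k ∈ Finset.Ioc 0 n, zqG p k

lemma zqW_sum (p k : ℕ) (hp : 2 ≤ p) (hk : 0 < k) : ∑ l ∈ k.divisors, zqW p l = zqG p k := by
  unfold zqW zqG
  rw [← Real.log_prod (fun l _ => by exact_mod_cast (zqCyc_pos p l hp).ne')]
  congr 1
  have := zqCyc_prod p k hp hk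
  have h2 : ((∏ l ∈ k.divisors, zqCyc p l : ℕ) : ℝ) = ((p ^ k - 1 : ℕ) : ℝ) := by rw [this]
  rw [Nat.cast_sub (Nat.one_le_pow _ _ (by omega))] at h2
  push_cast at h2
  exact h2

open ArithmeticFunction in
lemma zqS_eq (p n : ℕ) (hp : 2 ≤ p) :
    zqS p n = ∑ l ∈ Finset.Ioc 0 n, zqW p l * ((n / l : ℕ) : ℝ) := by
  let f : ArithmeticFunction ℝ := ⟨fun l => if l = 0 then 0 else zqW p l, by simp⟩
  have h := sum_Ioc_mul_zeta_eq_sum f n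
  have h2 : ∑ l ∈ Finset.Ioc 0 n, f l * ((n / l : ℕ) : ℝ) =
      ∑ l ∈ Finset.Ioc 0 n, zqW p l * ((n / l : ℕ) : ℝ) := by
    refine Finset.sum_congr rfl fun l hl => ?_
    have : l ≠ 0 := (Finset.mem_Ioc.1 hl).1.ne'
    simp [f, this]
  rw [← h2, ← h]
  unfold zqS
  refine Finset.sum_congr rfl fun k hk => ?_
  have hk' : 0 < k := (Finset.mem_Ioc.1 hk).1
  rw [coe_mul_zeta_apply, ← zqW_sum p k hp hk']
  refine Finset.sum_congr rfl fun l hl => ?_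
  have : l ≠ 0 := (Nat.pos_of_mem_divisors hl).ne'
  simp [f, this]

lemma zqS_eq' (p n L : ℕ) (hp : 2 ≤ p) (hL : n ≤ L) :
    zqS p n = ∑ l ∈ Finset.Ioc 0 L, zqW p l * ((n / l : ℕ) : ℝ) := by
  rw [zqS_eq p n hp]
  apply Finset.sum_subset (Finset.Ioc_subset_Ioc_right hL)
  intro l hl hl2
  simp only [Finset.mem_Ioc] at hl hl2
  rw [Nat.div_eq_of_lt (by omega)]
  simp

lemma zqPsi_eq' (p n L : ℕ) (hL : n ≤ L) :
    zqPsi p n = ∑ l ∈ Finset.Ioc 0 L, zqW p l * (if l ≤ n then 1 else 0 : ℝ) := by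
  unfold zqPsi
  simp only [mul_ite, mul_one, mul_zero]
  rw [← Finset.sum_filter]
  congr 1
  ext l
  simp only [Finset.mem_Ioc, Finset.mem_filter]
  omega

open ArithmeticFunction ArithmeticFunction.Moebius in
lemma zqPsi_moebius (p n : ℕ) (hp : 2 ≤ p) :
    zqPsi p n = ∑ m ∈ Finset.Ioc 0 n, (μ m : ℝ) * zqS p (n / m) := by
  have hinv := (sum_eq_iff_sum_mul_moebius_eq (f := zqW p) (g := zqG p)).1
    (fun k hk => zqW_sum p k hp hk)
  let g : ArithmeticFunction ℝ := ⟨fun l => if l = 0 then 0 else zqG p l, by simp⟩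
  have h := sum_Ioc_mul_eq_sum_sum ((μ : ArithmeticFunction ℤ) : ArithmeticFunction ℝ) g n
  unfold zqPsi
  trans ∑ k ∈ Finset.Ioc 0 n, (((μ : ArithmeticFunction ℤ) : ArithmeticFunction ℝ) * g) k
  · refine Finset.sum_congr rfl fun k hk => ?_
    have hk' : 0 < k := (Finset.mem_Ioc.1 hk).1
    rw [mul_apply, ← hinv k hk']
    refine Finset.sum_congr rfl fun x hx => ?_
    have : x.2 ≠ 0 := by
      rintro h0
      rw [Nat.mem_divisorsAntidiagonal, h0] at hx
      simp at hx; omega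
    simp [g, this]
  · rw [h]
    refine Finset.sum_congr rfl fun m _ => ?_
    congr 1
    unfold zqS
    refine Finset.sum_congr rfl fun k hk => ?_
    have hk' : k ≠ 0 := (Finset.mem_Ioc.1 hk).1.ne'
    simp [g, hk']

lemma zqG_bounds (p k : ℕ) (hp : 2 ≤ p) (hk : 0 < k) :
    k * Real.log p - Real.log 2 ≤ zqG p k ∧ zqG p k ≤ k * Real.log p ∧ 0 ≤ zqG p k := by
  have hp' : (2 : ℝ) ≤ p := by exact_mod_cast hp
  have h2 : (2 : ℝ) ≤ (p : ℝ) ^ k := by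
    calc (2 : ℝ) ≤ p := hp'
      _ = (p : ℝ) ^ 1 := (pow_one _).symm
      _ ≤ (p : ℝ) ^ k := pow_le_pow_right₀ (by linarith) hk
  unfold zqG
  refine ⟨?_, ?_, Real.log_nonneg (by linarith)⟩
  · rw [← Real.log_pow, ← Real.log_div (by positivity) (by norm_num)]
    apply Real.log_le_log (by positivity)
    linarith
  · rw [← Real.log_pow]
    apply Real.log_le_log (by linarith)
    linarith

lemma zq_sum_id (n : ℕ) : ∑ k ∈ Finset.Ioc 0 n, (k : ℝ) = n * (n + 1) / 2 := by
  induction n with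
  | zero => simp
  | succ n ih =>
    rw [Finset.sum_Ioc_succ_top (by omega), ih]; push_cast; ring

lemma zqS_bounds (p n : ℕ) (hp : 2 ≤ p) :
    (n * (n + 1) / 2) * Real.log p - n * Real.log 2 ≤ zqS p n ∧
      zqS p n ≤ (n * (n + 1) / 2) * Real.log p ∧ 0 ≤ zqS p n := by
  unfold zqS
  refine ⟨?_, ?_, ?_⟩
  · rw [← zq_sum_id, Finset.sum_mul]
    have : (n : ℝ) * Real.log 2 = ∑ k ∈ Finset.Ioc 0 n, Real.log 2 := by simp
    rw [this, ← Finset.sum_sub_distrib]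
    exact Finset.sum_le_sum fun k hk => (zqG_bounds p k hp (Finset.mem_Ioc.1 hk).1).1
  · rw [← zq_sum_id, Finset.sum_mul]
    exact Finset.sum_le_sum fun k hk => (zqG_bounds p k hp (Finset.mem_Ioc.1 hk).1).2.1
  · exact Finset.sum_nonneg fun k hk => (zqG_bounds p k hp (Finset.mem_Ioc.1 hk).1).2.2

open Filter Topology in
lemma zqS_tendsto (p : ℕ) (hp : 2 ≤ p) :
    Tendsto (fun n : ℕ => zqS p n / (n : ℝ) ^ 2) atTop (𝓝 (Real.log p / 2)) := by
  have hinv : Tendsto (fun n : ℕ => ((n : ℝ))⁻¹) atTop (𝓝 0) := tendsto_inv_atTop_nhds_zero_nat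
  have hlow : Tendsto (fun n : ℕ => (1 + (n : ℝ)⁻¹) / 2 * Real.log p - (n : ℝ)⁻¹ * Real.log 2)
      atTop (𝓝 ((1 + 0) / 2 * Real.log p - 0 * Real.log 2)) :=
    (((hinv.const_add 1).div_const 2).mul_const _).sub (hinv.mul_const _)
  have hup : Tendsto (fun n : ℕ => (1 + (n : ℝ)⁻¹) / 2 * Real.log p)
      atTop (𝓝 ((1 + 0) / 2 * Real.log p)) :=
    (((hinv.const_add 1).div_const 2).mul_const _)
  have e1 : (1 + 0) / 2 * Real.log p - 0 * Real.log 2 = Real.log p / 2 := by ring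
  have e2 : (1 + 0) / 2 * Real.log p = Real.log p / 2 := by ring
  rw [e1] at hlow
  rw [e2] at hup
  refine tendsto_of_tendsto_of_tendsto_of_le_of_le' hlow hup ?_ ?_
  · filter_upwards [eventually_gt_atTop 0] with n hn
    have hn' : (0 : ℝ) < n := by exact_mod_cast hn
    rw [le_div_iff₀ (by positivity)]
    refine le_trans (le_of_eq ?_) (zqS_bounds p n hp).1
    field_simp
  · filter_upwards [eventually_gt_atTop 0] with n hn
    have hn' : (0 : ℝ) < n := by exact_mod_cast hn
    rw [div_le_iff₀ (by positivity)]
    refine le_trans (zqS_bounds p n hp).2.1 (le_of_eq ?_)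
    field_simp

open ArithmeticFunction ArithmeticFunction.Moebius in
lemma zq_moebius_sum : ∑' m : ℕ, (μ m : ℝ) / (m : ℝ) ^ 2 = 6 / π ^ 2 := by
  have h := ArithmeticFunction.LSeries_zeta_mul_Lseries_moebius (s := 2) (by norm_num)
  rw [ArithmeticFunction.LSeries_zeta_eq_riemannZeta (by norm_num), riemannZeta_two] at h
  have h2 : LSeries (fun n => ((μ n : ℤ) : ℂ)) 2 =
      ((∑' m : ℕ, (μ m : ℝ) / (m : ℝ) ^ 2 : ℝ) : ℂ) := by
    unfold LSeries
    rw [Complex.ofReal_tsum]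
    refine tsum_congr fun m => ?_
    rw [LSeries.term_def]
    split_ifs with h0
    · simp [h0]
    · push_cast
      congr 1
      exact_mod_cast Complex.cpow_natCast (m : ℂ) 2
  rw [h2] at h
  have h3 : π ^ 2 / 6 * (∑' m : ℕ, (μ m : ℝ) / (m : ℝ) ^ 2 : ℝ) = 1 := by exact_mod_cast h
  have hpi : π ^ 2 ≠ 0 := by positivity
  field_simp at h3 ⊢
  linarith

open Filter Topology ArithmeticFunction ArithmeticFunction.Moebius in
lemma zqPsi_tendsto (p : ℕ) (hp : 2 ≤ p) :
    Tendsto (fun n : ℕ => zqPsi p n / (n : ℝ) ^ 2) atTop (𝓝 (3 / π ^ 2 * Real.log p)) := by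
  have hp' : (2 : ℝ) ≤ p := by exact_mod_cast hp
  have hlp : 0 ≤ Real.log p := Real.log_nonneg (by linarith)
  have hmu : ∀ m : ℕ, |(μ m : ℝ)| ≤ 1 := fun m => by
    have := ArithmeticFunction.abs_moebius_le_one (n := m)
    exact_mod_cast this
  have key := tendsto_tsum_of_dominated_convergence (𝓕 := (atTop : Filter ℕ))
    (f := fun n m : ℕ => (μ m : ℝ) * zqS p (n / m) / (n : ℝ) ^ 2)
    (g := fun m : ℕ => (μ m : ℝ) / (m : ℝ) ^ 2 * (Real.log p / 2))
    (bound := fun m : ℕ => Real.log p * (1 / (m : ℝ) ^ 2))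
    ((Real.summable_one_div_nat_pow.2 (by norm_num)).mul_left _) ?_ ?_
  · rw [tsum_mul_right, zq_moebius_sum] at key
    have e : 6 / π ^ 2 * (Real.log p / 2) = 3 / π ^ 2 * Real.log p := by ring
    rw [e] at key
    refine key.congr fun n => ?_
    rw [zqPsi_moebius p n hp, Finset.sum_div]
    apply tsum_eq_sum
    intro m hm
    rw [Finset.mem_Ioc] at hm
    have : n / m = 0 := by
      rcases Nat.eq_zero_or_pos m with h | h
      · simp [h]
      · exact Nat.div_eq_of_lt (by omega)
    rw [this]
    simp [zqS]
  · intro m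
    rcases Nat.eq_zero_or_pos m with h | h
    · simp [h]
    have hm : (0 : ℝ) < m := by exact_mod_cast h
    have h1 : Tendsto (fun n : ℕ => n / m) atTop atTop := Nat.tendsto_div_const_atTop h.ne'
    have h2 := (zqS_tendsto p hp).comp h1
    have h3 : Tendsto (fun n : ℕ => ((n / m : ℕ) : ℝ) / n) atTop (𝓝 (1 / m)) := by
      have h4 := (tendsto_nat_floor_mul_div_atTop (R := ℝ) (a := 1 / (m : ℝ)) (by positivity)).comp
        (tendsto_natCast_atTop_atTop (R := ℝ))
      refine h4.congr fun n => ?_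
      simp only [Function.comp]
      rw [one_div, inv_mul_eq_div, Nat.floor_div_natCast, Nat.floor_natCast]
    have h5 := ((h3.pow 2).mul h2).const_mul (μ m : ℝ)
    have e : (μ m : ℝ) * ((1 / (m : ℝ)) ^ 2 * (Real.log p / 2)) =
        (μ m : ℝ) / (m : ℝ) ^ 2 * (Real.log p / 2) := by
      field_simp
    rw [e] at h5
    refine h5.congr' ?_
    filter_upwards [eventually_ge_atTop m] with n hn
    have hn' : (0 : ℝ) < n := by exact_mod_cast (by omega : 0 < n)
    have hnm : (0 : ℝ) < ((n / m : ℕ) : ℝ) := by exact_mod_cast Nat.div_pos hn h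
    simp only [Function.comp]
    field_simp
  · filter_upwards [eventually_gt_atTop 0] with n hn m
    have hn' : (0 : ℝ) < n := by exact_mod_cast hn
    rcases Nat.eq_zero_or_pos m with h | h
    · simp [h]
    have hm : (0 : ℝ) < m := by exact_mod_cast h
    rw [Real.norm_eq_abs, abs_div, abs_mul, abs_of_nonneg (zqS_bounds p _ hp).2.2,
      abs_of_nonneg (by positivity : (0 : ℝ) ≤ (n : ℝ) ^ 2), div_le_iff₀ (by positivity)]
    have hS : zqS p (n / m) ≤ ((n / m : ℕ) : ℝ) ^ 2 * Real.log p := by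
      refine le_trans (zqS_bounds p _ hp).2.1 ?_
      gcongr
      have : ((n / m : ℕ) : ℝ) ≤ ((n / m : ℕ) : ℝ) ^ 2 := by
        exact_mod_cast Nat.le_self_pow (by norm_num) _
      nlinarith
    have hd : ((n / m : ℕ) : ℝ) ≤ n / m := Nat.cast_div_le
    calc |(μ m : ℝ)| * zqS p (n / m) ≤ 1 * (((n / m : ℕ) : ℝ) ^ 2 * Real.log p) := by
          gcongr
          · exact (zqS_bounds p _ hp).2.2
          · exact hmu m
      _ ≤ 1 * (((n : ℝ) / m) ^ 2 * Real.log p) := by gcongr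
      _ = _ := by field_simp

open Filter Topology in
lemma zq_tendsto_scale (f : ℕ → ℝ) (c : ℝ) (k : ℕ) (hk : 0 < k)
    (h : Tendsto (fun n : ℕ => f n / (n : ℝ) ^ 2) atTop (𝓝 c)) :
    Tendsto (fun s : ℕ => f (k * s) / (s : ℝ) ^ 2) atTop (𝓝 ((k : ℝ) ^ 2 * c)) := by
  have hk' : (0 : ℝ) < k := by exact_mod_cast hk
  have h1 : Tendsto (fun s : ℕ => k * s) atTop atTop := tendsto_id.const_mul_atTop' hk
  have h2 := (h.comp h1).const_mul ((k : ℝ) ^ 2)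
  refine h2.congr' ?_
  filter_upwards [eventually_gt_atTop 0] with s hs
  have hs' : (0 : ℝ) < s := by exact_mod_cast hs
  simp only [Function.comp]
  push_cast
  field_simp


open Polynomial in
def zqE (a : ℝ) (f : Polynomial ℝ) (u v : ℝ) : Prop :=
  (X - C a) ^ 2 ∣ f - C u * (1 + C v * (X - C a))

open Polynomial in
lemma zqE_mul (a : ℝ) (f g : Polynomial ℝ) (u v u' v' : ℝ) (hf : zqE a f u v) (hg : zqE a g u' v') :
    zqE a (f * g) (u * u') (v + v') := by
  obtain ⟨A, hA⟩ := hf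
  obtain ⟨B, hB⟩ := hg
  refine ⟨A * g + C u * (1 + C v * (X - C a)) * B + C u * C u' * C v * C v', ?_⟩
  have h1 : f = (X - C a) ^ 2 * A + C u * (1 + C v * (X - C a)) := by rw [← hA]; ring
  have h2 : g = (X - C a) ^ 2 * B + C u' * (1 + C v' * (X - C a)) := by rw [← hB]; ring
  rw [h1, h2]
  simp only [C_mul, C_add]
  ring

open Polynomial in
lemma zqE_one (a : ℝ) : zqE a 1 1 0 := by
  refine ⟨0, ?_⟩
  simp

open Polynomial in
lemma zqE_lin (a b : ℝ) (h : a ≠ b) : zqE a (X - C b) (a - b) (1 / (a - b)) := by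
  refine ⟨0, ?_⟩
  have h1 : a - b ≠ 0 := sub_ne_zero.2 h
  have h2 : C (a - b) * C (1 / (a - b)) = (1 : Polynomial ℝ) := by
    rw [← C_mul, mul_one_div_cancel h1, C_1]
  have : C (a - b) * (1 + C (1 / (a - b)) * (X - C a)) = C (a - b) +
      (C (a - b) * C (1 / (a - b))) * (X - C a) := by ring
  rw [this, h2]
  simp only [C_sub]
  ring

open Polynomial in
lemma zqE_pow (a b : ℝ) (h : a ≠ b) (m : ℕ) :
    zqE a ((X - C b) ^ m) ((a - b) ^ m) (m / (a - b)) := by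
  induction m with
  | zero => simpa using zqE_one a
  | succ m ih =>
    have := zqE_mul a _ _ _ _ _ _ ih (zqE_lin a b h)
    rw [pow_succ, pow_succ]
    convert this using 1
    push_cast; ring

open Polynomial in
lemma zqE_prod (a : ℝ) (s : Finset ℕ) (x : ℕ → ℝ) (m : ℕ → ℕ) (h : ∀ k ∈ s, a ≠ x k) :
    zqE a (∏ k ∈ s, (X - C (x k)) ^ m k) (∏ k ∈ s, (a - x k) ^ m k)
      (∑ k ∈ s, (m k : ℝ) / (a - x k)) := by
  classical
  induction s using Finset.induction_on with
  | empty => simpa using zqE_one a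
  | insert i s hi ih =>
    rw [Finset.prod_insert hi, Finset.prod_insert hi, Finset.sum_insert hi]
    exact zqE_mul a _ _ _ _ _ _ (zqE_pow a (x i) (h i (Finset.mem_insert_self _ _)) _)
      (ih fun k hk => h k (Finset.mem_insert_of_mem hk))

open Polynomial in
lemma zqE_eval (a : ℝ) (f : Polynomial ℝ) (u v : ℝ) (hf : zqE a f u v) : f.eval a = u := by
  obtain ⟨A, hA⟩ := hf
  have := congrArg (Polynomial.eval a) hA
  simp at this
  linarith

open Polynomial in
lemma zq_hermite (U : Finset ℕ) (x : ℕ → ℝ) (hx : ∀ i ∈ U, ∀ j ∈ U, i ≠ j → x i ≠ x j)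
    (m : ℕ → ℕ) (hm : ∀ j ∈ U, m j = 1 ∨ m j = 2) (F : Polynomial ℝ)
    (hF : F.degree < ((∑ j ∈ U, m j : ℕ) : WithBot ℕ)) (uF vF : ℕ → ℝ)
    (h : ∀ j ∈ U, zqE (x j) F (uF j) (vF j)) (y : ℝ) :
    F.eval y = ∑ j ∈ U, (uF j / ∏ k ∈ U.erase j, (x j - x k) ^ m k) *
      (if m j = 2 then 1 + (vF j - ∑ k ∈ U.erase j, (m k : ℝ) / (x j - x k)) * (y - x j) else 1) *
      ∏ k ∈ U.erase j, (y - x k) ^ m k := by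
  classical
  set c : ℕ → ℝ := fun j => uF j / ∏ k ∈ U.erase j, (x j - x k) ^ m k with hc
  set σ : ℕ → ℝ := fun j => vF j - ∑ k ∈ U.erase j, (m k : ℝ) / (x j - x k) with hσ
  set T : ℕ → Polynomial ℝ := fun j => ∏ k ∈ U.erase j, (X - C (x k)) ^ m k with hT
  set G : ℕ → Polynomial ℝ := fun j => C (c j) * (if m j = 2 then 1 + C (σ j) * (X - C (x j)) else 1)
    with hG
  set Q : Polynomial ℝ := ∏ k ∈ U, (X - C (x k)) ^ m k with hQ
  have hQT : ∀ j ∈ U, (X - C (x j)) ^ m j * T j = Q := fun j hj =>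
    Finset.mul_prod_erase U (fun k => (X - C (x k)) ^ m k) hj
  have hQmon : Q.Monic := monic_prod_of_monic _ _ fun k _ => (monic_X_sub_C _).pow _
  have hQdeg : Q.degree = ((∑ j ∈ U, m j : ℕ) : WithBot ℕ) := by
    rw [hQ, degree_prod]
    simp [degree_pow]
  have hne : ∀ j ∈ U, ∏ k ∈ U.erase j, (x j - x k) ^ m k ≠ 0 := by
    intro j hj
    refine Finset.prod_ne_zero_iff.2 fun k hk => pow_ne_zero _ (sub_ne_zero.2 ?_)
    exact hx j hj k (Finset.mem_of_mem_erase hk) (Finset.ne_of_mem_erase hk).symm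
  have hmain : F = ∑ j ∈ U, G j * T j := by
    rw [← sub_eq_zero]
    apply eq_zero_of_dvd_of_degree_lt (p := Q)
    · apply Finset.prod_dvd_of_coprime
      · intro i hi j hj hij
        exact ((pairwise_coprime_X_sub_C (s := fun k : U => x k) (by
          intro a b hab
          by_contra hne
          exact hx a a.2 b b.2 (fun h => hne (Subtype.ext h)) hab)) (i := ⟨i, hi⟩) (j := ⟨j, hj⟩)
          (fun h => hij (congrArg Subtype.val h))).pow
      · intro i hi
        rw [← Finset.add_sum_erase U _ hi, ← sub_sub]
        apply dvd_sub
        · have hTE : zqE (x i) (T i) (∏ k ∈ U.erase i, (x i - x k) ^ m k)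
              (∑ k ∈ U.erase i, (m k : ℝ) / (x i - x k)) := by
            apply zqE_prod
            intro k hk
            exact hx i hi k (Finset.mem_of_mem_erase hk) (Finset.ne_of_mem_erase hk).symm
          have hcc : c i * (∏ k ∈ U.erase i, (x i - x k) ^ m k) = uF i :=
            div_mul_cancel₀ _ (hne i hi)
          rcases hm i hi with h1 | h2
          · rw [h1, pow_one, dvd_iff_isRoot]
            simp only [hG, h1]
            have e1 := zqE_eval _ _ _ _ (h i hi)
            have e2 := zqE_eval _ _ _ _ hTE
            simp [e1, e2, hcc]
          · rw [h2]
            have hGE : zqE (x i) (G i) (c i) (σ i) := ⟨0, by simp [hG, h2]⟩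
            have hGT := zqE_mul _ _ _ _ _ _ _ hGE hTE
            rw [hcc] at hGT
            have hv : σ i + ∑ k ∈ U.erase i, (m k : ℝ) / (x i - x k) = vF i := by
              simp [hσ]
            rw [hv] at hGT
            have := dvd_sub (h i hi) hGT
            rwa [sub_sub_sub_cancel_right] at this
        · apply Finset.dvd_sum
          intro j hj
          apply Dvd.dvd.mul_left
          apply Finset.dvd_prod_of_mem (fun k => (X - C (x k)) ^ m k)
          exact Finset.mem_erase.2 ⟨(Finset.ne_of_mem_erase hj).symm, hi⟩
    · rw [hQdeg]
      refine lt_of_le_of_lt (degree_sub_le _ _) (max_lt hF ?_)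
      rw [← hQdeg]
      refine (Finset.sup_lt_iff ?_).2 ?_ |> lt_of_le_of_lt (degree_sum_le _ _)
      · exact bot_lt_iff_ne_bot.2 (degree_ne_bot.2 hQmon.ne_zero)
      · intro j hj
        rw [← hQT j hj, degree_mul (p := G j), degree_mul (p := (X - C (x j)) ^ m j)]
        have hTn : (T j).Monic := monic_prod_of_monic _ _ fun k _ => (monic_X_sub_C _).pow _
        have hTd : (T j).degree ≠ ⊥ := degree_ne_bot.2 hTn.ne_zero
        rw [degree_eq_natDegree hTn.ne_zero, degree_pow, degree_X_sub_C]
        refine WithBot.add_lt_add_right (by simp) ?_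
        simp only [hG]
        refine lt_of_le_of_lt (degree_mul_le _ _) ?_
        refine lt_of_le_of_lt (add_le_add degree_C_le le_rfl) ?_
        rw [zero_add]
        rcases hm j hj with h1 | h2
        · simp [h1]
        · simp only [h2, if_true]
          have : (1 + C (σ j) * (X - C (x j))).degree ≤ 1 := by
            compute_degree
          refine lt_of_le_of_lt this ?_
          norm_num
  conv_lhs => rw [hmain]
  rw [eval_finsetSum]
  refine Finset.sum_congr rfl fun j hj => ?_
  rw [eval_mul, hG, hT]
  simp only [eval_mul, eval_C, eval_prod, eval_pow, eval_sub, eval_X]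
  congr 2
  split_ifs
  · simp only [eval_add, eval_one, eval_mul, eval_C, eval_sub, eval_X]
    rfl
  · simp


noncomputable def zqf1 (u : ℝ) : ℝ := u / (1 - u)
noncomputable def zqf2 (u : ℝ) : ℝ := u / (1 - u) ^ 2

noncomputable def zqZ (p : ℕ) : ℝ :=
  ∑' k : ℕ, (k + 1 : ℝ) * ((1 : ℝ) / p) ^ (k + 1) / (1 - ((1 : ℝ) / p) ^ (k + 1))

lemma zq_q_bounds (p : ℕ) (hp : 2 ≤ p) : 0 < (1 : ℝ) / p ∧ (1 : ℝ) / p ≤ 1 / 2 := by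
  have hp' : (2 : ℝ) ≤ p := by exact_mod_cast hp
  exact ⟨by positivity, one_div_le_one_div_of_le (by norm_num) hp'⟩

lemma zq_qpow_bounds (p : ℕ) (hp : 2 ≤ p) (k : ℕ) :
    0 < ((1 : ℝ) / p) ^ (k + 1) ∧ ((1 : ℝ) / p) ^ (k + 1) ≤ 1 / 2 := by
  obtain ⟨h0, h1⟩ := zq_q_bounds p hp
  refine ⟨by positivity, ?_⟩
  rw [pow_succ]
  have : ((1 : ℝ) / p) ^ k ≤ 1 := pow_le_one₀ h0.le (by linarith)
  nlinarith

lemma zq_f1_summable (p : ℕ) (hp : 2 ≤ p) :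
    Summable (fun i : ℕ => zqf1 (((1 : ℝ) / p) ^ (i + 1))) := by
  obtain ⟨h0, h1⟩ := zq_q_bounds p hp
  have hs : Summable (fun i : ℕ => 2 * ((1 : ℝ) / p) ^ (i + 1)) :=
    (((summable_geometric_of_lt_one h0.le (by linarith)).comp_injective
      (add_left_injective 1))).mul_left 2
  refine Summable.of_nonneg_of_le (fun i => ?_) (fun i => ?_) hs
  · obtain ⟨a, b⟩ := zq_qpow_bounds p hp i
    exact div_nonneg a.le (by linarith)
  · obtain ⟨a, b⟩ := zq_qpow_bounds p hp i
    unfold zqf1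
    rw [div_le_iff₀ (by linarith)]
    nlinarith

lemma zq_f2_summable (p : ℕ) (hp : 2 ≤ p) :
    Summable (fun i : ℕ => zqf2 (((1 : ℝ) / p) ^ (i + 1))) := by
  obtain ⟨h0, h1⟩ := zq_q_bounds p hp
  have hs : Summable (fun i : ℕ => 4 * ((1 : ℝ) / p) ^ (i + 1)) :=
    (((summable_geometric_of_lt_one h0.le (by linarith)).comp_injective
      (add_left_injective 1))).mul_left 4
  refine Summable.of_nonneg_of_le (fun i => ?_) (fun i => ?_) hs
  · obtain ⟨a, b⟩ := zq_qpow_bounds p hp i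
    exact div_nonneg a.le (by positivity)
  · obtain ⟨a, b⟩ := zq_qpow_bounds p hp i
    unfold zqf2
    rw [div_le_iff₀ (by nlinarith)]
    have : 1 ≤ 4 * (1 - ((1 : ℝ) / p) ^ (i + 1)) ^ 2 := by nlinarith
    nlinarith

lemma zq_lambert (p : ℕ) (hp : 2 ≤ p) :
    HasSum (fun i : ℕ => zqf2 (((1 : ℝ) / p) ^ (i + 1))) (zqZ p) := by
  have hsum := zq_f2_summable p hp
  suffices h : zqZ p = ∑' i : ℕ, zqf2 (((1 : ℝ) / p) ^ (i + 1)) by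
    rw [h]; exact hsum.hasSum
  set q : ℝ := (1 : ℝ) / p with hq
  let g : ℕ × ℕ → ℝ := fun z => (z.2 + 1 : ℝ) * (q ^ (z.1 + 1)) ^ (z.2 + 1)
  have hb : ∀ k : ℕ, 0 < q ^ (k + 1) ∧ q ^ (k + 1) ≤ 1 / 2 := zq_qpow_bounds p hp
  have hf : ∀ i : ℕ, HasSum (fun k : ℕ => g (i, k)) (zqf2 (q ^ (i + 1))) := by
    intro i
    obtain ⟨a, b⟩ := hb i
    have h := hasSum_coe_mul_geometric_of_norm_lt_one (r := q ^ (i + 1))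
      (by rw [Real.norm_of_nonneg a.le]; linarith)
    have h2 := (hasSum_nat_add_iff' 1).2 h
    simpa [g, zqf2] using h2
  have hg0 : 0 ≤ g := by
    intro z
    have := (hb z.1).1
    simp only [Pi.zero_apply, g]
    positivity
  have hgs : Summable g := by
    rw [summable_prod_of_nonneg hg0]
    refine ⟨fun i => (hf i).summable, ?_⟩
    refine hsum.congr fun i => ?_
    exact (hf i).tsum_eq.symm
  have hc : ∑' (k : ℕ) (i : ℕ), g (i, k) = ∑' (i : ℕ) (k : ℕ), g (i, k) :=
    Summable.tsum_comm (f := fun i k => g (i, k)) hgs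
  unfold zqZ
  rw [← hq]
  trans ∑' (k : ℕ) (i : ℕ), g (i, k)
  · refine tsum_congr fun k => ?_
    obtain ⟨a, b⟩ := hb k
    have h := (hasSum_geometric_of_lt_one a.le (by linarith : q ^ (k + 1) < 1)).mul_left
      ((k + 1 : ℝ) * q ^ (k + 1))
    rw [← div_eq_mul_inv] at h
    rw [← h.tsum_eq]
    refine tsum_congr fun i => ?_
    simp only [g]
    rw [← pow_mul, ← pow_mul, mul_assoc, ← pow_add]
    congr 2
    ring
  · rw [hc]
    exact tsum_congr fun i => (hf i).tsum_eq

noncomputable def zqK (p N : ℕ) (U : Finset ℕ) (m : ℕ → ℕ) (j : ℕ) : ℝ :=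
  (∏ i ∈ Finset.Icc 1 N, (((1 : ℝ) / p) ^ j - (p : ℝ) ^ i)) /
    ∏ k ∈ U.erase j, (((1 : ℝ) / p) ^ j - ((1 : ℝ) / p) ^ k) ^ m k

noncomputable def zqTau (p N : ℕ) (U : Finset ℕ) (m : ℕ → ℕ) (j : ℕ) : ℝ :=
  (∑ i ∈ Finset.Icc 1 N, ((1 : ℝ) / p) ^ j / (((1 : ℝ) / p) ^ j - (p : ℝ) ^ i)) -
    ∑ k ∈ U.erase j, (m k : ℝ) * (((1 : ℝ) / p) ^ j / (((1 : ℝ) / p) ^ j - ((1 : ℝ) / p) ^ k))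

noncomputable def zqw (p : ℕ) (m : ℕ → ℕ) (j : ℕ) : ℝ := if m j = 2 then (p : ℝ) ^ j else 0
noncomputable def zqv (p N : ℕ) (U : Finset ℕ) (m : ℕ → ℕ) (j : ℕ) : ℝ :=
  if m j = 2 then (p : ℝ) ^ j * zqTau p N U m j else 1

noncomputable def zqR (p N : ℕ) (U : Finset ℕ) (m : ℕ → ℕ) (y : ℝ) : ℝ :=
  y * (∏ i ∈ Finset.Icc 1 N, (y - (p : ℝ) ^ i)) / ∏ k ∈ U, (y - ((1 : ℝ) / p) ^ k) ^ m k

lemma zq_node_ne (p : ℕ) (hp : 2 ≤ p) (i j : ℕ) (h : i ≠ j) :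
    ((1 : ℝ) / p) ^ i ≠ ((1 : ℝ) / p) ^ j := by
  obtain ⟨h0, h1⟩ := zq_q_bounds p hp
  intro e
  exact h (pow_right_injective₀ h0 (by linarith) e)

lemma zq_node_ne' (p : ℕ) (hp : 2 ≤ p) (i j : ℕ) (hi : 1 ≤ i) :
    ((1 : ℝ) / p) ^ j ≠ (p : ℝ) ^ i := by
  obtain ⟨h0, h1⟩ := zq_q_bounds p hp
  have hp' : (2 : ℝ) ≤ p := by exact_mod_cast hp
  have h2 : ((1 : ℝ) / p) ^ j ≤ 1 := pow_le_one₀ h0.le (by linarith)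
  have h3 : (1 : ℝ) < (p : ℝ) ^ i := one_lt_pow₀ (by linarith) (by omega)
  linarith

open Polynomial in
lemma zq_hermite_app (p N : ℕ) (hp : 2 ≤ p) (U : Finset ℕ) (m : ℕ → ℕ)
    (hm : ∀ j ∈ U, m j = 1 ∨ m j = 2) (hd : N + 1 < ∑ j ∈ U, m j) (y : ℝ) :
    y * (∏ i ∈ Finset.Icc 1 N, (y - (p : ℝ) ^ i)) =
    ∑ j ∈ U, (((1 : ℝ) / p) ^ j * zqK p N U m j) *
      (if m j = 2 then 1 + ((1 + zqTau p N U m j) / ((1 : ℝ) / p) ^ j) * (y - ((1 : ℝ) / p) ^ j)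
        else 1) *
      ∏ k ∈ U.erase j, (y - ((1 : ℝ) / p) ^ k) ^ m k := by
  obtain ⟨h0, h1⟩ := zq_q_bounds p hp
  set q : ℝ := (1 : ℝ) / p with hq
  have hE : ∀ j ∈ U, zqE (q ^ j) (X * ∏ i ∈ Finset.Icc 1 N, (X - C ((p : ℝ) ^ i)))
      (q ^ j * ∏ i ∈ Finset.Icc 1 N, (q ^ j - (p : ℝ) ^ i))
      (1 / q ^ j + ∑ i ∈ Finset.Icc 1 N, 1 / (q ^ j - (p : ℝ) ^ i)) := by
    intro j hj
    apply zqE_mul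
    · have := zqE_lin (q ^ j) 0 (by positivity)
      simpa using this
    · have := zqE_prod (q ^ j) (Finset.Icc 1 N) (fun i => (p : ℝ) ^ i) (fun _ => 1)
        (fun i hi => zq_node_ne' p hp i j (Finset.mem_Icc.1 hi).1)
      simpa using this
  have hdeg : (X * ∏ i ∈ Finset.Icc 1 N, (X - C ((p : ℝ) ^ i))).degree <
      ((∑ j ∈ U, m j : ℕ) : WithBot ℕ) := by
    rw [degree_mul, degree_prod]
    simp only [degree_X, degree_X_sub_C]
    simp
    exact_mod_cast (by omega : 1 + N < ∑ j ∈ U, m j)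
  have h := zq_hermite U (fun j => q ^ j) (fun i _ j _ hij => zq_node_ne p hp i j hij) m hm _ hdeg
    _ _ hE y
  rw [eval_mul, eval_prod, eval_X] at h
  simp only [eval_sub, eval_X, eval_C] at h
  rw [h]
  refine Finset.sum_congr rfl fun j hj => ?_
  have hqj : q ^ j ≠ 0 := by positivity
  congr 2
  · unfold zqK; rw [mul_div_assoc]
  · have : 1 / q ^ j + ∑ i ∈ Finset.Icc 1 N, 1 / (q ^ j - (p : ℝ) ^ i) -
        ∑ k ∈ U.erase j, (m k : ℝ) / (q ^ j - q ^ k) = (1 + zqTau p N U m j) / q ^ j := by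
      rw [eq_div_iff hqj]
      unfold zqTau
      rw [← hq, sub_mul, add_mul, Finset.sum_mul, Finset.sum_mul, one_div_mul_cancel hqj,
        add_sub_assoc]
      congr 1
      congr 1
      · refine Finset.sum_congr rfl fun i _ => ?_
        ring
      · refine Finset.sum_congr rfl fun i _ => ?_
        ring
    rw [this]

lemma zq_R_eq (p N : ℕ) (hp : 2 ≤ p) (U : Finset ℕ) (m : ℕ → ℕ)
    (hm : ∀ j ∈ U, m j = 1 ∨ m j = 2) (hd : N + 1 < ∑ j ∈ U, m j) (y : ℝ) (hy : y ≠ 0)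
    (hyx : ∀ j ∈ U, y ≠ ((1 : ℝ) / p) ^ j) :
    zqR p N U m y = ∑ j ∈ U, zqK p N U m j * (zqw p m j * zqf2 (((1 : ℝ) / p) ^ j / y) +
      zqv p N U m j * zqf1 (((1 : ℝ) / p) ^ j / y)) := by
  unfold zqR
  rw [zq_hermite_app p N hp U m hm hd, Finset.sum_div]
  refine Finset.sum_congr rfl fun j hj => ?_
  obtain ⟨h0, h1⟩ := zq_q_bounds p hp
  have hp0 : (p : ℝ) ≠ 0 := by positivity
  have hpj : (p : ℝ) ^ j = 1 / ((1 : ℝ) / p) ^ j := by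
    rw [one_div, ← inv_pow, one_div, inv_inv]
  set q : ℝ := (1 : ℝ) / p with hq
  have hT : ∏ k ∈ U.erase j, (y - q ^ k) ^ m k ≠ 0 :=
    Finset.prod_ne_zero_iff.2 fun k hk =>
      pow_ne_zero _ (sub_ne_zero.2 (hyx k (Finset.mem_of_mem_erase hk)))
  rw [← Finset.mul_prod_erase U (fun k => (y - q ^ k) ^ m k) hj, mul_div_mul_right _ _ hT]
  have hyj : y - q ^ j ≠ 0 := sub_ne_zero.2 (hyx j hj)
  have hqj : q ^ j ≠ 0 := by positivity
  unfold zqw zqv zqf1 zqf2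
  rw [hpj]
  have e : 1 - q ^ j / y = (y - q ^ j) / y := by field_simp
  rw [e]
  generalize q ^ j = x at *
  rcases hm j hj with h | h
  · simp only [h, pow_one]
    norm_num
    field_simp
  · simp only [h, if_true]
    field_simp
    ring

lemma zq_v_sum (p N : ℕ) (hp : 2 ≤ p) (U : Finset ℕ) (m : ℕ → ℕ)
    (hm : ∀ j ∈ U, m j = 1 ∨ m j = 2) (hd : N + 1 < ∑ j ∈ U, m j) :
    ∑ j ∈ U, zqK p N U m j * zqv p N U m j = 0 := by
  obtain ⟨h0, h1⟩ := zq_q_bounds p hp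
  have h := zq_hermite_app p N hp U m hm hd 0
  rw [zero_mul] at h
  have hpj : ∀ j : ℕ, (p : ℝ) ^ j = 1 / ((1 : ℝ) / p) ^ j := fun j => by
    rw [one_div, ← inv_pow, one_div, inv_inv]
  set q : ℝ := (1 : ℝ) / p with hq
  have hQ : ∏ k ∈ U, (0 - q ^ k) ^ m k ≠ 0 :=
    Finset.prod_ne_zero_iff.2 fun k hk => pow_ne_zero _ (by
      rw [zero_sub]; exact neg_ne_zero.2 (by positivity))
  have h2 : (∑ j ∈ U, zqK p N U m j * zqv p N U m j) * (- ∏ k ∈ U, (0 - q ^ k) ^ m k) = 0 := by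
    refine Eq.trans ?_ h.symm
    rw [Finset.sum_mul]
    refine Finset.sum_congr rfl fun j hj => ?_
    rw [← Finset.mul_prod_erase U (fun k => (0 - q ^ k) ^ m k) hj]
    generalize ∏ k ∈ U.erase j, (0 - q ^ k) ^ m k = T
    unfold zqv
    rw [hpj]
    have hqj : q ^ j ≠ 0 := by positivity
    generalize q ^ j = x at *
    rcases hm j hj with h | h
    · simp only [h, pow_one]
      norm_num
      ring
    · simp only [h, if_true]
      field_simp
      ring
  exact (mul_eq_zero.1 h2).resolve_right (neg_ne_zero.2 hQ)

noncomputable def zqB (p N : ℕ) (U : Finset ℕ) (m : ℕ → ℕ) : ℝ :=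
  ∑ j ∈ U, zqK p N U m j * zqw p m j
noncomputable def zqA (p N : ℕ) (U : Finset ℕ) (m : ℕ → ℕ) : ℝ :=
  ∑ j ∈ U, zqK p N U m j * (zqw p m j * ∑ i ∈ Finset.range j, zqf2 (((1 : ℝ) / p) ^ (i + 1)) +
      zqv p N U m j * ∑ i ∈ Finset.range j, zqf1 (((1 : ℝ) / p) ^ (i + 1)))

lemma zq_L_hasSum (p N : ℕ) (hp : 2 ≤ p) (U : Finset ℕ) (m : ℕ → ℕ)
    (hm : ∀ j ∈ U, m j = 1 ∨ m j = 2) (hd : N + 1 < ∑ j ∈ U, m j) :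
    HasSum (fun t : ℕ => zqR p N U m ((p : ℝ) ^ (t + 1)))
      (zqB p N U m * zqZ p - zqA p N U m) := by
  have h2 := zq_lambert p hp
  have h1 := (zq_f1_summable p hp).hasSum
  set Z1 := ∑' i : ℕ, zqf1 (((1 : ℝ) / p) ^ (i + 1))
  have hj : ∀ j ∈ U, HasSum (fun t : ℕ => zqK p N U m j *
      (zqw p m j * zqf2 (((1 : ℝ) / p) ^ (t + j + 1)) +
      zqv p N U m j * zqf1 (((1 : ℝ) / p) ^ (t + j + 1))))
      (zqK p N U m j * (zqw p m j * (zqZ p - ∑ i ∈ Finset.range j, zqf2 (((1 : ℝ) / p) ^ (i + 1))) +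
      zqv p N U m j * (Z1 - ∑ i ∈ Finset.range j, zqf1 (((1 : ℝ) / p) ^ (i + 1))))) := by
    intro j _
    exact ((((hasSum_nat_add_iff' j).2 h2).mul_left _).add
      (((hasSum_nat_add_iff' j).2 h1).mul_left _)).mul_left _
  have h := hasSum_sum hj
  convert h using 1
  · funext t
    have hp' : (2 : ℝ) ≤ p := by exact_mod_cast hp
    rw [zq_R_eq p N hp U m hm hd _ (by positivity)
      (fun j _ => (zq_node_ne' p hp (t + 1) j (by omega)).symm)]
    refine Finset.sum_congr rfl fun j _ => ?_
    have : ((1 : ℝ) / p) ^ j / (p : ℝ) ^ (t + 1) = ((1 : ℝ) / p) ^ (t + j + 1) := by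
      rw [div_eq_mul_inv, ← inv_pow, ← one_div, ← pow_add]
      congr 1; ring
    rw [this]
  · have hv := zq_v_sum p N hp U m hm hd
    unfold zqB zqA
    have : ∀ j ∈ U, zqK p N U m j * (zqw p m j * (zqZ p -
        ∑ i ∈ Finset.range j, zqf2 (((1 : ℝ) / p) ^ (i + 1))) +
      zqv p N U m j * (Z1 - ∑ i ∈ Finset.range j, zqf1 (((1 : ℝ) / p) ^ (i + 1)))) =
      zqK p N U m j * zqw p m j * zqZ p - zqK p N U m j *
        (zqw p m j * ∑ i ∈ Finset.range j, zqf2 (((1 : ℝ) / p) ^ (i + 1)) +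
      zqv p N U m j * ∑ i ∈ Finset.range j, zqf1 (((1 : ℝ) / p) ^ (i + 1))) +
      zqK p N U m j * zqv p N U m j * Z1 := by intro j _; ring
    rw [Finset.sum_congr rfl this, Finset.sum_add_distrib, Finset.sum_sub_distrib,
      ← Finset.sum_mul, ← Finset.sum_mul, hv]
    ring


lemma zq_R_bounds (p N d : ℕ) (hp : 2 ≤ p) (U : Finset ℕ) (m : ℕ → ℕ)
    (hd : ∑ j ∈ U, m j = N + 1 + d) (t : ℕ) (ht : N ≤ t) :
    1 / (2 ^ N * ((p : ℝ) ^ (t + 1)) ^ d) ≤ zqR p N U m ((p : ℝ) ^ (t + 1)) ∧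
    zqR p N U m ((p : ℝ) ^ (t + 1)) ≤ 2 ^ (N + 1 + d) / ((p : ℝ) ^ (t + 1)) ^ d := by
  have hp' : (2 : ℝ) ≤ p := by exact_mod_cast hp
  obtain ⟨h0, h1⟩ := zq_q_bounds p hp
  set y : ℝ := (p : ℝ) ^ (t + 1) with hy
  have hy2 : 2 ≤ y := by
    rw [hy, pow_succ]
    have : (1 : ℝ) ≤ (p : ℝ) ^ t := one_le_pow₀ (by linarith)
    nlinarith
  have hf1 : ∀ i ∈ Finset.Icc 1 N, y / 2 ≤ y - (p : ℝ) ^ i ∧ y - (p : ℝ) ^ i ≤ y := by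
    intro i hi
    have hi' : i ≤ t := (Finset.mem_Icc.1 hi).2.trans ht
    have a : (p : ℝ) ^ i ≤ (p : ℝ) ^ t := pow_le_pow_right₀ (by linarith) hi'
    have b : y = (p : ℝ) ^ t * p := pow_succ _ _
    have c : (0 : ℝ) < (p : ℝ) ^ i := by positivity
    constructor <;> nlinarith
  have hf2 : ∀ k ∈ U, y / 2 ≤ y - ((1 : ℝ) / p) ^ k ∧ y - ((1 : ℝ) / p) ^ k ≤ y := by
    intro k _
    have a : ((1 : ℝ) / p) ^ k ≤ 1 := pow_le_one₀ h0.le (by linarith)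
    have b : 0 < ((1 : ℝ) / p) ^ k := by positivity
    constructor <;> linarith
  have hP1 : (y / 2) ^ N ≤ ∏ i ∈ Finset.Icc 1 N, (y - (p : ℝ) ^ i) := by
    have := Finset.prod_le_prod (s := Finset.Icc 1 N) (f := fun _ => y / 2)
      (g := fun i => y - (p : ℝ) ^ i) (fun _ _ => by positivity) (fun i hi => (hf1 i hi).1)
    simpa only [Finset.prod_const, Nat.card_Icc, Nat.add_sub_cancel] using this
  have hP2 : ∏ i ∈ Finset.Icc 1 N, (y - (p : ℝ) ^ i) ≤ y ^ N := by
    have := Finset.prod_le_prod (s := Finset.Icc 1 N) (g := fun _ => y)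
      (f := fun i => y - (p : ℝ) ^ i) (fun i hi => by have := (hf1 i hi).1; linarith)
      (fun i hi => (hf1 i hi).2)
    simpa using this
  have hQ1 : (y / 2) ^ (N + 1 + d) ≤ ∏ k ∈ U, (y - ((1 : ℝ) / p) ^ k) ^ m k := by
    rw [← hd, ← Finset.prod_pow_eq_pow_sum]
    exact Finset.prod_le_prod (fun _ _ => by positivity)
      (fun k hk => pow_le_pow_left₀ (by positivity) (hf2 k hk).1 _)
  have hQ2 : ∏ k ∈ U, (y - ((1 : ℝ) / p) ^ k) ^ m k ≤ y ^ (N + 1 + d) := by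
    rw [← hd, ← Finset.prod_pow_eq_pow_sum]
    exact Finset.prod_le_prod (fun k hk => pow_nonneg (by have := (hf2 k hk).1; linarith) _)
      (fun k hk => pow_le_pow_left₀ (by have := (hf2 k hk).1; linarith) (hf2 k hk).2 _)
  have hQ0 : 0 < (y / 2) ^ (N + 1 + d) := by positivity
  have hP0 : 0 < (y / 2) ^ N := by positivity
  unfold zqR
  generalize (∏ i ∈ Finset.Icc 1 N, (y - (p : ℝ) ^ i)) = P at *
  generalize (∏ k ∈ U, (y - ((1 : ℝ) / p) ^ k) ^ m k) = Q at *
  have hy0 : 0 < y := by linarith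
  constructor
  · calc 1 / (2 ^ N * y ^ d) = y * (y / 2) ^ N / y ^ (N + 1 + d) := by
          rw [div_pow]; field_simp; ring
      _ ≤ y * P / Q := by
          apply div_le_div₀ _ _ (by linarith) hQ2
          · exact mul_nonneg hy0.le (hP0.le.trans hP1)
          · exact mul_le_mul_of_nonneg_left hP1 hy0.le
  · calc y * P / Q ≤ y * y ^ N / (y / 2) ^ (N + 1 + d) := by
          apply div_le_div₀ (by positivity) _ hQ0 hQ1
          exact mul_le_mul_of_nonneg_left hP2 hy0.le
      _ = 2 ^ (N + 1 + d) / y ^ d := by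
          rw [div_pow]; field_simp; ring

lemma zq_L_bounds (p N d : ℕ) (hp : 2 ≤ p) (U : Finset ℕ) (m : ℕ → ℕ)
    (hm : ∀ j ∈ U, m j = 1 ∨ m j = 2) (hd0 : 1 ≤ d) (hd : ∑ j ∈ U, m j = N + 1 + d) :
    1 / (2 ^ N * ((p : ℝ) ^ (N + 1)) ^ d) ≤ zqB p N U m * zqZ p - zqA p N U m ∧
    zqB p N U m * zqZ p - zqA p N U m ≤ 2 ^ (N + 2 + d) / ((p : ℝ) ^ (N + 1)) ^ d := by
  have hp' : (2 : ℝ) ≤ p := by exact_mod_cast hp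
  have h := zq_L_hasSum p N hp U m hm (by omega)
  have h2 := (hasSum_nat_add_iff' N).2 h
  have hz : ∑ i ∈ Finset.range N, zqR p N U m ((p : ℝ) ^ (i + 1)) = 0 := by
    refine Finset.sum_eq_zero fun i hi => ?_
    have hi' := Finset.mem_range.1 hi
    unfold zqR
    rw [Finset.prod_eq_zero (i := i + 1) (by simp; omega) (sub_self _)]
    simp
  rw [hz, sub_zero] at h2
  generalize zqB p N U m * zqZ p - zqA p N U m = L at *
  have hb := fun t : ℕ => zq_R_bounds p N d hp U m hd (t + N) (by omega)
  constructor
  · refine le_trans ?_ (le_hasSum h2 0 fun t _ => le_trans (by positivity) (hb t).1)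
    simpa using (hb 0).1
  · have hg := (hasSum_geometric_of_lt_one (r := (1 / 2 : ℝ)) (by norm_num) (by norm_num)).mul_left
      (2 ^ (N + 1 + d) / ((p : ℝ) ^ (N + 1)) ^ d)
    have := hasSum_le (fun t => ?_) h2 hg
    · refine this.trans (le_of_eq ?_)
      norm_num
      ring
    · refine (hb t).2.trans ?_
      rw [div_mul_eq_mul_div, div_le_div_iff₀ (by positivity) (by positivity)]
      have e : ((p : ℝ) ^ (t + N + 1)) ^ d = ((p : ℝ) ^ (N + 1)) ^ d * ((p : ℝ) ^ t) ^ d := by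
        rw [← mul_pow, ← pow_add]; congr 2; ring
      have e2 : (2 : ℝ) ^ t ≤ ((p : ℝ) ^ t) ^ d := by
        calc (2 : ℝ) ^ t ≤ (p : ℝ) ^ t := pow_le_pow_left₀ (by norm_num) hp' _
          _ ≤ ((p : ℝ) ^ t) ^ d := le_self_pow₀ (one_le_pow₀ (by linarith)) (by omega)
      have e3 : 1 ≤ (1 / 2 : ℝ) ^ t * ((p : ℝ) ^ t) ^ d := by
        calc (1 : ℝ) = (1 / 2 : ℝ) ^ t * 2 ^ t := by rw [← mul_pow]; norm_num
          _ ≤ _ := mul_le_mul_of_nonneg_left e2 (by positivity)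
      rw [e]
      have e4 : 0 ≤ (2 : ℝ) ^ (N + 1 + d) * ((p : ℝ) ^ (N + 1)) ^ d := by positivity
      nlinarith [mul_le_mul_of_nonneg_left e3 e4]


def zqe (s l : ℕ) : ℕ :=
  (if l ≤ 20 * s then 1 else 0) + (if l ≤ 18 * s then 1 else 0) + 14 * s / l +
    (if l ≤ 7 * s then 2 * (16 * s / l - 14 * s / l) else 0)

lemma zq_div_cases (a l : ℕ) (hl : 0 < l) (h : a < 3 * l) :
    (a / l = 0 ∧ a < l) ∨ (a / l = 1 ∧ l ≤ a ∧ a < 2 * l) ∨ (a / l = 2 ∧ 2 * l ≤ a) := by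
  rcases lt_or_ge a l with h1 | h1
  · exact Or.inl ⟨Nat.div_eq_of_lt h1, h1⟩
  · rcases lt_or_ge a (2 * l) with h2 | h2
    · exact Or.inr (Or.inl ⟨by rw [Nat.div_eq_iff hl]; omega, h1, h2⟩)
    · exact Or.inr (Or.inr ⟨by rw [Nat.div_eq_iff hl]; omega, h2⟩)

lemma zq_div_add (a b l : ℕ) : a / l + b / l ≤ (a + b) / l := Nat.div_add_div_le_add_div

lemma zq_arith_dbl (s l j x η c1 c2 num : ℕ) (hs : 1 ≤ s) (hl : 1 ≤ l)
    (hj1 : 4 * s ≤ j) (hj2 : j ≤ 18 * s)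
    (hc1 : c1 ≤ (j - 2 * s) / l + (18 * s - j) / l)
    (hc2 : c2 ≤ (j - 4 * s) / l + (20 * s - j) / l)
    (hnum : (14 * s + j) / l ≤ num + j / l)
    (hx : x ≤ 1) (hxl : x = 1 → l ≤ j) (hη : η ≤ 1)
    (hηl : η = 1 → l ≤ j ∨ 1 ≤ num ∨ 1 ≤ c1 + c2) :
    c1 + c2 + x + η ≤ zqe s l + num := by
  unfold zqe
  by_cases h7 : l ≤ 7 * s
  · rw [if_pos (by omega), if_pos (by omega), if_pos h7]
    have a1 := zq_div_add (j - 2 * s) (18 * s - j) l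
    have a2 := zq_div_add (j - 4 * s) (20 * s - j) l
    have a3 := zq_div_add (14 * s) j l
    rw [show j - 2 * s + (18 * s - j) = 16 * s by omega] at a1
    rw [show j - 4 * s + (20 * s - j) = 16 * s by omega] at a2
    omega
  · rw [if_neg h7]
    by_cases h14 : l ≤ 14 * s
    · rw [if_pos (by omega), if_pos (by omega)]
      have e14 : 14 * s / l = 1 := by rw [Nat.div_eq_iff (by omega)]; omega
      have a3 := zq_div_add (14 * s) j l
      have b1 := zq_div_cases (j - 2 * s) l (by omega) (by omega)
      have b2 := zq_div_cases (18 * s - j) l (by omega) (by omega)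
      have b3 := zq_div_cases (j - 4 * s) l (by omega) (by omega)
      have b4 := zq_div_cases (20 * s - j) l (by omega) (by omega)
      have b5 := zq_div_cases j l (by omega) (by omega)
      have b6 : 2 * l ≤ 14 * s + j → 2 ≤ (14 * s + j) / l := fun h => by
        rw [Nat.le_div_iff_mul_le (by omega)]; omega
      have b7 : 3 * l ≤ 14 * s + j → 3 ≤ (14 * s + j) / l := fun h => by
        rw [Nat.le_div_iff_mul_le (by omega)]; omega
      have b8 : 4 * l ≤ 14 * s + j → 4 ≤ (14 * s + j) / l := fun h => by
        rw [Nat.le_div_iff_mul_le (by omega)]; omega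
      rw [e14] at *
      generalize (j - 2 * s) / l = X1 at *
      generalize (18 * s - j) / l = X2 at *
      generalize (j - 4 * s) / l = X3 at *
      generalize (20 * s - j) / l = X4 at *
      generalize (14 * s + j) / l = X5 at *
      generalize j / l = X6 at *
      rcases b1 with b1 | b1 | b1 <;> rcases b3 with b3 | b3 | b3 <;> try omega
    · have e14 : 14 * s / l = 0 := Nat.div_eq_of_lt (by omega)
      rw [e14]
      rw [Nat.div_eq_of_lt (show 18 * s - j < l by omega)] at hc1
      rw [Nat.div_eq_of_lt (show j - 4 * s < l by omega)] at hc2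
      have b1 := zq_div_cases (j - 2 * s) l (by omega) (by omega)
      have b4 := zq_div_cases (20 * s - j) l (by omega) (by omega)
      have b5 := zq_div_cases j l (by omega) (by omega)
      have b6 : 2 * l ≤ 14 * s + j → 2 ≤ (14 * s + j) / l := fun h => by
        rw [Nat.le_div_iff_mul_le (by omega)]; omega
      generalize (j - 2 * s) / l = X1 at *
      generalize (20 * s - j) / l = X4 at *
      generalize (14 * s + j) / l = X5 at *
      generalize j / l = X6 at *
      split_ifs <;> omega

lemma zq_arith_sgl (s l j x c1 c2 num : ℕ) (hs : 1 ≤ s) (hl : 1 ≤ l)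
    (hj1 : 2 * s ≤ j) (hj2 : j ≤ 20 * s) (hj : j < 4 * s ∨ 18 * s < j)
    (hc1 : c1 ≤ (j - 2 * s) / l + (18 * s - j) / l)
    (hc2 : c2 ≤ (j - 4 * s) / l + (20 * s - j) / l)
    (hc1' : c1 ≤ 16 * s / l + 1) (hc2' : c2 ≤ 16 * s / l + 1)
    (hnum : (14 * s + j) / l ≤ num + j / l)
    (hx : x ≤ 1) (hxl : x = 1 → l ≤ j) :
    c1 + c2 + x ≤ zqe s l + num := by
  unfold zqe
  by_cases h7 : l ≤ 7 * s
  · rw [if_pos (by omega), if_pos (by omega), if_pos h7]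
    have a1 := zq_div_add (j - 2 * s) (18 * s - j) l
    have a2 := zq_div_add (j - 4 * s) (20 * s - j) l
    have a3 := zq_div_add (14 * s) j l
    rcases hj with hj | hj
    · rw [show j - 2 * s + (18 * s - j) = 16 * s by omega] at a1
      omega
    · rw [show j - 4 * s + (20 * s - j) = 16 * s by omega] at a2
      omega
  · rw [if_neg h7]
    have b1 := zq_div_cases (j - 2 * s) l (by omega) (by omega)
    have b2 := zq_div_cases (18 * s - j) l (by omega) (by omega)
    have b3 := zq_div_cases (j - 4 * s) l (by omega) (by omega)
    have b4 := zq_div_cases (20 * s - j) l (by omega) (by omega)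
    have b5 := zq_div_cases j l (by omega) (by omega)
    have b0 := zq_div_cases (14 * s) l (by omega) (by omega)
    have a3 := zq_div_add (14 * s) j l
    have b6 : 2 * l ≤ 14 * s + j → 2 ≤ (14 * s + j) / l := fun h => by
      rw [Nat.le_div_iff_mul_le (by omega)]; omega
    have b7 : 3 * l ≤ 14 * s + j → 3 ≤ (14 * s + j) / l := fun h => by
      rw [Nat.le_div_iff_mul_le (by omega)]; omega
    have b8 : 4 * l ≤ 14 * s + j → 4 ≤ (14 * s + j) / l := fun h => by
      rw [Nat.le_div_iff_mul_le (by omega)]; omega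
    clear hc1' hc2'
    generalize (j - 2 * s) / l = X1 at *
    generalize (18 * s - j) / l = X2 at *
    generalize (j - 4 * s) / l = X3 at *
    generalize (20 * s - j) / l = X4 at *
    generalize (14 * s + j) / l = X5 at *
    generalize j / l = X6 at *
    generalize 14 * s / l = X0 at *
    rcases hj with hj | hj <;>
    rcases b0 with b0 | b0 | b0 <;>
    rcases b1 with b1 | b1 | b1 <;> rcases b3 with b3 | b3 | b3 <;> try omega
    all_goals rcases b2 with b2 | b2 | b2 <;> try omega
    all_goals rcases b4 with b4 | b4 | b4 <;> try omega
    all_goals split_ifs <;> omega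


def zqd (j k : ℕ) : ℕ := (j - k) + (k - j)
def zqcI (A B j l : ℕ) : ℕ := ((Finset.Icc A B).filter (fun k => k ≠ j ∧ l ∣ zqd j k)).card

lemma zqcI_le (A B j l : ℕ) : zqcI A B j l ≤ (j - A) / l + (B - j) / l := by
  unfold zqcI
  have h1 := Nat.Ioc_filter_dvd_card_eq_div (j - A) l
  have h2 := Nat.Ioc_filter_dvd_card_eq_div (B - j) l
  rw [← Finset.card_filter_add_card_filter_not (fun k => k < j)]
  refine add_le_add ?_ ?_
  · rw [← h1]
    refine Finset.card_le_card_of_injOn (fun k => j - k) ?_ ?_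
    · intro k hk
      simp only [Finset.coe_filter, Finset.mem_filter, Finset.mem_Icc, Set.mem_ofPred_eq,
        Finset.mem_Ioc] at hk ⊢
      obtain ⟨⟨⟨a, b⟩, c, d⟩, e⟩ := hk
      have : zqd j k = j - k := by unfold zqd; omega
      rw [this] at d
      exact ⟨by omega, d⟩
    · intro k hk k' hk' h
      simp only [Finset.coe_filter, Finset.mem_filter, Finset.mem_Icc, Set.mem_ofPred_eq] at hk hk'
      simp only at h
      omega
  · rw [← h2]
    refine Finset.card_le_card_of_injOn (fun k => k - j) ?_ ?_
    · intro k hk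
      simp only [Finset.coe_filter, Finset.mem_filter, Finset.mem_Icc, Set.mem_ofPred_eq,
        Finset.mem_Ioc] at hk ⊢
      obtain ⟨⟨⟨a, b⟩, c, d⟩, e⟩ := hk
      have : zqd j k = k - j := by unfold zqd; omega
      rw [this] at d
      exact ⟨by omega, d⟩
    · intro k hk k' hk' h
      simp only [Finset.coe_filter, Finset.mem_filter, Finset.mem_Icc, Set.mem_ofPred_eq] at hk hk'
      simp only at h
      omega

lemma zqd_dvd_iff (j k l : ℕ) : l ∣ zqd j k ↔ (l : ℤ) ∣ (j : ℤ) - k := by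
  unfold zqd
  rcases le_total j k with h | h
  · rw [Nat.sub_eq_zero_of_le h, zero_add, ← Int.natCast_dvd_natCast, Nat.cast_sub h,
      ← dvd_neg, neg_sub]
  · rw [Nat.sub_eq_zero_of_le h, add_zero, ← Int.natCast_dvd_natCast, Nat.cast_sub h]

lemma zqcI_le' (A B j l : ℕ) (hl : 1 ≤ l) : zqcI A B j l ≤ (B - A) / l + 1 := by
  unfold zqcI
  rw [← Finset.card_range ((B - A) / l + 1)]
  refine Finset.card_le_card_of_injOn (fun k => (k - A) / l) ?_ ?_
  · intro k hk
    simp only [Finset.coe_filter, Finset.mem_Icc, Set.mem_ofPred_eq, Finset.coe_range,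
      Set.mem_Iio] at hk ⊢
    have : (k - A) / l ≤ (B - A) / l := Nat.div_le_div_right (by omega)
    omega
  · intro k hk k' hk' h
    simp only [Finset.coe_filter, Finset.mem_Icc, Set.mem_ofPred_eq] at hk hk'
    obtain ⟨⟨a, b⟩, c, d⟩ := hk
    obtain ⟨⟨a', b'⟩, c', d'⟩ := hk'
    simp only at h
    rw [zqd_dvd_iff] at d d'
    have d3 := dvd_sub d d'
    have e1 := Nat.div_add_mod (k - A) l
    have e2 := Nat.div_add_mod (k' - A) l
    have m1 := Nat.mod_lt (k - A) hl
    have m2 := Nat.mod_lt (k' - A) hl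
    rw [h] at e1
    have h0 : (j : ℤ) - k - (j - k') = 0 := by
      apply Int.eq_zero_of_abs_lt_dvd d3
      rw [abs_lt]
      omega
    omega

lemma zq_num_ge (N j l : ℕ) :
    (N + j) / l ≤ ((Finset.Icc 1 N).filter (fun i => l ∣ i + j)).card + j / l := by
  rw [← Nat.Ioc_filter_dvd_card_eq_div (N + j) l, ← Nat.Ioc_filter_dvd_card_eq_div j l,
    ← Finset.card_filter_add_card_filter_not (fun k => j < k)]
  refine add_le_add ?_ ?_
  · refine Finset.card_le_card_of_injOn (fun k => k - j) ?_ ?_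
    · intro k hk
      simp only [Finset.coe_filter, Finset.mem_filter, Finset.mem_Icc, Set.mem_ofPred_eq,
        Finset.mem_Ioc] at hk ⊢
      obtain ⟨⟨⟨a, b⟩, d⟩, e⟩ := hk
      rw [Nat.sub_add_cancel e.le]
      exact ⟨by omega, d⟩
    · intro k hk k' hk' h
      simp only [Finset.coe_filter, Finset.mem_filter, Set.mem_ofPred_eq] at hk hk'
      simp only at h
      omega
  · apply Finset.card_le_card
    intro k hk
    simp only [Finset.mem_filter, Finset.mem_Ioc] at hk ⊢
    exact ⟨by omega, hk.1.2⟩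

def zqm (s k : ℕ) : ℕ :=
  (if 2 * s ≤ k ∧ k ≤ 18 * s then 1 else 0) + (if 4 * s ≤ k ∧ k ≤ 20 * s then 1 else 0)
def zqU (s : ℕ) : Finset ℕ := Finset.Icc (2 * s) (20 * s)

lemma zq_m_sum (s : ℕ) (f : ℕ → ℕ) :
    ∑ k ∈ zqU s, zqm s k * f k =
      ∑ k ∈ Finset.Icc (2 * s) (18 * s), f k + ∑ k ∈ Finset.Icc (4 * s) (20 * s), f k := by
  unfold zqm zqU
  simp only [add_mul, ite_mul, one_mul, zero_mul]
  rw [Finset.sum_add_distrib, ← Finset.sum_filter, ← Finset.sum_filter]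
  congr 1
  · congr 1
    ext k; simp only [Finset.mem_filter, Finset.mem_Icc]; omega
  · congr 1
    ext k; simp only [Finset.mem_filter, Finset.mem_Icc]; omega

lemma zq_m_count (s j l : ℕ) :
    ∑ k ∈ (zqU s).erase j, zqm s k * (if l ∣ zqd j k then 1 else 0) =
      zqcI (2 * s) (18 * s) j l + zqcI (4 * s) (20 * s) j l := by
  have h := zq_m_sum s (fun k => if k ≠ j ∧ l ∣ zqd j k then 1 else 0)
  unfold zqcI
  rw [Finset.card_filter, Finset.card_filter, ← h, ← Finset.filter_ne', Finset.sum_filter]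
  refine Finset.sum_congr rfl fun k _ => ?_
  by_cases hk : k = j <;> simp [hk]

def zqnum (N j l : ℕ) : ℕ := ∑ i ∈ Finset.Icc 1 N, (if l ∣ i + j then 1 else 0)
def zqcnt (s j l : ℕ) : ℕ := ∑ k ∈ (zqU s).erase j, zqm s k * (if l ∣ zqd j k then 1 else 0)

lemma zq_exp_dbl (s l j i κ : ℕ) (hs : 1 ≤ s) (hl : 1 ≤ l) (hj1 : 4 * s ≤ j) (hj2 : j ≤ 18 * s)
    (hi : 1 ≤ i) (hij : i ≤ j)
    (hκ : (1 ≤ κ ∧ κ ≤ j) ∨ (∃ a, 1 ≤ a ∧ a ≤ 14 * s ∧ κ = a + j) ∨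
      (∃ k ∈ (zqU s).erase j, κ = zqd j k)) :
    zqcnt s j l + (if l ∣ i then 1 else 0) + (if l ∣ κ then 1 else 0) ≤
      zqe s l + zqnum (14 * s) j l := by
  have hnum := zq_num_ge (14 * s) j l
  unfold zqcnt zqnum
  have hcc := zq_m_count s j l
  rw [← Finset.card_filter]
  have hge : l ∣ κ → l ≤ j ∨ 1 ≤ ((Finset.Icc 1 (14 * s)).filter (fun i => l ∣ i + j)).card ∨
      1 ≤ zqcI (2 * s) (18 * s) j l + zqcI (4 * s) (20 * s) j l := by
    intro hd
    rcases hκ with h | ⟨a, ha1, ha2, rfl⟩ | ⟨k, hk, rfl⟩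
    · exact Or.inl ((Nat.le_of_dvd h.1 hd).trans h.2)
    · refine Or.inr (Or.inl (Finset.card_pos.2 ⟨a, ?_⟩))
      simp only [Finset.mem_filter, Finset.mem_Icc]
      exact ⟨⟨ha1, ha2⟩, hd⟩
    · refine Or.inr (Or.inr ?_)
      rw [← hcc]
      refine le_trans ?_ (Finset.single_le_sum (fun _ _ => Nat.zero_le _) hk)
      rw [if_pos hd, mul_one]
      have hk2 := Finset.mem_of_mem_erase hk
      unfold zqU at hk2
      rw [Finset.mem_Icc] at hk2
      unfold zqm
      split_ifs <;> omega
  rw [hcc]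
  apply zq_arith_dbl s l j _ _ _ _ _ hs hl hj1 hj2 (zqcI_le _ _ _ _) (zqcI_le _ _ _ _) hnum
  · split_ifs <;> omega
  · intro h
    by_cases hd : l ∣ i
    · exact (Nat.le_of_dvd hi hd).trans hij
    · simp [hd] at h
  · split_ifs <;> omega
  · intro h
    by_cases hd : l ∣ κ
    · exact hge hd
    · simp [hd] at h

lemma zq_exp_sgl (s l j i : ℕ) (hs : 1 ≤ s) (hl : 1 ≤ l) (hj1 : 2 * s ≤ j) (hj2 : j ≤ 20 * s)
    (hj : j < 4 * s ∨ 18 * s < j) (hi : 1 ≤ i) (hij : i ≤ j) :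
    zqcnt s j l + (if l ∣ i then 1 else 0) ≤ zqe s l + zqnum (14 * s) j l := by
  have hnum := zq_num_ge (14 * s) j l
  unfold zqcnt zqnum
  rw [← Finset.card_filter, zq_m_count s j l]
  have e1 := zqcI_le' (2 * s) (18 * s) j l hl
  have e2 := zqcI_le' (4 * s) (20 * s) j l hl
  rw [show 18 * s - 2 * s = 16 * s by omega] at e1
  rw [show 20 * s - 4 * s = 16 * s by omega] at e2
  apply zq_arith_sgl s l j _ _ _ _ hs hl hj1 hj2 hj (zqcI_le _ _ _ _) (zqcI_le _ _ _ _) e1 e2 hnum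
  · split_ifs <;> omega
  · intro h
    by_cases hd : l ∣ i
    · exact (Nat.le_of_dvd hi hd).trans hij
    · simp [hd] at h


noncomputable def zqM0 (p s : ℕ) : ℕ := ∏ l ∈ Finset.Ioc 0 (34 * s), zqCyc p l ^ zqe s l
noncomputable def zqWp (p N j : ℕ) : ℕ := ∏ i ∈ Finset.Icc 1 N, (p ^ (i + j) - 1)
noncomputable def zqVp (p s j : ℕ) : ℕ := ∏ k ∈ (zqU s).erase j, (p ^ zqd j k - 1) ^ zqm s k

lemma zq_cyc_ext (p k n : ℕ) (hp : 2 ≤ p) (hk : 1 ≤ k) (hkn : k ≤ n) :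
    p ^ k - 1 = ∏ l ∈ Finset.Ioc 0 n, zqCyc p l ^ (if l ∣ k then 1 else 0) := by
  rw [← zqCyc_prod p k hp hk]
  simp only [pow_ite, pow_one, pow_zero]
  rw [← Finset.prod_filter]
  congr 1
  ext l
  simp only [Nat.mem_divisors, Finset.mem_filter, Finset.mem_Ioc]
  constructor
  · rintro ⟨h, h2⟩
    exact ⟨⟨Nat.pos_of_dvd_of_pos h hk, (Nat.le_of_dvd hk h).trans hkn⟩, h⟩
  · rintro ⟨_, h⟩
    exact ⟨h, by omega⟩

lemma zqWp_eq (p s j : ℕ) (hp : 2 ≤ p) (hj2 : j ≤ 20 * s) :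
    zqWp p (14 * s) j = ∏ l ∈ Finset.Ioc 0 (34 * s), zqCyc p l ^ zqnum (14 * s) j l := by
  unfold zqWp zqnum
  simp only [← Finset.prod_pow_eq_pow_sum]
  rw [Finset.prod_comm]
  refine Finset.prod_congr rfl fun i hi => ?_
  have := Finset.mem_Icc.1 hi
  exact zq_cyc_ext p _ _ hp (by omega) (by omega)

lemma zqVp_eq (p s j : ℕ) (hp : 2 ≤ p) (hj : j ∈ zqU s) :
    zqVp p s j = ∏ l ∈ Finset.Ioc 0 (34 * s), zqCyc p l ^ zqcnt s j l := by
  unfold zqVp zqcnt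
  simp only [← Finset.prod_pow_eq_pow_sum]
  rw [Finset.prod_comm]
  refine Finset.prod_congr rfl fun k hk => ?_
  have h1 := Finset.ne_of_mem_erase hk
  have h2 := Finset.mem_of_mem_erase hk
  unfold zqU at h2 hj
  have h3 := Finset.mem_Icc.1 h2
  have h4 := Finset.mem_Icc.1 hj
  rw [zq_cyc_ext p (zqd j k) (34 * s) hp (by unfold zqd; omega) (by unfold zqd; omega),
    ← Finset.prod_pow]
  refine Finset.prod_congr rfl fun l _ => ?_
  rw [← pow_mul, mul_comm]

lemma zq_dvd_dbl (p s j i κ : ℕ) (hp : 2 ≤ p) (hs : 1 ≤ s) (hj1 : 4 * s ≤ j) (hj2 : j ≤ 18 * s)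
    (hi : 1 ≤ i) (hij : i ≤ j)
    (hκ : (1 ≤ κ ∧ κ ≤ j) ∨ (∃ a, 1 ≤ a ∧ a ≤ 14 * s ∧ κ = a + j) ∨
      (∃ k ∈ (zqU s).erase j, κ = zqd j k)) :
    zqVp p s j * ((p ^ i - 1) * (p ^ κ - 1)) ∣ zqM0 p s * zqWp p (14 * s) j := by
  have hκ2 : 1 ≤ κ ∧ κ ≤ 34 * s := by
    rcases hκ with h | ⟨a, ha1, ha2, rfl⟩ | ⟨k, hk, rfl⟩
    · omega
    · omega
    · have h1 := Finset.ne_of_mem_erase hk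
      have h2 := Finset.mem_of_mem_erase hk
      unfold zqU at h2
      have h3 := Finset.mem_Icc.1 h2
      unfold zqd; omega
  rw [zqVp_eq p s j hp (by unfold zqU; rw [Finset.mem_Icc]; omega), zqWp_eq p s j hp (by omega),
    zq_cyc_ext p i (34 * s) hp hi (by omega), zq_cyc_ext p κ (34 * s) hp hκ2.1 hκ2.2]
  unfold zqM0
  rw [← Finset.prod_mul_distrib, ← Finset.prod_mul_distrib, ← Finset.prod_mul_distrib]
  refine Finset.prod_dvd_prod_of_dvd _ _ fun l hl => ?_
  rw [← pow_add, ← pow_add, ← pow_add, ← add_assoc]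
  exact pow_dvd_pow _ (zq_exp_dbl s l j i κ hs (Finset.mem_Ioc.1 hl).1 hj1 hj2 hi hij hκ)

lemma zq_dvd_sgl (p s j i : ℕ) (hp : 2 ≤ p) (hs : 1 ≤ s) (hj1 : 2 * s ≤ j) (hj2 : j ≤ 20 * s)
    (hj : j < 4 * s ∨ 18 * s < j) (hi : 1 ≤ i) (hij : i ≤ j) :
    zqVp p s j * (p ^ i - 1) ∣ zqM0 p s * zqWp p (14 * s) j := by
  rw [zqVp_eq p s j hp (by unfold zqU; rw [Finset.mem_Icc]; omega), zqWp_eq p s j hp (by omega),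
    zq_cyc_ext p i (34 * s) hp hi (by omega)]
  unfold zqM0
  rw [← Finset.prod_mul_distrib, ← Finset.prod_mul_distrib]
  refine Finset.prod_dvd_prod_of_dvd _ _ fun l hl => ?_
  rw [← pow_add, ← pow_add]
  exact pow_dvd_pow _ (zq_exp_sgl s l j i hs (Finset.mem_Ioc.1 hl).1 hj1 hj2 hj hi hij)

def zqc (s : ℕ) : ℕ := 262 * s ^ 2 - 11 * s
def zqz (s j : ℕ) : ℕ := ∑ k ∈ (zqU s).erase j, zqm s k * max j k

lemma zq_sum_Ico (a n : ℕ) : 2 * ∑ k ∈ Finset.Ico a (a + n), k + n = n * (2 * a + n) := by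
  induction n with
  | zero => simp
  | succ n ih =>
    rw [show a + (n + 1) = a + n + 1 by ring, Finset.sum_Ico_succ_top (by omega)]
    nlinarith

lemma zq_Icc_max (a b j s : ℕ) (ha : a ≤ 10 * s) (hb : 10 * s ≤ b) :
    (10 * s - a) * j + ∑ k ∈ Finset.Ico (10 * s) (b + 1), k ≤ ∑ k ∈ Finset.Icc a b, max j k := by
  have : Finset.Icc a b = Finset.Ico a (b + 1) := by
    ext k; simp only [Finset.mem_Icc, Finset.mem_Ico]; omega
  rw [this, ← Finset.sum_Ico_consecutive _ ha (by omega : 10 * s ≤ b + 1)]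
  refine add_le_add ?_ ?_
  · have := Finset.card_nsmul_le_sum (Finset.Ico a (10 * s)) (fun k => max j k) j
      (fun k _ => le_max_left _ _)
    simpa using this
  · exact Finset.sum_le_sum fun k _ => le_max_right _ _

lemma zqz_ge (s j : ℕ) (hj : j ∈ zqU s) : j * (14 * s) + zqc s ≤ zqz s j := by
  have h1 := Finset.add_sum_erase (zqU s) (fun k => zqm s k * max j k) hj
  rw [zq_m_sum s (fun k => max j k)] at h1
  have h2 := zq_Icc_max (2 * s) (18 * s) j s (by omega) (by omega)
  have h3 := zq_Icc_max (4 * s) (20 * s) j s (by omega) (by omega)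
  have h4 := zq_sum_Ico (10 * s) (8 * s + 1)
  have h5 := zq_sum_Ico (10 * s) (10 * s + 1)
  rw [show 10 * s + (8 * s + 1) = 18 * s + 1 by ring] at h4
  rw [show 10 * s + (10 * s + 1) = 20 * s + 1 by ring] at h5
  rw [show 10 * s - 2 * s = 8 * s by omega] at h2
  rw [show 10 * s - 4 * s = 6 * s by omega] at h3
  unfold zqU at hj
  have hj' := Finset.mem_Icc.1 hj
  have hmj : zqm s j ≤ 2 := by unfold zqm; split_ifs <;> omega
  have hmj2 : zqm s j * max j j ≤ 40 * s := by
    rw [max_self]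
    calc zqm s j * j ≤ 2 * (20 * s) := Nat.mul_le_mul hmj hj'.2
      _ = 40 * s := by ring
  unfold zqz zqc
  have h6 : j * (14 * s) + (262 * s ^ 2 + 29 * s) ≤
      ∑ k ∈ (zqU s).erase j, zqm s k * max j k + 40 * s := by
    nlinarith
  have h7 : 11 * s ≤ 262 * s ^ 2 := by nlinarith
  omega

lemma zq_natpow_cast (p k : ℕ) (hp : 2 ≤ p) : ((p ^ k - 1 : ℕ) : ℝ) = (p : ℝ) ^ k - 1 := by
  rw [Nat.cast_sub (Nat.one_le_pow _ _ (by omega))]; push_cast; rfl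

lemma zq_diff (p j k : ℕ) (hp : 2 ≤ p) (hjk : j ≠ k) :
    ((1 : ℝ) / p) ^ j - ((1 : ℝ) / p) ^ k =
      ((if k < j then -1 else 1 : ℤ) : ℝ) * ((p ^ zqd j k - 1 : ℕ) : ℝ) / (p : ℝ) ^ max j k := by
  have hp0 : (p : ℝ) ≠ 0 := by positivity
  rw [zq_natpow_cast p _ hp]
  rcases lt_or_gt_of_ne hjk with h | h
  · have hd : zqd j k = k - j := by unfold zqd; omega
    rw [if_neg (by omega), max_eq_right h.le, hd]
    obtain ⟨n, rfl⟩ := Nat.exists_eq_add_of_lt h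
    rw [show j + n + 1 - j = n + 1 by omega]
    simp only [one_div, inv_pow]
    rw [show j + n + 1 = j + (n + 1) by ring, pow_add]
    field_simp
    simp
  · have hd : zqd j k = j - k := by unfold zqd; omega
    rw [if_pos h, max_eq_left h.le, hd]
    obtain ⟨n, rfl⟩ := Nat.exists_eq_add_of_lt h
    rw [show k + n + 1 - k = n + 1 by omega]
    simp only [one_div, inv_pow]
    rw [show k + n + 1 = k + (n + 1) by ring, pow_add]
    field_simp
    push_cast
    ring

lemma zq_diff' (p j i : ℕ) (hp : 2 ≤ p) :
    ((1 : ℝ) / p) ^ j - (p : ℝ) ^ i = -1 * ((p ^ (i + j) - 1 : ℕ) : ℝ) / (p : ℝ) ^ j := by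
  have hp0 : (p : ℝ) ≠ 0 := by positivity
  rw [zq_natpow_cast p _ hp, pow_add, one_div, inv_pow]
  field_simp
  ring

lemma zqK_eq (p s j : ℕ) (hp : 2 ≤ p) :
    ∃ ε : ℤ, zqK p (14 * s) (zqU s) (zqm s) j * (((p : ℝ) ^ (j * (14 * s))) * zqVp p s j) =
      ε * (p : ℝ) ^ zqz s j * zqWp p (14 * s) j := by
  have hp0 : (p : ℝ) ≠ 0 := by positivity
  set δ : ℤ := ∏ k ∈ (zqU s).erase j, (if k < j then -1 else 1 : ℤ) ^ zqm s k with hδ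
  have hδ2 : δ * δ = 1 := by
    rw [hδ, ← Finset.prod_mul_distrib]
    refine Finset.prod_eq_one fun k _ => ?_
    rw [← mul_pow]
    split_ifs <;> simp
  have hden : ∏ k ∈ (zqU s).erase j, (((1 : ℝ) / p) ^ j - ((1 : ℝ) / p) ^ k) ^ zqm s k =
      δ * zqVp p s j / (p : ℝ) ^ zqz s j := by
    rw [hδ]
    unfold zqVp zqz
    rw [← Finset.prod_pow_eq_pow_sum]
    push_cast
    rw [← Finset.prod_mul_distrib, ← Finset.prod_div_distrib]
    refine Finset.prod_congr rfl fun k hk => ?_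
    rw [zq_diff p j k hp (Finset.ne_of_mem_erase hk).symm, div_pow, mul_pow, mul_comm (zqm s k),
      pow_mul]
    norm_cast
  have hnum : ∏ i ∈ Finset.Icc 1 (14 * s), (((1 : ℝ) / p) ^ j - (p : ℝ) ^ i) =
      ((-1 : ℤ) ^ (14 * s) : ℤ) * zqWp p (14 * s) j / (p : ℝ) ^ (j * (14 * s)) := by
    rw [Finset.prod_congr rfl fun i _ => zq_diff' p j i hp]
    rw [Finset.prod_div_distrib, Finset.prod_mul_distrib, Finset.prod_const, Finset.prod_const,
      Nat.card_Icc, Nat.add_sub_cancel, ← pow_mul]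
    unfold zqWp
    push_cast
    rfl
  refine ⟨(-1) ^ (14 * s) * δ, ?_⟩
  have hV : (zqVp p s j : ℝ) ≠ 0 := by
    unfold zqVp
    rw [Nat.cast_ne_zero, Finset.prod_ne_zero_iff]
    intro k hk
    apply pow_ne_zero
    have h1 := Finset.ne_of_mem_erase hk
    have : 2 ^ 1 ≤ p ^ zqd j k := by
      calc 2 ^ 1 ≤ p ^ 1 := Nat.pow_le_pow_left hp 1
        _ ≤ p ^ zqd j k := Nat.pow_le_pow_right (by omega) (by unfold zqd; omega)
    omega
  have hδ3 : (δ : ℝ) * δ = 1 := by exact_mod_cast hδ2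
  have hδ0 : (δ : ℝ) ≠ 0 := fun h => by rw [h] at hδ3; norm_num at hδ3
  unfold zqK
  rw [hden, hnum]
  push_cast
  field_simp
  rw [pow_two, hδ3, mul_one]

lemma zq_atom (p s j D : ℕ) (hp : 2 ≤ p) (hj : j ∈ zqU s) (hD : D ≠ 0)
    (h : zqVp p s j * D ∣ zqM0 p s * zqWp p (14 * s) j) (hV : zqVp p s j ≠ 0) :
    (zqM0 p s : ℝ) / (p : ℝ) ^ zqc s * zqK p (14 * s) (zqU s) (zqm s) j / D ∈
      (Int.castRingHom ℝ).range := by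
  have hp0 : (p : ℝ) ≠ 0 := by positivity
  obtain ⟨ε, hε⟩ := zqK_eq p s j hp
  obtain ⟨w, hw⟩ := h
  obtain ⟨e, he⟩ := Nat.exists_eq_add_of_le (zqz_ge s j hj)
  have hV' : (zqVp p s j : ℝ) ≠ 0 := by exact_mod_cast hV
  have hD' : (D : ℝ) ≠ 0 := by exact_mod_cast hD
  have hw' : (zqM0 p s : ℝ) * zqWp p (14 * s) j = zqVp p s j * D * w := by exact_mod_cast hw
  refine ⟨ε * p ^ e * w, ?_⟩
  simp only [eq_intCast]
  push_cast
  have hK : zqK p (14 * s) (zqU s) (zqm s) j = ε * (p : ℝ) ^ zqz s j * zqWp p (14 * s) j /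
      (((p : ℝ) ^ (j * (14 * s))) * zqVp p s j) := by
    rw [eq_div_iff (mul_ne_zero (pow_ne_zero _ hp0) hV'), hε]
  rw [hK, he, pow_add, pow_add]
  have h1 := pow_ne_zero (zqc s) hp0
  have h2 := pow_ne_zero (j * (14 * s)) hp0
  generalize (p : ℝ) ^ (j * (14 * s)) = a1 at *
  generalize (p : ℝ) ^ zqc s = a2 at *
  have e1 : (zqM0 p s : ℝ) / a2 * (ε * (a1 * a2 * (p : ℝ) ^ e) * zqWp p (14 * s) j /
      (a1 * zqVp p s j)) / D = ε * (p : ℝ) ^ e * ((zqM0 p s : ℝ) * zqWp p (14 * s) j) /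
      (zqVp p s j * D) := by
    field_simp
  rw [e1, hw']
  field_simp


lemma zq_pk_ne (p k : ℕ) (hp : 2 ≤ p) (hk : 1 ≤ k) : p ^ k - 1 ≠ 0 := by
  have : 2 ^ 1 ≤ p ^ k := by
    calc 2 ^ 1 ≤ p ^ 1 := Nat.pow_le_pow_left hp 1
      _ ≤ p ^ k := Nat.pow_le_pow_right (by omega) hk
  omega

lemma zqVp_ne (p s j : ℕ) (hp : 2 ≤ p) : zqVp p s j ≠ 0 := by
  unfold zqVp
  rw [Finset.prod_ne_zero_iff]
  intro k hk
  have h1 := Finset.ne_of_mem_erase hk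
  exact pow_ne_zero _ (zq_pk_ne p _ hp (by unfold zqd; omega))

lemma zq_f1_val (p i : ℕ) (hp : 2 ≤ p) :
    zqf1 (((1 : ℝ) / p) ^ (i + 1)) = 1 / ((p ^ (i + 1) - 1 : ℕ) : ℝ) := by
  have hp0 : (p : ℝ) ≠ 0 := by positivity
  have h1 : ((p ^ (i + 1) - 1 : ℕ) : ℝ) ≠ 0 := by exact_mod_cast zq_pk_ne p (i + 1) hp (by omega)
  have h2 := zq_natpow_cast p (i + 1) hp
  rw [h2] at h1 ⊢
  unfold zqf1
  rw [one_div, inv_pow]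
  have h3 := pow_ne_zero (i + 1) hp0
  generalize (p : ℝ) ^ (i + 1) = y at *
  have : 1 - y⁻¹ ≠ 0 := by
    intro h; apply h1; field_simp at h; linarith
  field_simp

lemma zq_f2_val (p i : ℕ) (hp : 2 ≤ p) :
    zqf2 (((1 : ℝ) / p) ^ (i + 1)) =
      (p : ℝ) ^ (i + 1) / (((p ^ (i + 1) - 1) * (p ^ (i + 1) - 1) : ℕ) : ℝ) := by
  have hp0 : (p : ℝ) ≠ 0 := by positivity
  have h1 : ((p ^ (i + 1) - 1 : ℕ) : ℝ) ≠ 0 := by exact_mod_cast zq_pk_ne p (i + 1) hp (by omega)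
  have h2 := zq_natpow_cast p (i + 1) hp
  rw [Nat.cast_mul]
  rw [h2] at h1 ⊢
  unfold zqf2
  rw [one_div, inv_pow]
  have h3 := pow_ne_zero (i + 1) hp0
  generalize (p : ℝ) ^ (i + 1) = y at *
  have : 1 - y⁻¹ ≠ 0 := by
    intro h; apply h1; field_simp at h; linarith
  have e : 1 - y⁻¹ = (y - 1) / y := by field_simp
  rw [e]
  field_simp

lemma zq_t1_val (p j a : ℕ) (hp : 2 ≤ p) (ha : 1 ≤ a) :
    ((1 : ℝ) / p) ^ j / (((1 : ℝ) / p) ^ j - (p : ℝ) ^ a) =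
      -1 / ((p ^ (a + j) - 1 : ℕ) : ℝ) := by
  have hp0 : (p : ℝ) ≠ 0 := by positivity
  have h1 : ((p ^ (a + j) - 1 : ℕ) : ℝ) ≠ 0 := by exact_mod_cast zq_pk_ne p (a + j) hp (by omega)
  rw [zq_diff' p j a hp, one_div, inv_pow]
  field_simp

lemma zq_t2_val (p j k : ℕ) (hp : 2 ≤ p) (hjk : j ≠ k) :
    ∃ n : ℤ, ((1 : ℝ) / p) ^ j / (((1 : ℝ) / p) ^ j - ((1 : ℝ) / p) ^ k) =
      n / ((p ^ zqd j k - 1 : ℕ) : ℝ) := by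
  have hp0 : (p : ℝ) ≠ 0 := by positivity
  have h1 : ((p ^ zqd j k - 1 : ℕ) : ℝ) ≠ 0 := by
    exact_mod_cast zq_pk_ne p (zqd j k) hp (by unfold zqd; omega)
  rw [zq_diff p j k hp hjk, one_div, inv_pow]
  have e : max j k = j + (max j k - j) := by omega
  refine ⟨(if k < j then -1 else 1) * (p : ℤ) ^ (max j k - j), ?_⟩
  have e2 : (p : ℝ) ^ max j k = (p : ℝ) ^ j * (p : ℝ) ^ (max j k - j) := by
    rw [← pow_add, ← e]
  rw [e2]
  push_cast
  split_ifs
  · field_simp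
  · field_simp

lemma zq_m_two (s j : ℕ) (h : zqm s j = 2) : 4 * s ≤ j ∧ j ≤ 18 * s := by
  unfold zqm at h
  split_ifs at h <;> omega

lemma zq_m_ne_two (s j : ℕ) (hs : 1 ≤ s) (hj : j ∈ zqU s) (h : zqm s j ≠ 2) :
    2 * s ≤ j ∧ j ≤ 20 * s ∧ (j < 4 * s ∨ 18 * s < j) := by
  unfold zqU at hj
  have := Finset.mem_Icc.1 hj
  unfold zqm at h
  split_ifs at h <;> omega

lemma zq_m_one_two (s j : ℕ) (hs : 1 ≤ s) (hj : j ∈ zqU s) : zqm s j = 1 ∨ zqm s j = 2 := by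
  unfold zqU at hj
  have := Finset.mem_Icc.1 hj
  unfold zqm
  split_ifs <;> omega

noncomputable def zqM (p s : ℕ) : ℝ := (zqM0 p s : ℝ) / (p : ℝ) ^ zqc s

lemma zq_int_w (p s j : ℕ) (hp : 2 ≤ p) (hs : 1 ≤ s) (hj : j ∈ zqU s) :
    zqM p s * (zqK p (14 * s) (zqU s) (zqm s) j * zqw p (zqm s) j) ∈ (Int.castRingHom ℝ).range := by
  unfold zqw
  split_ifs with h
  · obtain ⟨h1, h2⟩ := zq_m_two s j h
    have hd := zq_dvd_dbl p s j 1 1 hp hs h1 h2 le_rfl (by omega) (Or.inl (by omega))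
    have ha := zq_atom p s j 1 hp hj one_ne_zero
      (by rw [mul_one]; exact (dvd_mul_right _ _).trans hd) (zqVp_ne p s j hp)
    have := Subring.mul_mem _ ha (⟨(p : ℤ) ^ j, by simp⟩ : (p : ℝ) ^ j ∈ (Int.castRingHom ℝ).range)
    convert this using 1
    unfold zqM
    push_cast
    ring
  · simp only [mul_zero]; exact Subring.zero_mem _

lemma zq_int_f2 (p s j i : ℕ) (hp : 2 ≤ p) (hs : 1 ≤ s) (hj : j ∈ zqU s) (hi : i < j) :
    zqM p s * (zqK p (14 * s) (zqU s) (zqm s) j * (zqw p (zqm s) j *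
      zqf2 (((1 : ℝ) / p) ^ (i + 1)))) ∈ (Int.castRingHom ℝ).range := by
  unfold zqw
  split_ifs with h
  · obtain ⟨h1, h2⟩ := zq_m_two s j h
    have hd := zq_dvd_dbl p s j (i + 1) (i + 1) hp hs h1 h2 (by omega) (by omega)
      (Or.inl (by omega))
    have hne := zq_pk_ne p (i + 1) hp (by omega)
    have ha := zq_atom p s j _ hp hj (mul_ne_zero hne hne) hd (zqVp_ne p s j hp)
    have := Subring.mul_mem _ ha (⟨(p : ℤ) ^ j * (p : ℤ) ^ (i + 1), by simp⟩ :
      (p : ℝ) ^ j * (p : ℝ) ^ (i + 1) ∈ (Int.castRingHom ℝ).range)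
    rw [zq_f2_val p i hp]
    convert this using 1
    unfold zqM
    ring
  · simp only [mul_zero, zero_mul]; exact Subring.zero_mem _

lemma zq_int_f1 (p s j i : ℕ) (hp : 2 ≤ p) (hs : 1 ≤ s) (hj : j ∈ zqU s) (hi : i < j) :
    zqM p s * (zqK p (14 * s) (zqU s) (zqm s) j * (zqv p (14 * s) (zqU s) (zqm s) j *
      zqf1 (((1 : ℝ) / p) ^ (i + 1)))) ∈ (Int.castRingHom ℝ).range := by
  unfold zqv
  rw [zq_f1_val p i hp]
  have hne := zq_pk_ne p (i + 1) hp (by omega)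
  split_ifs with h
  · obtain ⟨h1, h2⟩ := zq_m_two s j h
    unfold zqTau
    have hpj : (p : ℝ) ^ j ∈ (Int.castRingHom ℝ).range := ⟨(p : ℤ) ^ j, by simp⟩
    have e : ∀ M K P T1 T2 F : ℝ, M * (K * (P * (T1 - T2) * F)) =
      P * (T1 * (M * K * F) - T2 * (M * K * F)) := by intros; ring
    rw [e]
    refine Subring.mul_mem _ hpj (Subring.sub_mem _ ?_ ?_)
    · rw [Finset.sum_mul]
      refine Subring.sum_mem _ fun a ha => ?_
      have ha' := Finset.mem_Icc.1 ha
      rw [zq_t1_val p j a hp ha'.1]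
      have hd := zq_dvd_dbl p s j (i + 1) (a + j) hp hs h1 h2 (by omega) (by omega)
        (Or.inr (Or.inl ⟨a, ha'.1, ha'.2, rfl⟩))
      have hne2 := zq_pk_ne p (a + j) hp (by omega)
      have hat := zq_atom p s j _ hp hj (mul_ne_zero hne hne2) hd (zqVp_ne p s j hp)
      convert Subring.neg_mem _ hat using 1
      unfold zqM
      rw [Nat.cast_mul]
      ring
    · rw [Finset.sum_mul]
      refine Subring.sum_mem _ fun k hk => ?_
      have hjk := (Finset.ne_of_mem_erase hk).symm
      obtain ⟨n, hn⟩ := zq_t2_val p j k hp hjk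
      rw [hn]
      have hd := zq_dvd_dbl p s j (i + 1) (zqd j k) hp hs h1 h2 (by omega) (by omega)
        (Or.inr (Or.inr ⟨k, hk, rfl⟩))
      have hne2 := zq_pk_ne p (zqd j k) hp (by unfold zqd; omega)
      have hat := zq_atom p s j _ hp hj (mul_ne_zero hne hne2) hd (zqVp_ne p s j hp)
      have := Subring.mul_mem _ (⟨(zqm s k : ℤ) * n, by simp⟩ :
        (zqm s k : ℝ) * n ∈ (Int.castRingHom ℝ).range) hat
      convert this using 1
      unfold zqM
      rw [Nat.cast_mul]
      ring
  · obtain ⟨h1, h2, h3⟩ := zq_m_ne_two s j hs hj h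
    have hd := zq_dvd_sgl p s j (i + 1) hp hs h1 h2 h3 (by omega) (by omega)
    have hat := zq_atom p s j _ hp hj hne hd (zqVp_ne p s j hp)
    convert hat using 1
    unfold zqM
    ring

lemma zq_int_B (p s : ℕ) (hp : 2 ≤ p) (hs : 1 ≤ s) :
    ∃ B : ℤ, (B : ℝ) = zqM p s * zqB p (14 * s) (zqU s) (zqm s) := by
  have : zqM p s * zqB p (14 * s) (zqU s) (zqm s) ∈ (Int.castRingHom ℝ).range := by
    unfold zqB
    rw [Finset.mul_sum]
    exact Subring.sum_mem _ fun j hj => zq_int_w p s j hp hs hj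
  obtain ⟨B, hB⟩ := this
  exact ⟨B, hB⟩

lemma zq_int_A (p s : ℕ) (hp : 2 ≤ p) (hs : 1 ≤ s) :
    ∃ A : ℤ, (A : ℝ) = zqM p s * zqA p (14 * s) (zqU s) (zqm s) := by
  have : zqM p s * zqA p (14 * s) (zqU s) (zqm s) ∈ (Int.castRingHom ℝ).range := by
    unfold zqA
    rw [Finset.mul_sum]
    refine Subring.sum_mem _ fun j hj => ?_
    rw [mul_add, mul_add, Finset.mul_sum, Finset.mul_sum, Finset.mul_sum, Finset.mul_sum,
      Finset.mul_sum, Finset.mul_sum]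
    refine Subring.add_mem _ (Subring.sum_mem _ fun i hi => ?_) (Subring.sum_mem _ fun i hi => ?_)
    · exact zq_int_f2 p s j i hp hs hj (Finset.mem_range.1 hi)
    · exact zq_int_f1 p s j i hp hs hj (Finset.mem_range.1 hi)
  obtain ⟨A, hA⟩ := this
  exact ⟨A, hA⟩


lemma zq_mm_sum (s : ℕ) : ∑ k ∈ zqU s, zqm s k = 14 * s + 1 + (18 * s + 1) := by
  have h := zq_m_sum s (fun _ => 1)
  simp only [mul_one, Finset.sum_const, Nat.card_Icc, smul_eq_mul] at h
  rw [h]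
  omega

lemma zq_sum_min (s j : ℕ) (hj : j ≤ 18 * s) :
    ∑ k ∈ (zqU s).erase j, (min j k + 1) * zqm s k ≤ 350 * s ^ 2 + 53 * s + 2 := by
  have h0 : ∑ k ∈ (zqU s).erase j, (min j k + 1) * zqm s k ≤
      ∑ k ∈ zqU s, zqm s k * (min j k + 1) := by
    simp only [mul_comm]
    exact Finset.sum_le_sum_of_subset (Finset.erase_subset _ _)
  rw [zq_m_sum] at h0
  have h4 := zq_sum_Ico (2 * s) (16 * s + 1)
  have h5 := zq_sum_Ico (4 * s) (14 * s + 1)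
  have h1 : ∑ k ∈ Finset.Icc (2 * s) (18 * s), (min j k + 1) ≤
      ∑ k ∈ Finset.Ico (2 * s) (2 * s + (16 * s + 1)), k + (16 * s + 1) := by
    have e : Finset.Icc (2 * s) (18 * s) = Finset.Ico (2 * s) (2 * s + (16 * s + 1)) := by
      ext k; simp only [Finset.mem_Icc, Finset.mem_Ico]; omega
    rw [e, Finset.sum_add_distrib]
    refine add_le_add (Finset.sum_le_sum fun k _ => min_le_right _ _) ?_
    simp
  have h2 : ∑ k ∈ Finset.Icc (4 * s) (20 * s), (min j k + 1) ≤
      ∑ k ∈ Finset.Ico (4 * s) (4 * s + (14 * s + 1)), k + (2 * s) * (18 * s) + (16 * s + 1) := by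
    have e : Finset.Icc (4 * s) (20 * s) = Finset.Ico (4 * s) (20 * s + 1) := by
      ext k; simp only [Finset.mem_Icc, Finset.mem_Ico]; omega
    rw [e, Finset.sum_add_distrib, ← Finset.sum_Ico_consecutive _
      (by omega : 4 * s ≤ 4 * s + (14 * s + 1)) (by omega : 4 * s + (14 * s + 1) ≤ 20 * s + 1)]
    refine add_le_add (add_le_add (Finset.sum_le_sum fun k _ => min_le_right _ _) ?_) ?_
    · have := Finset.sum_le_card_nsmul (Finset.Ico (4 * s + (14 * s + 1)) (20 * s + 1))
        (fun k => min j k) (18 * s) (fun k _ => (min_le_left _ _).trans hj)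
      refine this.trans (le_of_eq ?_)
      rw [Nat.card_Ico, smul_eq_mul]
      congr 1
      omega
    · simp
      omega
  nlinarith

lemma zq_diff_ge (p j k : ℕ) (hp : 2 ≤ p) (hjk : j ≠ k) :
    ((1 : ℝ) / p) ^ (min j k + 1) ≤ |((1 : ℝ) / p) ^ j - ((1 : ℝ) / p) ^ k| := by
  obtain ⟨h0, h1⟩ := zq_q_bounds p hp
  set q : ℝ := (1 : ℝ) / p
  have key : ∀ a b : ℕ, a < b → q ^ (a + 1) ≤ q ^ a - q ^ b := by
    intro a b hab
    have e1 : q ^ b ≤ q ^ (a + 1) := pow_le_pow_of_le_one h0.le (by linarith) hab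
    have e2 : q ^ (a + 1) = q ^ a * q := pow_succ _ _
    have e3 : 0 < q ^ a := by positivity
    nlinarith
  rcases lt_or_gt_of_ne hjk with h | h
  · rw [min_eq_left h.le]
    exact (key j k h).trans (le_abs_self _)
  · rw [min_eq_right h.le, abs_sub_comm]
    exact (key k j h).trans (le_abs_self _)

lemma zqK_bound (p s j : ℕ) (hp : 2 ≤ p) (hj : j ≤ 18 * s) :
    |zqK p (14 * s) (zqU s) (zqm s) j| ≤ (p : ℝ) ^ (448 * s ^ 2 + 60 * s + 2) := by
  have hp' : (2 : ℝ) ≤ p := by exact_mod_cast hp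
  obtain ⟨h0, h1⟩ := zq_q_bounds p hp
  unfold zqK
  rw [abs_div, Finset.abs_prod, Finset.abs_prod]
  have hn : ∏ i ∈ Finset.Icc 1 (14 * s), |((1 : ℝ) / p) ^ j - (p : ℝ) ^ i| ≤
      (p : ℝ) ^ (98 * s ^ 2 + 7 * s) := by
    have hs : ∑ i ∈ Finset.Icc 1 (14 * s), i = 98 * s ^ 2 + 7 * s := by
      have e : Finset.Icc 1 (14 * s) = Finset.Ico 1 (1 + 14 * s) := by
        ext k; simp only [Finset.mem_Icc, Finset.mem_Ico]; omega
      have := zq_sum_Ico 1 (14 * s)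
      rw [e]
      nlinarith
    rw [← hs, ← Finset.prod_pow_eq_pow_sum]
    refine Finset.prod_le_prod (fun _ _ => abs_nonneg _) fun i hi => ?_
    have a : ((1 : ℝ) / p) ^ j ≤ 1 := pow_le_one₀ h0.le (by linarith)
    have b : 0 < ((1 : ℝ) / p) ^ j := by positivity
    have c : (1 : ℝ) ≤ (p : ℝ) ^ i := one_le_pow₀ (by linarith)
    rw [abs_le]
    constructor <;> linarith
  have hd : ((1 : ℝ) / p) ^ (350 * s ^ 2 + 53 * s + 2) ≤
      ∏ k ∈ (zqU s).erase j, |(((1 : ℝ) / p) ^ j - ((1 : ℝ) / p) ^ k) ^ zqm s k| := by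
    refine (pow_le_pow_of_le_one h0.le (by linarith) (zq_sum_min s j hj)).trans ?_
    rw [← Finset.prod_pow_eq_pow_sum]
    refine Finset.prod_le_prod (fun _ _ => by positivity) fun k hk => ?_
    rw [pow_mul, abs_pow]
    exact pow_le_pow_left₀ (by positivity) (zq_diff_ge p j k hp (Finset.ne_of_mem_erase hk).symm) _
  have hq0 : 0 < ((1 : ℝ) / p) ^ (350 * s ^ 2 + 53 * s + 2) := by positivity
  calc _ ≤ (p : ℝ) ^ (98 * s ^ 2 + 7 * s) / ((1 : ℝ) / p) ^ (350 * s ^ 2 + 53 * s + 2) :=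
        div_le_div₀ (by positivity) hn hq0 hd
    _ = (p : ℝ) ^ (448 * s ^ 2 + 60 * s + 2) := by
        rw [one_div, inv_pow, div_inv_eq_mul, ← pow_add]
        congr 1; ring

lemma zqB_bound (p s : ℕ) (hp : 2 ≤ p) (hs : 1 ≤ s) :
    |zqB p (14 * s) (zqU s) (zqm s)| ≤ (p : ℝ) ^ (448 * s ^ 2 + 99 * s) := by
  have hp' : (2 : ℝ) ≤ p := by exact_mod_cast hp
  unfold zqB
  refine (Finset.abs_sum_le_sum_abs _ _).trans ?_
  have hterm : ∀ j ∈ zqU s, |zqK p (14 * s) (zqU s) (zqm s) j * zqw p (zqm s) j| ≤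
      (p : ℝ) ^ (448 * s ^ 2 + 78 * s + 2) := by
    intro j hj
    unfold zqw
    split_ifs with h
    · obtain ⟨h1, h2⟩ := zq_m_two s j h
      rw [abs_mul, abs_of_nonneg (by positivity : (0 : ℝ) ≤ (p : ℝ) ^ j)]
      calc _ ≤ (p : ℝ) ^ (448 * s ^ 2 + 60 * s + 2) * (p : ℝ) ^ (18 * s) :=
            mul_le_mul (zqK_bound p s j hp h2) (pow_le_pow_right₀ (by linarith) h2)
              (by positivity) (by positivity)
        _ = _ := by rw [← pow_add]; congr 1; ring
    · rw [mul_zero, abs_zero]; positivity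
  refine (Finset.sum_le_card_nsmul _ _ _ hterm).trans ?_
  rw [nsmul_eq_mul]
  have hcard : ((zqU s).card : ℝ) ≤ (p : ℝ) ^ (18 * s + 1) := by
    unfold zqU
    rw [Nat.card_Icc, show 20 * s + 1 - 2 * s = 18 * s + 1 by omega]
    have h1 : 18 * s + 1 ≤ p ^ (18 * s + 1) := (Nat.lt_pow_self (by omega)).le
    exact_mod_cast h1
  calc _ ≤ (p : ℝ) ^ (18 * s + 1) * (p : ℝ) ^ (448 * s ^ 2 + 78 * s + 2) :=
        mul_le_mul_of_nonneg_right hcard (by positivity)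
    _ = (p : ℝ) ^ (448 * s ^ 2 + 96 * s + 3) := by rw [← pow_add]; congr 1; ring
    _ ≤ _ := pow_le_pow_right₀ (by linarith) (by omega)

lemma zqe_real (s l : ℕ) (hl : 1 ≤ l) :
    (zqe s l : ℝ) = (if l ≤ 20 * s then 1 else 0) + (if l ≤ 18 * s then 1 else 0) +
      ((14 * s / l : ℕ) : ℝ) + 2 * (((16 * s / l : ℕ) : ℝ) - ((14 * s / l : ℕ) : ℝ)) -
      2 * ((if l ≤ 16 * s then 1 else 0) - (if l ≤ 14 * s then 1 else 0) +
        (if l ≤ 8 * s then 1 else 0) - (if l ≤ 7 * s then 1 else 0)) := by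
  have h : (zqe s l : ℤ) = (if l ≤ 20 * s then 1 else 0) + (if l ≤ 18 * s then 1 else 0) +
      ((14 * s / l : ℕ) : ℤ) + 2 * (((16 * s / l : ℕ) : ℤ) - ((14 * s / l : ℕ) : ℤ)) -
      2 * ((if l ≤ 16 * s then 1 else 0) - (if l ≤ 14 * s then 1 else 0) +
        (if l ≤ 8 * s then 1 else 0) - (if l ≤ 7 * s then 1 else 0)) := by
    unfold zqe
    have hmono : 14 * s / l ≤ 16 * s / l := Nat.div_le_div_right (by omega)
    by_cases h7 : l ≤ 7 * s
    · rw [if_pos h7, if_pos h7]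
      have a1 : l ≤ 8 * s := by omega
      have a2 : l ≤ 14 * s := by omega
      have a3 : l ≤ 16 * s := by omega
      have a4 : l ≤ 18 * s := by omega
      have a5 : l ≤ 20 * s := by omega
      simp only [a1, a2, a3, a4, a5, if_true]
      omega
    · have b1 := zq_div_cases (14 * s) l (by omega) (by omega)
      have b2 := zq_div_cases (16 * s) l (by omega) (by omega)
      generalize 14 * s / l = X at *
      generalize 16 * s / l = Y at *
      split_ifs <;> omega
  have h2 := congrArg (Int.cast : ℤ → ℝ) h
  simp only [Int.cast_add, Int.cast_sub, Int.cast_mul, Int.cast_ite, Int.cast_natCast,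
    Int.cast_one, Int.cast_zero, Int.cast_ofNat] at h2
  exact h2

lemma zq_logM0 (p s : ℕ) (hp : 2 ≤ p) :
    Real.log (zqM0 p s) = zqPsi p (20 * s) + zqPsi p (18 * s) + zqS p (14 * s) +
      2 * (zqS p (16 * s) - zqS p (14 * s)) -
      2 * (zqPsi p (16 * s) - zqPsi p (14 * s) + zqPsi p (8 * s) - zqPsi p (7 * s)) := by
  rw [zqPsi_eq' p (20 * s) (34 * s) (by omega), zqPsi_eq' p (18 * s) (34 * s) (by omega),
    zqPsi_eq' p (16 * s) (34 * s) (by omega), zqPsi_eq' p (14 * s) (34 * s) (by omega),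
    zqPsi_eq' p (8 * s) (34 * s) (by omega), zqPsi_eq' p (7 * s) (34 * s) (by omega),
    zqS_eq' p (14 * s) (34 * s) hp (by omega), zqS_eq' p (16 * s) (34 * s) hp (by omega)]
  unfold zqM0
  push_cast
  rw [Real.log_prod (fun l _ => pow_ne_zero _ (by exact_mod_cast (zqCyc_pos p l hp).ne'))]
  simp only [← Finset.sum_sub_distrib, ← Finset.sum_add_distrib, Finset.mul_sum]
  refine Finset.sum_congr rfl fun l hl => ?_
  rw [Real.log_pow, zqe_real s l (Finset.mem_Ioc.1 hl).1]
  unfold zqW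
  push_cast
  ring

open Filter Topology in
lemma zq_logM0_tendsto (p : ℕ) (hp : 2 ≤ p) :
    Tendsto (fun s : ℕ => Real.log (zqM0 p s) / (s : ℝ) ^ 2) atTop
      (𝓝 ((158 + 1722 / π ^ 2) * Real.log p)) := by
  have hS := fun k hk => zq_tendsto_scale (zqS p) _ k hk (zqS_tendsto p hp)
  have hP := fun k hk => zq_tendsto_scale (zqPsi p) _ k hk (zqPsi_tendsto p hp)
  have h := ((((hP 20 (by omega)).add (hP 18 (by omega))).add (hS 14 (by omega))).add
    (((hS 16 (by omega)).sub (hS 14 (by omega))).const_mul 2)).sub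
    (((((hP 16 (by omega)).sub (hP 14 (by omega))).add (hP 8 (by omega))).sub
      (hP 7 (by omega))).const_mul 2)
  convert h using 1
  · funext s
    rw [zq_logM0 p s hp]
    ring
  · congr 1
    push_cast
    ring


lemma zqZ_pos (p : ℕ) (hp : 2 ≤ p) : 0 < zqZ p := by
  have h := zq_lambert p hp
  have hpos : ∀ i : ℕ, 0 < zqf2 ((1 / (p : ℝ)) ^ (i + 1)) := by
    intro i
    have hp' : (2 : ℝ) ≤ p := by exact_mod_cast hp
    have h0 : (0 : ℝ) < 1 / p := by positivity
    have h1 : 1 / (p : ℝ) < 1 := by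
      rw [div_lt_one (by linarith)]; linarith
    have h2 : (1 / (p : ℝ)) ^ (i + 1) < 1 := pow_lt_one₀ h0.le h1 (by omega)
    have h3 : 0 < (1 / (p : ℝ)) ^ (i + 1) := by positivity
    have h4 : 0 < 1 - (1 / (p : ℝ)) ^ (i + 1) := by linarith
    unfold zqf2
    positivity
  have := h.summable.tsum_pos (fun i => (hpos i).le) 0 (hpos 0)
  rwa [h.tsum_eq] at this

lemma zqM_eq (p s : ℕ) (hp : 2 ≤ p) :
    zqM p s = Real.exp (Real.log (zqM0 p s) - (262 * (s : ℝ) ^ 2 - 11 * s) * Real.log p) := by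
  have hp' : (0 : ℝ) < p := by exact_mod_cast (by omega : 0 < p)
  have hM : 0 < zqM0 p s := by
    unfold zqM0
    exact Finset.prod_pos (fun l _ => pow_pos (zqCyc_pos p l hp) _)
  have hM' : (0 : ℝ) < zqM0 p s := by exact_mod_cast hM
  have hc : ((zqc s : ℕ) : ℝ) = 262 * (s : ℝ) ^ 2 - 11 * s := by
    unfold zqc
    rw [Nat.cast_sub (by nlinarith [Nat.le_self_pow (two_ne_zero) s])]
    push_cast; ring
  unfold zqM
  rw [Real.exp_sub, Real.exp_log hM', ← hc, mul_comm, ← Real.rpow_def_of_pos hp',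
    Real.rpow_natCast]

lemma zq_pow_exp (p n : ℕ) (hp : 2 ≤ p) : (p : ℝ) ^ n = Real.exp ((n : ℝ) * Real.log p) := by
  have hp' : (0 : ℝ) < p := by exact_mod_cast (by omega : 0 < p)
  rw [mul_comm, ← Real.rpow_def_of_pos hp', Real.rpow_natCast]

lemma zq_L_exp (p s : ℕ) (hp : 2 ≤ p) (hs : 1 ≤ s) :
    Real.exp (-((252 * (s : ℝ) ^ 2 + 46 * s + 1) * Real.log p)) ≤
      zqB p (14 * s) (zqU s) (zqm s) * zqZ p - zqA p (14 * s) (zqU s) (zqm s) ∧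
    zqB p (14 * s) (zqU s) (zqm s) * zqZ p - zqA p (14 * s) (zqU s) (zqm s) ≤
      Real.exp ((-(252 * (s : ℝ) ^ 2) + 2) * Real.log p) := by
  have hp2 : (2 : ℝ) ≤ p := by exact_mod_cast hp
  have hp0 : (0 : ℝ) < p := by linarith
  have h := zq_L_bounds p (14 * s) (18 * s + 1) hp (zqU s) (zqm s)
    (fun j hj => zq_m_one_two s j hs hj) (by omega) (zq_mm_sum s)
  refine ⟨le_trans ?_ h.1, h.2.trans ?_⟩
  · have e1 : Real.exp (-((252 * (s : ℝ) ^ 2 + 46 * s + 1) * Real.log p)) =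
        1 / ((p : ℝ) ^ (14 * s) * ((p : ℝ) ^ (14 * s + 1)) ^ (18 * s + 1)) := by
      rw [← pow_mul, ← pow_add, zq_pow_exp p _ hp, one_div, ← Real.exp_neg]
      congr 1
      push_cast
      ring
    rw [e1]
    apply one_div_le_one_div_of_le (by positivity)
    gcongr
  · have e2 : Real.exp ((-(252 * (s : ℝ) ^ 2) + 2) * Real.log p) =
        (p : ℝ) ^ (14 * s + 2 + (18 * s + 1)) / ((p : ℝ) ^ (14 * s + 1)) ^ (18 * s + 1) := by
      rw [← pow_mul, zq_pow_exp p _ hp, zq_pow_exp p _ hp, ← Real.exp_sub]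
      congr 1
      push_cast
      ring
    rw [e2]
    gcongr

open Filter Topology in
lemma zq_main (p : ℕ) (hp : 2 ≤ p) :
    {ab : ℤ × ℤ | |zqZ p - (ab.1 : ℝ) / (ab.2 : ℝ)| ≤
        |(ab.2 : ℝ)| ^ (-(10 * π ^ 2 / (5 * π ^ 2 - 24)))}.Finite := by
  have hp2 : (2 : ℝ) ≤ p := by exact_mod_cast hp
  have hlp : 0 < Real.log p := Real.log_pos (by linarith)
  have hP : 9 < π ^ 2 := by nlinarith [Real.pi_gt_three]
  have hev : ∀ᶠ s : ℕ in atTop,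
      |Real.log (zqM0 p s) / (s : ℝ) ^ 2 - (158 + 1722 / π ^ 2) * Real.log p| <
        1 / 10 * Real.log p := by
    have := (Metric.tendsto_nhds.1 (zq_logM0_tendsto p hp)) (1 / 10 * Real.log p) (by positivity)
    simpa only [Real.dist_eq] using this
  obtain ⟨s1, hs1⟩ := eventually_atTop.1 hev
  have hg : ∀ s : ℕ, s1 + 2000 ≤ s →
      (158 + 1722 / π ^ 2 - 1 / 10) * (s : ℝ) ^ 2 * Real.log p ≤ Real.log (zqM0 p s) ∧
      Real.log (zqM0 p s) ≤ (158 + 1722 / π ^ 2 + 1 / 10) * (s : ℝ) ^ 2 * Real.log p := by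
    intro s hs
    have hs0 : (0 : ℝ) < (s : ℝ) ^ 2 := by
      have : (0 : ℝ) < s := by exact_mod_cast (by omega : 0 < s)
      positivity
    have h := abs_lt.1 (hs1 s (by omega))
    have e : Real.log (zqM0 p s) = Real.log (zqM0 p s) / (s : ℝ) ^ 2 * (s : ℝ) ^ 2 := by
      rw [div_mul_cancel₀ _ hs0.ne']
    generalize Real.log (zqM0 p s) / (s : ℝ) ^ 2 = y at *
    rw [e]
    constructor
    · nlinarith [mul_pos (by linarith [h.1] :
        0 < y - (158 + 1722 / π ^ 2) * Real.log p + 1 / 10 * Real.log p) hs0]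
    · nlinarith [mul_pos (by linarith [h.2] :
        0 < 1 / 10 * Real.log p - (y - (158 + 1722 / π ^ 2) * Real.log p)) hs0]
  have hlin : ∀ s : ℕ, s1 + 2000 ≤ s →
      (110 * (s : ℝ) + 10) * Real.log p ≤ 1 / 10 * (s : ℝ) ^ 2 * Real.log p := by
    intro s hs
    have : (2000 : ℝ) ≤ s := by exact_mod_cast (by omega : 2000 ≤ s)
    apply mul_le_mul_of_nonneg_right _ hlp.le
    nlinarith
  have hAB : ∀ s : ℕ, ∃ AB : ℤ × ℤ, 1 ≤ s →
      (AB.1 : ℝ) = zqM p s * zqA p (14 * s) (zqU s) (zqm s) ∧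
      (AB.2 : ℝ) = zqM p s * zqB p (14 * s) (zqU s) (zqm s) := by
    intro s
    by_cases hs : 1 ≤ s
    · obtain ⟨A, hA⟩ := zq_int_A p s hp hs
      obtain ⟨B, hB⟩ := zq_int_B p s hp hs
      exact ⟨(A, B), fun _ => ⟨hA, hB⟩⟩
    · exact ⟨(0, 0), fun h => absurd h hs⟩
  choose AB hAB using hAB
  have hL : ∀ s : ℕ, s1 + 2000 ≤ s →
      |((AB s).2 : ℝ) * zqZ p - ((AB s).1 : ℝ)| = zqM p s *
      (zqB p (14 * s) (zqU s) (zqm s) * zqZ p - zqA p (14 * s) (zqU s) (zqm s)) := by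
    intro s hs
    have h1 := hAB s (by omega)
    have h2 := (zq_L_exp p s hp (by omega)).1
    have h3 : 0 < zqM p s := by rw [zqM_eq p s hp]; exact Real.exp_pos _
    rw [h1.1, h1.2]
    rw [show zqM p s * zqB p (14 * s) (zqU s) (zqm s) * zqZ p -
      zqM p s * zqA p (14 * s) (zqU s) (zqm s) = zqM p s *
      (zqB p (14 * s) (zqU s) (zqm s) * zqZ p - zqA p (14 * s) (zqU s) (zqm s)) by ring]
    exact abs_of_nonneg (mul_nonneg h3.le ((Real.exp_pos _).le.trans h2))
  have hi : 1722 / π ^ 2 < 200 := by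
    rw [div_lt_iff₀ (by positivity)]; nlinarith
  have hi0 : 0 < 1722 / π ^ 2 := by positivity
  refine zq_dioph (zqZ p) (zqZ_pos p hp).ne' _ ((344 + 1722 / π ^ 2 + 1 / 5) * Real.log p)
    ((356 - 1722 / π ^ 2 - 1 / 5) * Real.log p) ((356 - 1722 / π ^ 2 + 1 / 5) * Real.log p)
    (mul_pos (by linarith) hlp) (mul_nonneg (by linarith) hlp.le)
    (mul_le_mul_of_nonneg_right (by linarith) hlp.le) ?_
    (fun s => (AB s).1) (fun s => (AB s).2) (s1 + 2000) ?_ ?_ ?_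
  · have hd : 0 < 5 * π ^ 2 - 24 := by linarith
    have key : 700 + 2 / 5 < 10 * π ^ 2 / (5 * π ^ 2 - 24) * (356 - 1722 / π ^ 2 - 1 / 5) := by
      have e : 10 * π ^ 2 / (5 * π ^ 2 - 24) * (356 - 1722 / π ^ 2 - 1 / 5) =
          (3558 * π ^ 2 - 17220) / (5 * π ^ 2 - 24) := by
        field_simp
        ring
      rw [e, lt_div_iff₀ hd]
      linarith
    calc _ = (700 + 2 / 5) * Real.log p := by ring
      _ < (10 * π ^ 2 / (5 * π ^ 2 - 24) * (356 - 1722 / π ^ 2 - 1 / 5)) * Real.log p :=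
        mul_lt_mul_of_pos_right key hlp
      _ = _ := by ring
  · intro s hs
    have h1 := (hAB s (by omega)).2
    have h3 : 0 < zqM p s := by rw [zqM_eq p s hp]; exact Real.exp_pos _
    have h4 := hg s hs
    have h5 := hlin s hs
    rw [h1, abs_mul, abs_of_pos h3]
    refine (mul_le_mul_of_nonneg_left (zqB_bound p s hp (by omega)) h3.le).trans ?_
    rw [zqM_eq p s hp, zq_pow_exp p _ hp, ← Real.exp_add]
    apply Real.exp_le_exp.2
    push_cast
    nlinarith [h4.2]
  · intro s hs
    have h3 : 0 < zqM p s := by rw [zqM_eq p s hp]; exact Real.exp_pos _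
    have h4 := hg s hs
    have h5 := hlin s hs
    rw [hL s hs]
    refine le_trans ?_ (mul_le_mul_of_nonneg_left (zq_L_exp p s hp (by omega)).1 h3.le)
    rw [zqM_eq p s hp, ← Real.exp_add]
    apply Real.exp_le_exp.2
    have h6 : 0 ≤ (s : ℝ) * Real.log p := by positivity
    nlinarith [h4.1]
  · intro s hs
    have h3 : 0 < zqM p s := by rw [zqM_eq p s hp]; exact Real.exp_pos _
    have h4 := hg s hs
    have h5 := hlin s hs
    rw [hL s hs]
    refine (mul_le_mul_of_nonneg_left (zq_L_exp p s hp (by omega)).2 h3.le).trans ?_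
    rw [zqM_eq p s hp, ← Real.exp_add]
    apply Real.exp_le_exp.2
    have h6 : 0 ≤ (s : ℝ) * Real.log p := by positivity
    nlinarith [h4.2]

theorem zetaq2_irrationality_measure (p : ℕ) (hp : 2 ≤ p) :
    {ab : ℤ × ℤ |
      |(∑' k : ℕ, (k + 1 : ℝ) * ((1 : ℝ) / p) ^ (k + 1) / (1 - ((1 : ℝ) / p) ^ (k + 1))) -
          (ab.1 : ℝ) / (ab.2 : ℝ)| ≤
        |(ab.2 : ℝ)| ^ (-(10 * Real.pi ^ 2 / (5 * Real.pi ^ 2 - 24)))}.Finite := by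
  exact zq_main p hp
end
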